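/- Let G be a planar graph, let a, b be vertices in a common biconnected component B_i of G but in no common triconnected component, and let the path in T_3(B_i) between the rigid components R_a ∋ a and R_b ∋ b be R_a, P_1, R_1, ..., R_k, P_{k+1}, R_b. Suppose that: all vertices in {a} ∪ V(P_1) lie on a common face boundary in the planar embedding of R_a; all vertices in V(P_{k+1}) ∪ {b} lie on a common face boundary in the planar embedding of R_b; and for each i ∈ [k], all vertices in V(P_i) ∪ V(P_{i+1}) lie on a common face boundary in the planar embedding of R_i. Let G_{ab} be the subgraph of G consisting of the triconnected components R_a, R_1, ..., R_k, R_b. Then G_{ab} has a planar embedding in which all the separating-pair vertices ⋃_{i∈[k+1]} V(P_i) together with the vertices a and b lie on the boundary of the outer face. -/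

import Mathlib

open SimpleGraph

/-- The graph `G` with the edge `{a,b}` inserted. -/
def addEdge {W : Type*} (G : SimpleGraph W) (a b : W) : SimpleGraph W :=
  G ⊔ SimpleGraph.fromEdgeSet {s(a, b)}

/-- `u` and `v` are joined by a walk all of whose vertices lie in `A`,
i.e. they are connected in the subgraph induced on `A`. -/
def ReachableWithin {W : Type*} (G : SimpleGraph W) (A : Set W) (u v : W) : Prop :=
  ∃ p : G.Walk u v, ∀ x ∈ p.support, x ∈ A

/-- The subgraph of `G` induced on the vertex set `A` is connected. -/
def ConnectedOn {W : Type*} (G : SimpleGraph W) (A : Set W) : Prop :=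
  A.Nonempty ∧ ∀ ⦃u⦄, u ∈ A → ∀ ⦃v⦄, v ∈ A → ReachableWithin G A u v

/-- The subgraph of `G` induced on `A` is biconnected: connected and without cut vertices. -/
def BiconnectedOn {W : Type*} (G : SimpleGraph W) (A : Set W) : Prop :=
  ConnectedOn G A ∧ ∀ w ∈ A, (A \ {w}).Nonempty → ConnectedOn G (A \ {w})

/-- `B` is (the vertex set of) a block of `G`: a maximal biconnected subgraph. -/
def IsBlock {W : Type*} (G : SimpleGraph W) (B : Set W) : Prop :=
  BiconnectedOn G B ∧ ∀ B' : Set W, B ⊆ B' → BiconnectedOn G B' → B' = B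

/-- The subgraph of `G` induced on `A` is `k`-connected: it has more than `k` vertices
and remains connected after deleting any fewer than `k` vertices. -/
def KConnectedOn {W : Type*} (k : ℕ) (G : SimpleGraph W) (A : Set W) : Prop :=
  (∃ f : Fin (k + 1) → W, Function.Injective f ∧ ∀ i, f i ∈ A) ∧
  ∀ S : Set W, S.Finite → S.ncard < k → ConnectedOn G (A \ S)

/-- `G` is `k`-connected. -/
def KConnected {W : Type*} (k : ℕ) (G : SimpleGraph W) : Prop :=
  KConnectedOn k G Set.univ

/-- Two walks with common endpoints are internally vertex-disjoint: they share no
vertices other than the endpoints. -/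
def IntDisjoint {W : Type*} (G : SimpleGraph W) {s t : W} (p q : G.Walk s t) : Prop :=
  ∀ x, x ∈ p.support → x ∈ q.support → x = s ∨ x = t

/-- The subgraph of `G` induced on the vertex set `A` (with edges only inside `A`),
as a graph on the ambient vertex type. -/
def inducedOn {W : Type*} (G : SimpleGraph W) (A : Set W) : SimpleGraph W :=
  SimpleGraph.fromRel (fun u v => u ∈ A ∧ v ∈ A ∧ G.Adj u v)

/-- A planar drawing of the part of the graph `G` induced on the vertex set `A`:
vertices are distinct points of the plane and edges are arcs that meet
only at shared endpoints. -/
structure PlanarDrawingOn {W : Type*} (G : SimpleGraph W) (A : Set W) where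
  pos : W → ℝ × ℝ
  pos_inj : Set.InjOn pos A
  arc : Sym2 W → Set (ℝ × ℝ)
  arc_spec : ∀ ⦃u v : W⦄, u ∈ A → v ∈ A → G.Adj u v →
    ∃ f : ℝ → ℝ × ℝ, ContinuousOn f (Set.Icc 0 1) ∧ Set.InjOn f (Set.Icc 0 1) ∧
      f 0 = pos u ∧ f 1 = pos v ∧ f '' Set.Icc 0 1 = arc s(u, v)
  arc_inter : ∀ ⦃e₁ e₂ : Sym2 W⦄, e₁ ∈ G.edgeSet → e₂ ∈ G.edgeSet →
    (∀ x ∈ e₁, x ∈ A) → (∀ x ∈ e₂, x ∈ A) → e₁ ≠ e₂ →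
    arc e₁ ∩ arc e₂ ⊆ {p : ℝ × ℝ | ∃ v ∈ A, v ∈ e₁ ∧ v ∈ e₂ ∧ p = pos v}
  pos_arc : ∀ ⦃e : Sym2 W⦄, e ∈ G.edgeSet → (∀ x ∈ e, x ∈ A) →
    ∀ v ∈ A, pos v ∈ arc e → v ∈ e

namespace PlanarDrawingOn

variable {W : Type*} {G : SimpleGraph W} {A : Set W}

/-- The set of points of the plane used by the drawing. -/
def image (D : PlanarDrawingOn G A) : Set (ℝ × ℝ) :=
  D.pos '' A ∪ ⋃ e ∈ {e : Sym2 W | e ∈ G.edgeSet ∧ ∀ x ∈ e, x ∈ A}, D.arc e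

/-- A face of a drawing: a connected component of the complement of the drawing. -/
def IsFace (D : PlanarDrawingOn G A) (F : Set (ℝ × ℝ)) : Prop :=
  ∃ x ∈ D.imageᶜ, F = connectedComponentIn D.imageᶜ x

/-- The outer face of a drawing is its unbounded face. -/
def IsOuterFace (D : PlanarDrawingOn G A) (F : Set (ℝ × ℝ)) : Prop :=
  D.IsFace F ∧ ¬ Bornology.IsBounded F

end PlanarDrawingOn

/-- A graph is planar if it admits a planar drawing. -/
def SimpleGraph.IsPlanar {W : Type*} (G : SimpleGraph W) : Prop :=
  Nonempty (PlanarDrawingOn G Set.univ)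

/-- All vertices of `S` lie on the boundary of a common face in a planar embedding of
the part of `G` induced on `A`. -/
def OnCommonFace {W : Type*} (G : SimpleGraph W) (A : Set W) (S : Set W) : Prop :=
  ∃ (D : PlanarDrawingOn G A) (F : Set (ℝ × ℝ)),
    D.IsFace F ∧ ∀ v ∈ S, D.pos v ∈ frontier F

/-- There are three pairwise internally vertex-disjoint `s`–`t` paths
inside the vertex set `B`. -/
def ThreePathsOn {W : Type*} (G : SimpleGraph W) (B : Set W) (s t : W) : Prop :=
  ∃ p₁ p₂ p₃ : G.Walk s t,
    p₁.IsPath ∧ p₂.IsPath ∧ p₃.IsPath ∧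
    (∀ x ∈ p₁.support, x ∈ B) ∧ (∀ x ∈ p₂.support, x ∈ B) ∧ (∀ x ∈ p₃.support, x ∈ B) ∧
    p₁ ≠ p₂ ∧ p₁ ≠ p₃ ∧ p₂ ≠ p₃ ∧
    IntDisjoint G p₁ p₂ ∧ IntDisjoint G p₁ p₃ ∧ IntDisjoint G p₂ p₃

/-- `{s,t}` is a separating pair of (the subgraph induced on) `B`:
deleting both vertices disconnects it. -/
def SepPairOn {W : Type*} (G : SimpleGraph W) (B : Set W) (s t : W) : Prop :=
  s ∈ B ∧ t ∈ B ∧ s ≠ t ∧ (B \ {s, t}).Nonempty ∧ ¬ ConnectedOn G (B \ {s, t})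

/-- `{s,t}` is a 3-connected separating pair of `B`: a separating pair whose two
vertices are joined by three internally vertex-disjoint paths. -/
def TriSepPairOn {W : Type*} (G : SimpleGraph W) (B : Set W) (s t : W) : Prop :=
  SepPairOn G B s t ∧ ThreePathsOn G B s t

/-- Deleting the pair `{s,t}` separates `u` from `v` inside `B`. -/
def SeparatesOn {W : Type*} (G : SimpleGraph W) (B : Set W) (s t u v : W) : Prop :=
  u ∈ B \ {s, t} ∧ v ∈ B \ {s, t} ∧ ¬ ReachableWithin G (B \ {s, t}) u v

/-- `u` and `v` lie in a common triconnected component of `B`: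
no 3-connected separating pair separates them. -/
def SameTriCompOn {W : Type*} (G : SimpleGraph W) (B : Set W) (u v : W) : Prop :=
  u ∈ B ∧ v ∈ B ∧ ∀ s t : W, TriSepPairOn G B s t → ¬ SeparatesOn G B s t u v

/-- `R` is (the vertex set of) a triconnected component of the block `B`. -/
def IsTriCompOn {W : Type*} (G : SimpleGraph W) (B R : Set W) : Prop :=
  R ⊆ B ∧ R.Pairwise (SameTriCompOn G B) ∧
  ∀ R' : Set W, R ⊆ R' → R' ⊆ B → R'.Pairwise (SameTriCompOn G B) → R' = R

/-- The graph of the triconnected component on `R` of the block `B`: edges of `G`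
inside `R` together with virtual edges for 3-connected separating pairs inside `R`. -/
def triCompGraph {W : Type*} (G : SimpleGraph W) (B R : Set W) : SimpleGraph W :=
  SimpleGraph.fromRel (fun u v => u ∈ R ∧ v ∈ R ∧ (G.Adj u v ∨ TriSepPairOn G B u v))

/-- `R` is a rigid component (R-node): a triconnected component of `B` whose
component graph is 3-connected. -/
def IsRigidCompOn {W : Type*} (G : SimpleGraph W) (B R : Set W) : Prop :=
  IsTriCompOn G B R ∧ KConnectedOn 3 (triCompGraph G B R) R

/-- The restriction of the graph `H` to `R` is a cycle: connected, at least three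
vertices, and every vertex has exactly two neighbours. -/
def IsCycleGraphOn {W : Type*} (H : SimpleGraph W) (R : Set W) : Prop :=
  ConnectedOn H R ∧ 3 ≤ R.ncard ∧ R.Finite ∧
  ∀ v ∈ R, ∃ x y : W, x ≠ y ∧ {z : W | H.Adj v z} = {x, y}

/-- The path `R_a, P_1, R_1, …, R_k, P_(k+1), R_b` in the SPQR-tree `T_3(B)` of the
block `B`, between the rigid components `R 0 ∋ a` and `R (k+1) ∋ b`; `P i` is the
`i`-th 3-connected separating pair (P-node) on the path, adjacent to the rigid
components `R i` and `R (i+1)`. -/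
structure SPQRPathOn {W : Type*} (G : SimpleGraph W) (B : Set W) (a b : W) (k : ℕ) where
  R : Fin (k + 2) → Set W
  P : Fin (k + 1) → W × W
  rigid : ∀ i, IsRigidCompOn G B (R i)
  sep : ∀ i, TriSepPairOn G B (P i).1 (P i).2
  ha : a ∈ R 0
  hb : b ∈ R (Fin.last (k + 1))
  linkL : ∀ i : Fin (k + 1), (P i).1 ∈ R i.castSucc ∧ (P i).2 ∈ R i.castSucc
  linkR : ∀ i : Fin (k + 1), (P i).1 ∈ R i.succ ∧ (P i).2 ∈ R i.succ
  R_inj : Function.Injective R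
  P_inj : Function.Injective P

section
open Complex Set

/-! ### Part A: angles and the topological nonplanarity of `K_{3,3}` and `K_5` -/

lemma exists_log_sc {X : Type*} [TopologicalSpace X] [LocallyPathConnectedSpace X]
    [SimplyConnectedSpace X] {g : X → ℂ} (hg : Continuous g) (h0 : ∀ x, g x ≠ 0) :
    ∃ L : X → ℂ, Continuous L ∧ ∀ x, exp (L x) = g x := by
  obtain ⟨f, hf, he⟩ := Complex.exists_continuousOn_eqOn_exp_comp (X := X) (U := univ)
    (by
      have : SimplyConnectedSpace (univ : Set X) :=
        (Homeomorph.Set.univ X).toHomotopyEquiv.simplyConnectedSpace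
      exact this) isOpen_univ (g := g) hg.continuousOn (by simpa using h0)
  exact ⟨f, by simpa using hf, fun x => he (mem_univ x)⟩

lemma log_diff {f g : ℝ → ℂ} (hf : Continuous f) (hg : Continuous g)
    (h : ∀ x, exp (f x) = exp (g x)) (s t : ℝ) : f s - f t = g s - g t := by
  have hk : ∀ x, ∃ n : ℤ, f x = g x + n * (2 * Real.pi * I) := fun x =>
    Complex.exp_eq_exp_iff_exists_int.mp (h x)
  choose n hn using hk
  have hpi : (2 * Real.pi * I : ℂ) ≠ 0 := Complex.two_pi_I_ne_zero
  have hc : Continuous (fun x => ((n x : ℝ))) := by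
    have : (fun x => ((n x : ℝ))) = fun x => ((f x - g x) / (2 * Real.pi * I)).re := by
      funext x
      rw [hn x, add_sub_cancel_left, mul_div_assoc, div_self hpi]
      simp
    rw [this]
    exact continuous_re.comp ((hf.sub hg).div_const _)
  have hc' : Continuous n := by
    have := Int.isClosedEmbedding_coe_real.isEmbedding.continuous_iff (f := n)
    exact this.mpr hc
  have : n s = n t := by
    have := (PreconnectedSpace.constant (inferInstance : PreconnectedSpace ℝ) hc' (x := s) (y := t))
    exact this
  rw [hn s, hn t, this]; ring

/-- The change of (complex) logarithm of `γ - p` along `γ`. -/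
noncomputable def wnd (p : ℂ) (γ : ℝ → ℂ) : ℂ := by
  classical exact
  if h : ∃ L : ℝ → ℂ, Continuous L ∧ ∀ t, exp (L t) = γ t - p then h.choose 1 - h.choose 0 else 0

lemma wnd_eq {p : ℂ} {γ : ℝ → ℂ} {L : ℝ → ℂ} (hL : Continuous L)
    (h : ∀ t, exp (L t) = γ t - p) : wnd p γ = L 1 - L 0 := by
  have hex : ∃ L : ℝ → ℂ, Continuous L ∧ ∀ t, exp (L t) = γ t - p := ⟨L, hL, h⟩
  unfold wnd
  rw [dif_pos hex]
  exact log_diff hex.choose_spec.1 hL (fun x => by rw [hex.choose_spec.2, h]) 1 0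

lemma exp_pi_add (z : ℂ) : exp (z + Real.pi * I) = - exp z := by
  rw [exp_add, exp_pi_mul_I]; ring

lemma wnd_rel {γ δ : ℝ → ℂ} (hγ : Continuous γ) (hδ : Continuous δ) (h : ∀ s t, γ s ≠ δ t) :
    wnd (γ 1) δ + wnd (δ 0) γ = wnd (γ 0) δ + wnd (δ 1) γ ∧
    exp (wnd (γ 1) δ) = (δ 1 - γ 1) / (δ 0 - γ 1) ∧
    exp (wnd (δ 0) γ) = (γ 1 - δ 0) / (γ 0 - δ 0) ∧
    exp (wnd (γ 0) δ) = (δ 1 - γ 0) / (δ 0 - γ 0) ∧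
    exp (wnd (δ 1) γ) = (γ 1 - δ 1) / (γ 0 - δ 1) := by
  obtain ⟨L, hL, he⟩ := exists_log_sc (g := fun x : ℝ × ℝ => δ x.2 - γ x.1) (by fun_prop)
    (fun x => sub_ne_zero.mpr (h _ _).symm)
  have e1 : ∀ s, wnd (γ s) δ = L (s, 1) - L (s, 0) := fun s =>
    wnd_eq (L := fun t => L (s, t)) (by fun_prop) (fun t => he (s, t))
  have e2 : ∀ t, wnd (δ t) γ = L (1, t) - L (0, t) := fun t => by
    rw [wnd_eq (L := fun s => L (s, t) + Real.pi * I) (by fun_prop)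
      (fun s => by rw [exp_pi_add, he (s, t)]; ring)]
    ring
  have key : ∀ s t, (γ s - δ t) = -(δ t - γ s) := fun s t => by ring
  refine ⟨by rw [e1, e1, e2, e2]; ring, ?_, ?_, ?_, ?_⟩
  · rw [e1, exp_sub, he, he]
  · rw [e2, exp_sub, he, he, key, key 0, neg_div_neg_eq]
  · rw [e1, exp_sub, he, he]
  · rw [e2, exp_sub, he, he, key, key 0, neg_div_neg_eq]

/-- sign used to compare angles -/
def sg (m n : ℕ) : ℤ := if m < n then -1 else 1

lemma edge_system {ι : Type*} (r : ι → ℕ) (hr : Function.Injective r) (P : ι → ℂ)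
    (E : ι → ι → Prop) (γ : ι → ι → ℝ → ℂ) (hc : ∀ u v, E u v → Continuous (γ u v))
    (h0 : ∀ u v, E u v → γ u v 0 = P u) (h1 : ∀ u v, E u v → γ u v 1 = P v) :
    ∃ a : ι → ι → ι → ℤ, ∀ u v x y, E u v → E x y → (∀ s t, γ u v s ≠ γ x y t) →
      sg (r v) (r y) + sg (r x) (r v) + sg (r u) (r x) + sg (r y) (r u)
        + 2 * (a v x y + a x u v - a u x y - a y u v) = 0 := by
  classical
  let θ : ι → ι → ℂ := fun u v => if r u < r v then log (P v - P u) else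
    log (P u - P v) + Real.pi * I
  have hθ : ∀ u v, P u ≠ P v → exp (θ u v) = P v - P u := by
    intro u v huv
    simp only [θ]
    split_ifs
    · rw [exp_log (sub_ne_zero.mpr huv.symm)]
    · rw [exp_pi_add, exp_log (sub_ne_zero.mpr huv)]; ring
  have hsg : ∀ u v, u ≠ v → θ u v - θ v u = (sg (r u) (r v) : ℂ) * (Real.pi * I) := by
    intro u v huv
    have : r u ≠ r v := fun h => huv (hr h)
    simp only [θ, sg]
    rcases lt_or_gt_of_ne this with h | h
    · simp [h, h.not_gt]
    · simp [h, h.not_gt]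
  have ha : ∀ v x y, ∃ n : ℤ, P v ≠ P x → P v ≠ P y →
      exp (wnd (P v) (γ x y)) = (P y - P v) / (P x - P v) →
      wnd (P v) (γ x y) = θ v y - θ v x + n * (2 * Real.pi * I) := by
    intro v x y
    by_cases h : P v ≠ P x ∧ P v ≠ P y ∧
      exp (wnd (P v) (γ x y)) = (P y - P v) / (P x - P v)
    · have : exp (wnd (P v) (γ x y)) = exp (θ v y - θ v x) := by
        rw [exp_sub, hθ v y h.2.1, hθ v x h.1, h.2.2]
      obtain ⟨n, hn⟩ := Complex.exp_eq_exp_iff_exists_int.mp this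
      exact ⟨n, fun _ _ _ => hn⟩
    · exact ⟨0, fun h1 h2 h3 => absurd ⟨h1, h2, h3⟩ h⟩
  choose a ha using ha
  refine ⟨a, fun u v x y hE hF hd => ?_⟩
  obtain ⟨q0, q1, q2, q3, q4⟩ := wnd_rel (hc u v hE) (hc x y hF) hd
  have n1 := hd 1 1
  have n2 := hd 1 0
  have n3 := hd 0 1
  have n4 := hd 0 0
  rw [h0 u v hE, h1 u v hE, h0 x y hF, h1 x y hF] at *
  have m1 := ha v x y n2 n1 q1
  have m2 := ha x u v n4.symm n2.symm q2
  have m3 := ha u x y n4 n3 q3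
  have m4 := ha y u v n3.symm n1.symm q4
  rw [m1, m2, m3, m4] at q0
  have s1 := hsg v y (fun h => n1 (by rw [h]))
  have s2 := hsg x v (fun h => n2 (by rw [h]))
  have s3 := hsg u x (fun h => n4 (by rw [h]))
  have s4 := hsg y u (fun h => n3 (by rw [h]))
  have hpi : (Real.pi * I : ℂ) ≠ 0 := by
    simp [Real.pi_ne_zero]
  have : (((sg (r v) (r y) + sg (r x) (r v) + sg (r u) (r x) + sg (r y) (r u)
        + 2 * (a v x y + a x u v - a u x y - a y u v) : ℤ)) : ℂ) * (Real.pi * I) = 0 := by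
    push_cast
    linear_combination q0 - s1 - s2 - s3 - s4
  have := (mul_eq_zero.mp this).resolve_right hpi
  exact_mod_cast this

lemma joinedIn_real {E : Set ℂ} {x y : ℂ} (h : JoinedIn E x y) :
    ∃ γ : ℝ → ℂ, Continuous γ ∧ γ 0 = x ∧ γ 1 = y ∧ ∀ t, γ t ∈ E := by
  obtain ⟨p, hp⟩ := h
  refine ⟨p.extend, p.continuous_extend, by simp, by simp, fun t => ?_⟩
  have : p.extend t ∈ range p := by
    rw [← p.extend_range]; exact mem_range_self t
  obtain ⟨s, hs⟩ := this
  rw [← hs]; exact hp s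

lemma K33top (p q : Fin 3 → ℂ) (E : Fin 3 → Fin 3 → Set ℂ)
    (hE : ∀ i j, JoinedIn (E i j) (p i) (q j))
    (hd : ∀ i j k l, i < k → j ≠ l → Disjoint (E i j) (E k l)) : False := by
  choose γ hc h0 h1 hm using fun i j => joinedIn_real (hE i j)
  obtain ⟨a, ha⟩ := edge_system (ι := Fin 3 ⊕ Fin 3)
    (Sum.elim (fun i => i.val) (fun i => i.val + 3))
    (by decide) (Sum.elim p q)
    (fun u v => ∃ i j, u = .inl i ∧ v = .inr j)
    (fun u v => Sum.elim (fun i => Sum.elim (fun _ => fun _ => 0) (fun j => γ i j) v)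
      (fun _ => fun _ => 0) u)
    (by rintro u v ⟨i, j, rfl, rfl⟩; exact hc i j)
    (by rintro u v ⟨i, j, rfl, rfl⟩; exact h0 i j)
    (by rintro u v ⟨i, j, rfl, rfl⟩; exact h1 i j)
  have key : ∀ i j k l, i < k → j ≠ l → _ := fun i j k l hik hjl =>
    ha (.inl i) (.inr j) (.inl k) (.inr l) ⟨i, j, rfl, rfl⟩ ⟨k, l, rfl, rfl⟩
      (fun s t => (hd i j k l hik hjl).ne_of_mem (hm i j s) (hm k l t))
  have e1 := key 0 0 1 1 (by decide) (by decide)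
  have e2 := key 0 0 1 2 (by decide) (by decide)
  have e3 := key 0 1 1 0 (by decide) (by decide)
  have e4 := key 0 1 1 2 (by decide) (by decide)
  have e5 := key 0 2 1 0 (by decide) (by decide)
  have e6 := key 0 2 1 1 (by decide) (by decide)
  have f1 := key 0 0 2 1 (by decide) (by decide)
  have f2 := key 0 0 2 2 (by decide) (by decide)
  have f3 := key 0 1 2 0 (by decide) (by decide)
  have f4 := key 0 1 2 2 (by decide) (by decide)
  have f5 := key 0 2 2 0 (by decide) (by decide)
  have f6 := key 0 2 2 1 (by decide) (by decide)
  have g1 := key 1 0 2 1 (by decide) (by decide)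
  have g2 := key 1 0 2 2 (by decide) (by decide)
  have g3 := key 1 1 2 0 (by decide) (by decide)
  have g4 := key 1 1 2 2 (by decide) (by decide)
  have g5 := key 1 2 2 0 (by decide) (by decide)
  have g6 := key 1 2 2 1 (by decide) (by decide)
  clear key ha hd hE hm h0 h1 hc
  simp [sg] at *
  omega

lemma K5top (p : Fin 5 → ℂ) (E : Fin 5 → Fin 5 → Set ℂ)
    (hE : ∀ i j, i < j → JoinedIn (E i j) (p i) (p j))
    (hd : ∀ i j k l, i < j → k < l → i ≠ k → i ≠ l → j ≠ k → j ≠ l → Disjoint (E i j) (E k l)) :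
    False := by
  have : ∀ i j, ∃ γ : ℝ → ℂ, i < j → Continuous γ ∧ γ 0 = p i ∧ γ 1 = p j ∧ ∀ t, γ t ∈ E i j := by
    intro i j
    by_cases h : i < j
    · obtain ⟨γ, h'⟩ := joinedIn_real (hE i j h)
      exact ⟨γ, fun _ => h'⟩
    · exact ⟨fun _ => 0, fun h' => absurd h' h⟩
  choose γ hγ using this
  obtain ⟨a, ha⟩ := edge_system (ι := Fin 5) (fun i => i.val) (by decide) p
    (fun u v => u < v) γ (fun u v h => (hγ u v h).1) (fun u v h => (hγ u v h).2.1)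
    (fun u v h => (hγ u v h).2.2.1)
  have key : ∀ i j k l, i < j → k < l → i ≠ k → i ≠ l → j ≠ k → j ≠ l → _ :=
    fun i j k l hij hkl h1 h2 h3 h4 =>
    ha i j k l hij hkl
      (fun s t => (hd i j k l hij hkl h1 h2 h3 h4).ne_of_mem ((hγ i j hij).2.2.2 s)
        ((hγ k l hkl).2.2.2 t))
  have e01 := key 1 2 3 4 (by decide) (by decide) (by decide) (by decide) (by decide) (by decide)
  have e02 := key 1 3 2 4 (by decide) (by decide) (by decide) (by decide) (by decide) (by decide)
  have e03 := key 1 4 2 3 (by decide) (by decide) (by decide) (by decide) (by decide) (by decide)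
  have e11 := key 0 2 3 4 (by decide) (by decide) (by decide) (by decide) (by decide) (by decide)
  have e12 := key 0 3 2 4 (by decide) (by decide) (by decide) (by decide) (by decide) (by decide)
  have e13 := key 0 4 2 3 (by decide) (by decide) (by decide) (by decide) (by decide) (by decide)
  have e21 := key 0 1 3 4 (by decide) (by decide) (by decide) (by decide) (by decide) (by decide)
  have e22 := key 0 3 1 4 (by decide) (by decide) (by decide) (by decide) (by decide) (by decide)
  have e23 := key 0 4 1 3 (by decide) (by decide) (by decide) (by decide) (by decide) (by decide)
  have e31 := key 0 1 2 4 (by decide) (by decide) (by decide) (by decide) (by decide) (by decide)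
  have e32 := key 0 2 1 4 (by decide) (by decide) (by decide) (by decide) (by decide) (by decide)
  have e33 := key 0 4 1 2 (by decide) (by decide) (by decide) (by decide) (by decide) (by decide)
  have e41 := key 0 1 2 3 (by decide) (by decide) (by decide) (by decide) (by decide) (by decide)
  have e42 := key 0 2 1 3 (by decide) (by decide) (by decide) (by decide) (by decide) (by decide)
  have e43 := key 0 3 1 2 (by decide) (by decide) (by decide) (by decide) (by decide) (by decide)
  clear key ha hd hE hγ
  simp [sg] at *
  omega

end

section
open Complex Set

/-! ### An arc does not separate the plane -/

lemma arc_bounded_false {f : ℝ → ℂ} (hf : ContinuousOn f (Icc 0 1)) (hi : InjOn f (Icc 0 1))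
    {V : Set ℂ} (hVo : IsOpen V) (hVn : V.Nonempty) (hb : Bornology.IsBounded V)
    (hfr : frontier V ⊆ f '' Icc 0 1) (hd : Disjoint V (f '' Icc 0 1)) : False := by
  obtain ⟨p, hp⟩ := hVn
  have hpK : ∀ t ∈ Icc (0:ℝ) 1, f t ≠ p := fun t ht h =>
    Set.disjoint_left.mp hd hp ⟨t, ht, h⟩
  let f' : Icc (0:ℝ) 1 → ℂ := fun t => f t
  have hf' : Continuous f' := continuousOn_iff_continuous_domRestrict.mp hf
  have hcl : Topology.IsClosedEmbedding f' :=
    hf'.isClosedEmbedding (fun x y h => Subtype.ext (hi x.2 y.2 h))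
  obtain ⟨L, hL, he⟩ := exists_log_sc (X := ℝ)
    (g := fun t => f' (projIcc 0 1 zero_le_one t) - p)
    ((hf'.comp continuous_projIcc).sub continuous_const)
    (fun t => sub_ne_zero.mpr (hpK _ (projIcc 0 1 zero_le_one t).2))
  obtain ⟨g, hg⟩ := ContinuousMap.exists_extension hcl
    (⟨fun t => L t, hL.comp continuous_subtype_val⟩ : C(Icc (0:ℝ) 1, ℂ))
  have hgK : ∀ z ∈ f '' Icc 0 1, exp (g z) = z - p := by
    rintro z ⟨t, ht, rfl⟩
    have h1 : g (f t) = L t := congrArg (fun k => k ⟨t, ht⟩) hg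
    rw [h1, he t, projIcc_of_mem zero_le_one ht]
  classical
  let h : ℂ → ℂ := V.piecewise (fun z => exp (g z)) (fun z => z - p)
  have hh : Continuous h := by
    apply Continuous.piecewise
    · intro a ha; exact hgK a (hfr ha)
    · fun_prop
    · fun_prop
  have hh0 : ∀ z, h z ≠ 0 := by
    intro z
    by_cases hz : z ∈ V
    · simp [h, hz]
    · simp only [h, piecewise_eq_of_notMem _ _ _ hz]
      exact sub_ne_zero.mpr (fun e => hz (e ▸ hp))
  obtain ⟨H, hH, hHe⟩ := exists_log_sc hh hh0
  obtain ⟨r, hr⟩ := hb.subset_ball p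
  have hr0 : 0 < r := by
    by_contra hc
    have := hr hp
    simp [Metric.mem_ball] at this
    exact hc this
  have hout : ∀ θ : ℝ, p + r * exp (θ * I) ∉ V := by
    intro θ hz
    have := hr hz
    simp [Metric.mem_ball, dist_eq, norm_exp_ofReal_mul_I, abs_of_pos hr0] at this
  have := log_diff (f := fun θ : ℝ => H (p + r * exp (θ * I)))
    (g := fun θ : ℝ => log r + θ * I) (by fun_prop) (by fun_prop)
    (fun θ => by
      rw [hHe, exp_add, exp_log (by exact_mod_cast hr0.ne')]
      simp only [h, piecewise_eq_of_notMem _ _ _ (hout θ)]; ring) (2 * Real.pi) 0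
  simp [exp_two_pi_mul_I] at this

lemma ext_ball_conn {r : ℝ} (hr0 : 0 < r) : IsPreconnected (Metric.closedBall (0:ℂ) r)ᶜ := by
  have : (Metric.closedBall (0:ℂ) r)ᶜ = exp '' {z : ℂ | Real.log r < z.re} := by
    ext z
    simp only [mem_compl_iff, Metric.mem_closedBall, dist_zero_right, not_le, mem_image,
      mem_ofPred_eq]
    constructor
    · intro h
      have hz : z ≠ 0 := by rintro rfl; simp at h; linarith
      refine ⟨log z, ?_, exp_log hz⟩
      rw [log_re]; exact Real.log_lt_log hr0 h
    · rintro ⟨w, hw, rfl⟩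
      rw [norm_exp]
      exact (Real.log_lt_iff_lt_exp hr0).mp hw
  rw [this]
  exact ((convex_halfSpace_re_gt _).isPreconnected).image _ continuous_exp.continuousOn

lemma arc_not_sep {f : ℝ → ℂ} (hf : ContinuousOn f (Icc 0 1)) (hi : InjOn f (Icc 0 1))
    {V : Set ℂ} (hVo : IsOpen V) (hVn : V.Nonempty)
    (hfr : frontier V ⊆ f '' Icc 0 1) (hd : Disjoint V (f '' Icc 0 1)) :
    V ∪ f '' Icc 0 1 = univ := by
  set K := f '' Icc 0 1 with hK
  have hKc : IsCompact K := isCompact_Icc.image_of_continuousOn hf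
  by_contra hne
  obtain ⟨c, hc⟩ := (ne_univ_iff_exists_notMem _).mp hne
  rw [mem_union, not_or] at hc
  have hWo : IsOpen (closure V ∪ K)ᶜ := (isClosed_closure.union hKc.isClosed).isOpen_compl
  have hcl : closure V ⊆ V ∪ K := by
    rw [closure_eq_self_union_frontier]; exact union_subset_union_right _ hfr
  have hcl2 : closure V ∪ K = V ∪ K := subset_antisymm
    (union_subset hcl subset_union_right) (union_subset_union_left _ subset_closure)
  have hVb : ¬ Bornology.IsBounded V := fun hb => arc_bounded_false hf hi hVo hVn hb hfr hd
  have hWb : ¬ Bornology.IsBounded (V ∪ K)ᶜ := by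
    intro hb
    refine arc_bounded_false hf hi (V := (V ∪ K)ᶜ) (hcl2 ▸ hWo) ⟨c, ?_⟩ hb ?_ ?_
    · simp [hc]
    · rw [frontier_compl]
      refine (frontier_union_subset _ _).trans ?_
      refine union_subset (inter_subset_left.trans hfr) ?_
      exact inter_subset_right.trans hKc.isClosed.frontier_subset
    · exact Set.disjoint_left.mpr (fun x hx hx' => hx (Or.inr hx'))
  obtain ⟨r, hr0, hr⟩ : ∃ r : ℝ, 0 < r ∧ K ⊆ Metric.closedBall 0 r := by
    obtain ⟨r, hr⟩ := hKc.isBounded.subset_closedBall 0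
    exact ⟨max r 1, by positivity, hr.trans (Metric.closedBall_subset_closedBall (le_max_left _ _))⟩
  have hconn : IsPreconnected (Metric.closedBall (0:ℂ) r)ᶜ := by
    exact ext_ball_conn hr0
  have hex : ∀ S : Set ℂ, ¬ Bornology.IsBounded S → ((Metric.closedBall (0:ℂ) r)ᶜ ∩ S).Nonempty := by
    intro S hS
    by_contra hcon
    apply hS
    refine Metric.isBounded_closedBall.subset (s := S) (t := Metric.closedBall (0:ℂ) r) ?_
    intro x hx
    by_contra hx'
    exact hcon ⟨x, hx', hx⟩
  obtain ⟨x, hx1, hx2, hx3⟩ := hconn V (V ∪ K)ᶜ hVo (hcl2 ▸ hWo)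
    (fun x hx => by
      by_cases h : x ∈ V
      · exact Or.inl h
      · refine Or.inr (fun h' => ?_)
        rcases h' with h' | h'
        · exact h h'
        · exact hx (hr h')) (hex V hVb) (hex _ hWb)
  exact hx3 (Or.inl hx2)

end

section
open Set

/-! ### Part C: set-based connectivity, contraction -/

section Comb

variable {α : Type*}

/-- set-based connectivity of the subgraph induced on `A` -/
def Cn (H : SimpleGraph α) (A : Set α) : Prop :=
  A.Nonempty ∧ ∀ C ⊆ A, C.Nonempty → (A \ C).Nonempty → ∃ x ∈ C, ∃ y ∈ A \ C, H.Adj x y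

/-- no edge from `C` to the rest of `A` -/
def Clo (H : SimpleGraph α) (A C : Set α) : Prop := ∀ x ∈ C, ∀ y ∈ A, H.Adj x y → y ∈ C

lemma Cn.edge {H : SimpleGraph α} {A C : Set α} (h : Cn H A) (hC : C ⊆ A) (hn : C.Nonempty)
    {v : α} (hv : v ∈ A) (hv' : v ∉ C) : ∃ x ∈ C, ∃ y ∈ A, y ∉ C ∧ H.Adj x y := by
  obtain ⟨x, hx, y, hy, e⟩ := h.2 C hC hn ⟨v, hv, hv'⟩
  exact ⟨x, hx, y, hy.1, hy.2, e⟩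

lemma not_cn {H : SimpleGraph α} {A : Set α} (hA : A.Nonempty) (h : ¬ Cn H A) :
    ∃ C ⊆ A, C.Nonempty ∧ (A \ C).Nonempty ∧ Clo H A C := by
  unfold Cn at h
  push Not at h
  obtain ⟨C, h1, h2, h3, h4⟩ := h hA
  refine ⟨C, h1, h2, h3, fun x hx y hy e => ?_⟩
  by_contra hc
  exact h4 x hx y ⟨hy, hc⟩ e

lemma Cn.clo_eq {H : SimpleGraph α} {A C : Set α} (h : Cn H A) (hC : C ⊆ A) (hn : C.Nonempty)
    (hc : Clo H A C) : C = A := by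
  by_contra hne
  obtain ⟨v, hv, hv'⟩ := not_subset.mp (fun h' => hne (subset_antisymm hC h'))
  obtain ⟨x, hx, y, hy, hy', e⟩ := h.edge hC hn hv hv'
  exact hy' (hc x hx y hy e)

lemma Clo.compl {H : SimpleGraph α} {A C : Set α} (h : Clo H A C) :
    Clo H A (A \ C) := fun x hx y hy e =>
  ⟨hy, fun hyC => hx.2 (h y hyC x hx.1 e.symm)⟩

lemma cn_singleton (H : SimpleGraph α) (a : α) : Cn H {a} := by
  refine ⟨singleton_nonempty a, fun C hC hn hd => ?_⟩
  obtain ⟨x, hx⟩ := hn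
  obtain ⟨y, hy, hy'⟩ := hd
  have h1 := hC hx
  simp only [mem_singleton_iff] at h1 hy
  subst h1; subst hy
  exact absurd hx hy'

lemma Cn.mono {H H' : SimpleGraph α} {A : Set α} (h : Cn H A)
    (hH : ∀ x ∈ A, ∀ y ∈ A, H.Adj x y → H'.Adj x y) : Cn H' A := by
  refine ⟨h.1, fun C hC hn hd => ?_⟩
  obtain ⟨x, hx, y, hy, e⟩ := h.2 C hC hn hd
  exact ⟨x, hx, y, hy, hH x (hC hx) y hy.1 e⟩

lemma Cn.union {H : SimpleGraph α} {A B : Set α} (hA : Cn H A) (hB : Cn H B)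
    (hAB : (∃ x ∈ A, ∃ y ∈ B, x = y ∨ H.Adj x y)) : Cn H (A ∪ B) := by
  refine ⟨hA.1.inl, fun C hC hn hd => ?_⟩
  by_contra hno
  push Not at hno
  have hclo : Clo H (A ∪ B) C := fun x hx y hy e => by
    by_contra hc; exact hno x hx y ⟨hy, hc⟩ e
  have key : ∀ D : Set α, D ⊆ A ∪ B → Cn H D → (D ∩ C).Nonempty → D ⊆ C := by
    intro D hD hDc hne
    have := hDc.clo_eq (C := D ∩ C) inter_subset_left hne
      (fun x hx y hy e => ⟨hy, hclo x hx.2 y (hD hy) e⟩)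
    exact inter_eq_left.mp this
  obtain ⟨x, hx, y, hy, hxy⟩ := hAB
  obtain ⟨c, hc⟩ := hn
  obtain ⟨d, hd, hd'⟩ := hd
  have hxyC : x ∈ C ↔ y ∈ C := by
    rcases hxy with rfl | e
    · rfl
    · exact ⟨fun h => hclo x h y (Or.inr hy) e, fun h => hclo y h x (Or.inl hx) e.symm⟩
  have hA' := key A subset_union_left hA
  have hB' := key B subset_union_right hB
  have : A ⊆ C ∧ B ⊆ C := by
    rcases hC hc with h | h
    · have h1 := hA' ⟨c, h, hc⟩
      exact ⟨h1, hB' ⟨y, hy, hxyC.mp (h1 hx)⟩⟩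
    · have h1 := hB' ⟨c, h, hc⟩
      exact ⟨hA' ⟨x, hx, hxyC.mpr (h1 hy)⟩, h1⟩
  rcases hd with h | h
  · exact hd' (this.1 h)
  · exact hd' (this.2 h)

lemma cn_pair {H : SimpleGraph α} {a b : α} (h : H.Adj a b) : Cn H {a, b} := by
  have := (cn_singleton H a).union (cn_singleton H b) ⟨a, rfl, b, rfl, Or.inr h⟩
  rw [insert_eq]; exact this

/-- connected component of `x` in `A` -/
lemma exists_comp (H : SimpleGraph α) {A : Set α} {x : α} (hx : x ∈ A) :
    ∃ C ⊆ A, x ∈ C ∧ Cn H C ∧ Clo H A C := by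
  let C : Set α := ⋃₀ {D | D ⊆ A ∧ x ∈ D ∧ Cn H D}
  have hxC : x ∈ C := ⟨{x}, ⟨by simpa using hx, rfl, cn_singleton H x⟩, rfl⟩
  have hCA : C ⊆ A := sUnion_subset (fun D hD => hD.1)
  have hCn : Cn H C := by
    refine ⟨⟨x, hxC⟩, fun E hE hn hd => ?_⟩
    by_contra hno
    push Not at hno
    have hclo : ∀ u ∈ C, ∀ v ∈ C, H.Adj u v → (u ∈ E ↔ v ∈ E) := by
      intro u hu v hv e
      constructor
      · intro h; by_contra h'; exact hno u h v ⟨hv, h'⟩ e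
      · intro h; by_contra h'; exact hno v h u ⟨hu, h'⟩ e.symm
    have key : ∀ v ∈ C, (v ∈ E ↔ x ∈ E) := by
      rintro v ⟨D, ⟨hDA, hxD, hDc⟩, hvD⟩
      have hDC : D ⊆ C := fun w hw => ⟨D, ⟨hDA, hxD, hDc⟩, hw⟩
      by_cases h : x ∈ E
      · have := hDc.clo_eq (C := D ∩ E) inter_subset_left ⟨x, hxD, h⟩
          (fun a ha b hb e => ⟨hb, (hclo a (hDC ha.1) b (hDC hb) e).mp ha.2⟩)
        have h2 : v ∈ D ∩ E := by rw [this]; exact hvD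
        exact ⟨fun _ => h, fun _ => h2.2⟩
      · have := hDc.clo_eq (C := D \ E) sdiff_subset ⟨x, hxD, h⟩
          (fun a ha b hb e => ⟨hb, fun hbE => ha.2 ((hclo a (hDC ha.1) b (hDC hb) e).mpr hbE)⟩)
        have h2 : v ∈ D \ E := by rw [this]; exact hvD
        exact ⟨fun h' => absurd h' h2.2, fun h' => absurd h' h⟩
    obtain ⟨c, hc⟩ := hn
    obtain ⟨d, hd, hd'⟩ := hd
    exact hd' ((key d hd).mpr ((key c (hE hc)).mp hc))
  refine ⟨C, hCA, hxC, hCn, fun u hu v hv e => ?_⟩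
  refine ⟨C ∪ {v}, ⟨union_subset hCA (by simpa using hv), Or.inl hxC, ?_⟩, Or.inr rfl⟩
  exact hCn.union (cn_singleton H v) ⟨u, hu, v, rfl, Or.inr e⟩

/-- contraction of `y` into `x` -/
def ctr (H : SimpleGraph α) (x y : α) : SimpleGraph α where
  Adj u v := u ≠ v ∧ u ≠ y ∧ v ≠ y ∧ (H.Adj u v ∨ (u = x ∧ H.Adj y v) ∨ (v = x ∧ H.Adj u y))
  symm := ⟨by
    rintro u v ⟨h1, h2, h3, h4⟩
    refine ⟨h1.symm, h3, h2, ?_⟩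
    rcases h4 with h | ⟨h, h'⟩ | ⟨h, h'⟩
    · exact Or.inl h.symm
    · exact Or.inr (Or.inr ⟨h, h'.symm⟩)
    · exact Or.inr (Or.inl ⟨h, h'.symm⟩)⟩
  loopless := ⟨fun u h => h.1 rfl⟩

/-- lifting of vertex sets along the contraction -/
def lft (x y : α) (C : Set α) : Set α := {u | u ∈ C ∨ (u = y ∧ x ∈ C)}

lemma lft_of_notMem {x y : α} {C : Set α} (h : x ∉ C) : lft x y C = C := by
  ext u; simp [lft, h]

lemma subset_lft (x y : α) (C : Set α) : C ⊆ lft x y C := fun _ h => Or.inl h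

lemma ctr_edge_lft {H : SimpleGraph α} {x y u v : α} {C D : Set α} (hu : u ∈ C) (hv : v ∈ D)
    (h : (ctr H x y).Adj u v) : ∃ u' ∈ lft x y C, ∃ v' ∈ lft x y D, H.Adj u' v' := by
  obtain ⟨h1, h2, h3, h4 | ⟨rfl, h4⟩ | ⟨rfl, h4⟩⟩ := h
  · exact ⟨u, Or.inl hu, v, Or.inl hv, h4⟩
  · exact ⟨y, Or.inr ⟨rfl, hu⟩, v, Or.inl hv, h4⟩
  · exact ⟨u, Or.inl hu, y, Or.inr ⟨rfl, hv⟩, h4⟩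

lemma cn_lft {H : SimpleGraph α} {x y : α} (hxy : H.Adj x y) {C : Set α} (hy : y ∉ C) :
    Cn (ctr H x y) C ↔ Cn H (lft x y C) := by
  constructor
  · rintro ⟨hne, h⟩
    refine ⟨hne.mono (subset_lft _ _ _), fun D hD hn hd => ?_⟩
    by_cases hx : x ∈ C
    · by_cases hxD : x ∈ D
      · by_cases hyD : y ∈ D
        · obtain ⟨w, hw, hwD⟩ := hd
          have hwC : w ∈ C := by
            rcases hw with h | ⟨rfl, _⟩
            · exact h
            · exact absurd hyD hwD
          obtain ⟨u, hu, v, hv, e⟩ := h (D ∩ C) inter_subset_right ⟨x, hxD, hx⟩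
            ⟨w, hwC, fun h => hwD h.1⟩
          have hvD : v ∉ D := fun h => hv.2 ⟨h, hv.1⟩
          obtain ⟨h1, h2, h3, h4 | ⟨rfl, h4⟩ | ⟨rfl, h4⟩⟩ := e
          · exact ⟨u, hu.1, v, ⟨Or.inl hv.1, hvD⟩, h4⟩
          · exact ⟨y, hyD, v, ⟨Or.inl hv.1, hvD⟩, h4⟩
          · exact absurd hxD hvD
        · exact ⟨x, hxD, y, ⟨Or.inr ⟨rfl, hx⟩, hyD⟩, hxy⟩
      · by_cases hyD : y ∈ D
        · exact ⟨y, hyD, x, ⟨Or.inl hx, hxD⟩, hxy.symm⟩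
        · obtain ⟨w, hw⟩ := hn
          have hDC : D ⊆ C := by
            intro w hw
            rcases hD hw with h | ⟨rfl, _⟩
            · exact h
            · exact absurd hw hyD
          obtain ⟨u, hu, v, hv, e⟩ := h D hDC ⟨w, hw⟩ ⟨x, hx, hxD⟩
          obtain ⟨h1, h2, h3, h4 | ⟨rfl, h4⟩ | ⟨rfl, h4⟩⟩ := e
          · exact ⟨u, hu, v, ⟨Or.inl hv.1, hv.2⟩, h4⟩
          · exact absurd hu hxD
          · exact ⟨u, hu, y, ⟨Or.inr ⟨rfl, hx⟩, hyD⟩, h4⟩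
    · rw [lft_of_notMem hx] at *
      obtain ⟨u, hu, v, hv, e⟩ := h D hD hn hd
      obtain ⟨h1, h2, h3, h4 | ⟨rfl, h4⟩ | ⟨rfl, h4⟩⟩ := e
      · exact ⟨u, hu, v, hv, h4⟩
      · exact absurd (hD hu) hx
      · exact absurd hv.1 hx
  · rintro ⟨hne, h⟩
    refine ⟨?_, fun D hD hn hd => ?_⟩
    · obtain ⟨w, hw | ⟨_, hw⟩⟩ := hne
      · exact ⟨w, hw⟩
      · exact ⟨x, hw⟩
    · obtain ⟨u, hu, v, ⟨hv, hv'⟩, e⟩ := h (lft x y D)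
        (fun w hw => hw.elim (fun h => Or.inl (hD h)) (fun h => Or.inr ⟨h.1, hD h.2⟩))
        (hn.mono (subset_lft _ _ _)) (by
          obtain ⟨w, hw, hwD⟩ := hd
          refine ⟨w, Or.inl hw, ?_⟩
          rintro (h | ⟨rfl, _⟩)
          · exact hwD h
          · exact hy hw)
      have hyD : y ∉ D := fun h => hy (hD h)
      simp only [lft, mem_ofPred_eq, not_or, not_and] at hu hv hv'
      rcases hu with hu | ⟨rfl, hu⟩
      · rcases hv with hv | ⟨rfl, hv⟩
        · exact ⟨u, hu, v, ⟨hv, hv'.1⟩, fun h => hv'.1 (h ▸ hu), fun h => hyD (h ▸ hu),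
            fun h => hy (h ▸ hv), Or.inl e⟩
        · refine ⟨u, hu, x, ⟨hv, hv'.2 rfl⟩, fun h => hv'.2 rfl (h ▸ hu), fun h => hyD (h ▸ hu),
            hxy.ne, Or.inr (Or.inr ⟨rfl, e⟩)⟩
      · rcases hv with hv | ⟨rfl, hv⟩
        · refine ⟨x, hu, v, ⟨hv, hv'.1⟩, fun h => hv'.1 (h ▸ hu), hxy.ne, fun h => hy (h ▸ hv),
            Or.inr (Or.inl ⟨rfl, e⟩)⟩
        · exact absurd e (H.irrefl)

lemma lft_disjoint {x y : α} {C D : Set α} (hC : y ∉ C) (hD : y ∉ D) (h : Disjoint C D) :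
    Disjoint (lft x y C) (lft x y D) := by
  rw [Set.disjoint_left] at *
  rintro u (hu | ⟨rfl, hu⟩) (hv | ⟨e, hv⟩)
  · exact h hu hv
  · exact hC (e ▸ hu)
  · exact hD hv
  · exact h hu hv

lemma lft_subset {x y : α} {A C : Set α} (hy : y ∈ A) (h : C ⊆ A \ {y}) : lft x y C ⊆ A := by
  rintro u (hu | ⟨rfl, _⟩)
  · exact (h hu).1
  · exact hy

/-- `K_{3,3}` minor models -/
def K33M (H : SimpleGraph α) (A : Set α) : Prop :=
  ∃ B C : Fin 3 → Set α, (∀ i, B i ⊆ A ∧ Cn H (B i)) ∧ (∀ i, C i ⊆ A ∧ Cn H (C i)) ∧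
    (∀ i j, i ≠ j → Disjoint (B i) (B j)) ∧ (∀ i j, i ≠ j → Disjoint (C i) (C j)) ∧
    (∀ i j, Disjoint (B i) (C j)) ∧ ∀ i j, ∃ u ∈ B i, ∃ v ∈ C j, H.Adj u v

/-- `K_5` minor models -/
def K5M (H : SimpleGraph α) (A : Set α) : Prop :=
  ∃ B : Fin 5 → Set α, (∀ i, B i ⊆ A ∧ Cn H (B i)) ∧
    (∀ i j, i ≠ j → Disjoint (B i) (B j)) ∧ ∀ i j, i < j → ∃ u ∈ B i, ∃ v ∈ B j, H.Adj u v

lemma K33M.lift {H : SimpleGraph α} {A : Set α} {x y : α} (hxy : H.Adj x y) (hyA : y ∈ A)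
    (h : K33M (ctr H x y) (A \ {y})) : K33M H A := by
  obtain ⟨B, C, hB, hC, dB, dC, dBC, e⟩ := h
  have hBy : ∀ i, y ∉ B i := fun i h => ((hB i).1 h).2 rfl
  have hCy : ∀ i, y ∉ C i := fun i h => ((hC i).1 h).2 rfl
  refine ⟨fun i => lft x y (B i), fun i => lft x y (C i),
    fun i => ⟨lft_subset hyA (hB i).1, (cn_lft hxy (hBy i)).mp (hB i).2⟩,
    fun i => ⟨lft_subset hyA (hC i).1, (cn_lft hxy (hCy i)).mp (hC i).2⟩,
    fun i j h => lft_disjoint (hBy i) (hBy j) (dB i j h),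
    fun i j h => lft_disjoint (hCy i) (hCy j) (dC i j h),
    fun i j => lft_disjoint (hBy i) (hCy j) (dBC i j), fun i j => ?_⟩
  obtain ⟨u, hu, v, hv, h⟩ := e i j
  exact ctr_edge_lft hu hv h

lemma K5M.lift {H : SimpleGraph α} {A : Set α} {x y : α} (hxy : H.Adj x y) (hyA : y ∈ A)
    (h : K5M (ctr H x y) (A \ {y})) : K5M H A := by
  obtain ⟨B, hB, dB, e⟩ := h
  have hBy : ∀ i, y ∉ B i := fun i h => ((hB i).1 h).2 rfl
  refine ⟨fun i => lft x y (B i),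
    fun i => ⟨lft_subset hyA (hB i).1, (cn_lft hxy (hBy i)).mp (hB i).2⟩,
    fun i j h => lft_disjoint (hBy i) (hBy j) (dB i j h), fun i j h => ?_⟩
  obtain ⟨u, hu, v, hv, h⟩ := e i j h
  exact ctr_edge_lft hu hv h

end Comb

end

section
open Set

/-! ### 2- and 3-connected vertex sets, contractible edges -/

section Comb

variable {α : Type*}

lemma exists_two {S : Set α} (h : 2 ≤ S.ncard) : ∃ x ∈ S, ∃ y ∈ S, x ≠ y := by
  have hf : S.Finite := finite_of_ncard_ne_zero (by omega)
  obtain ⟨x, hx, y, hy, h⟩ := (one_lt_ncard (hs := hf)).mp (by omega)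
  exact ⟨x, hx, y, hy, h⟩

lemma exists_notMem_of_card {A S : Set α} (hS : S.Finite) (h : S.ncard < A.ncard) :
    ∃ v ∈ A, v ∉ S := by
  obtain ⟨v, hv, hv'⟩ := exists_mem_notMem_of_ncard_lt_ncard h hS
  exact ⟨v, hv, hv'⟩

lemma ncard_pair_le (a b : α) : ({a, b} : Set α).ncard ≤ 2 := ncard_insert_le _ _ |>.trans (by simp)

lemma ncard_triple_le (a b c : α) : ({a, b, c} : Set α).ncard ≤ 3 :=
  (ncard_insert_le _ _).trans (by have := ncard_pair_le b c; omega)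

lemma ncard_quad_le (a b c d : α) : ({a, b, c, d} : Set α).ncard ≤ 4 :=
  (ncard_insert_le _ _).trans (by have := ncard_triple_le b c d; omega)

lemma cn_up {H : SimpleGraph α} {A : Set α} (hf : A.Finite) (hc : 3 ≤ A.ncard)
    (h : ∀ q ∈ A, Cn H (A \ {q})) : Cn H A := by
  by_contra hn
  have hne : A.Nonempty := by
    rw [nonempty_iff_ne_empty]; rintro rfl; simp at hc
  obtain ⟨C, hC, hCn, ⟨d, hd⟩, hclo⟩ := not_cn hne hn
  obtain ⟨c, hcC⟩ := hCn
  obtain ⟨q, hq, hq'⟩ := exists_notMem_of_card (A := A) (S := {c, d}) (toFinite _)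
    (by have := ncard_pair_le c d; omega)
  simp only [mem_insert_iff, mem_singleton_iff, not_or] at hq'
  obtain ⟨x, hx, y, hy, hy', e⟩ := (h q hq).edge (C := C \ {q})
    (fun u hu => ⟨hC hu.1, hu.2⟩) ⟨c, hcC, fun e => hq'.1 e.symm⟩ (v := d)
    ⟨hd.1, fun e => hq'.2 e.symm⟩ (fun h => hd.2 h.1)
  exact hy' ⟨hclo x hx.1 y hy.1 e, hy.2⟩

/-- 2-connected -/
def BC (H : SimpleGraph α) (A : Set α) : Prop :=
  A.Finite ∧ 3 ≤ A.ncard ∧ ∀ p ∈ A, Cn H (A \ {p})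

/-- 3-connected -/
def TC (H : SimpleGraph α) (A : Set α) : Prop :=
  A.Finite ∧ 4 ≤ A.ncard ∧ ∀ p ∈ A, ∀ q ∈ A, p ≠ q → Cn H (A \ {p, q})

lemma BC.cn {H : SimpleGraph α} {A : Set α} (h : BC H A) : Cn H A := cn_up h.1 h.2.1 h.2.2

lemma TC.cn1 {H : SimpleGraph α} {A : Set α} (h : TC H A) {p : α} (hp : p ∈ A) :
    Cn H (A \ {p}) := by
  refine cn_up h.1.sdiff ?_ ?_
  · have := ncard_sdiff_singleton_of_mem hp
    have := h.2.1
    omega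
  · intro q hq
    have := h.2.2 p hp q hq.1 (fun e => hq.2 e.symm)
    rwa [sdiff_sdiff]

lemma TC.cn {H : SimpleGraph α} {A : Set α} (h : TC H A) : Cn H A :=
  cn_up h.1 (by have := h.2.1; omega) (fun _ hq => h.cn1 hq)

lemma TC.cn2 {H : SimpleGraph α} {A : Set α} (h : TC H A) (p q : α) : Cn H (A \ {p, q}) := by
  by_cases hp : p ∈ A
  · by_cases hq : q ∈ A
    · by_cases hpq : p = q
      · subst hpq; simpa using h.cn1 hp
      · exact h.2.2 p hp q hq hpq
    · have : A \ {p, q} = A \ {p} := by ext u; simp; grind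
      rw [this]; exact h.cn1 hp
  · by_cases hq : q ∈ A
    · have : A \ {p, q} = A \ {q} := by ext u; simp; grind
      rw [this]; exact h.cn1 hq
    · have : A \ {p, q} = A := by ext u; simp; grind
      rw [this]; exact h.cn

/-- every vertex has a neighbour outside any two given vertices -/
lemma TC.nbr {H : SimpleGraph α} {A : Set α} (h : TC H A) {n : α} (hn : n ∈ A) (p q : α)
    (hp : n ≠ p) (hq : n ≠ q) : ∃ m ∈ A, m ≠ p ∧ m ≠ q ∧ H.Adj n m := by
  obtain ⟨v, hv, hv'⟩ := exists_notMem_of_card (A := A) (S := {n, p, q}) (toFinite _)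
    (by have := ncard_triple_le n p q; have := h.2.1; omega)
  simp only [mem_insert_iff, mem_singleton_iff, not_or] at hv'
  obtain ⟨x, hx, y, hy, hy', e⟩ := (h.cn2 p q).edge (C := {n}) (by simp [hn, hp, hq])
    ⟨n, rfl⟩ (v := v) (by simp [hv, hv']) (by simp [hv'])
  simp only [mem_singleton_iff] at hx
  subst hx
  simp only [mem_sdiff, mem_insert_iff, mem_singleton_iff, not_or] at hy
  exact ⟨y, hy.1, hy.2.1, hy.2.2, e⟩

lemma TC.bc {H : SimpleGraph α} {A : Set α} (h : TC H A) (h5 : 5 ≤ A.ncard) {x y : α}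
    (hx : x ∈ A) (hy : y ∈ A) (hxy : x ≠ y)
    (hc : ∀ w ∈ A, w ≠ x → w ≠ y → Cn H (A \ {x, y, w})) : BC H (A \ {x, y}) := by
  refine ⟨h.1.sdiff, ?_, ?_⟩
  · have := le_ncard_sdiff {x, y} A (hs := toFinite _)
    have := ncard_pair_le x y
    omega
  · intro p hp
    simp only [mem_sdiff, mem_insert_iff, mem_singleton_iff, not_or] at hp
    have := hc p hp.1 hp.2.1 hp.2.2
    rw [sdiff_sdiff]
    convert this using 2
    ext; simp; tauto

lemma noncontr {H : SimpleGraph α} {A : Set α} (h : TC H A) (h5 : 5 ≤ A.ncard) {x y : α}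
    (hx : x ∈ A) (hy : y ∈ A) (hxy : H.Adj x y) (hn : ¬ TC (ctr H x y) (A \ {y})) :
    ∃ w ∈ A, w ≠ x ∧ w ≠ y ∧ ¬ Cn H (A \ {x, y, w}) := by
  by_contra hcon
  push Not at hcon
  apply hn
  refine ⟨h.1.sdiff, ?_, ?_⟩
  · have := ncard_sdiff_singleton_of_mem hy
    omega
  · intro p hp q hq hpq
    rw [cn_lft hxy (by simp)]
    by_cases hpx : p = x
    · subst hpx
      rw [lft_of_notMem (by simp)]
      have := hcon q hq.1 hpq.symm hq.2
      convert this using 1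
      ext; simp; tauto
    · by_cases hqx : q = x
      · subst hqx
        rw [lft_of_notMem (by simp)]
        have := hcon p hp.1 hpq hp.2
        convert this using 1
        ext; simp; tauto
      · have := h.cn2 p q
        convert this using 1
        ext u
        have h1 := hp.2
        have h2 := hq.2
        have h3 := hxy.ne
        simp only [lft, mem_sdiff, mem_insert_iff, mem_singleton_iff, mem_ofPred_eq] at *
        grind

/-- converse direction -/
lemma contr_cn {H : SimpleGraph α} {A : Set α} {x y : α} (hx : x ∈ A)
    (hxy : H.Adj x y) (hn : TC (ctr H x y) (A \ {y})) {w : α} (hw : w ∈ A) (hwx : w ≠ x)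
    (hwy : w ≠ y) : Cn H (A \ {x, y, w}) := by
  have := hn.2.2 x ⟨hx, hxy.ne⟩ w ⟨hw, hwy⟩ hwx.symm
  rw [cn_lft hxy (by simp), lft_of_notMem (by simp)] at this
  convert this using 1
  ext; simp; tauto

lemma contractible_aux {H : SimpleGraph α} {A τ : Set α} (h : TC H A) (h5 : 5 ≤ A.ncard)
    (hnc : ∀ x ∈ A, ∀ y ∈ A, H.Adj x y → y ∉ τ → ¬ TC (ctr H x y) (A \ {y})) :
    ∀ n : ℕ, ∀ x y w : α, ∀ D : Set α, D.ncard = n → x ∈ A → y ∈ A → w ∈ A → H.Adj x y →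
      w ≠ x → w ≠ y → D ⊆ A \ {x, y, w} → D.Nonempty → Clo H (A \ {x, y, w}) D →
      Disjoint D τ → False := by
  intro n
  induction n using Nat.strong_induction_on with
  | _ n ih =>
  intro x y w D hDn hx hy hw hxy hwx hwy hD hDne hclo hDτ
  -- `w` has a neighbour in `D`
  have hDf : D.Finite := h.1.subset (fun u hu => (hD hu).1)
  have hDx : x ∉ D := fun hu => (hD hu).2 (by simp)
  have hDy : y ∉ D := fun hu => (hD hu).2 (by simp)
  have hDw : w ∉ D := fun hu => (hD hu).2 (by simp)
  have hclo' : ∀ u ∈ D, ∀ v ∈ A, H.Adj u v → v ∈ D ∨ v = x ∨ v = y ∨ v = w := by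
    intro u hu v hv e
    by_cases hc : v ∈ ({x, y, w} : Set α)
    · right; simpa using hc
    · left; exact hclo u hu v ⟨hv, hc⟩ e
  obtain ⟨u, hu, w', hw', hw'D, e⟩ := (h.cn2 x y).edge (C := D)
    (fun u hu => ⟨(hD hu).1, fun h => (hD hu).2 (by simp at h ⊢; tauto)⟩) hDne (v := w)
    (by simp [hw, hwx, hwy]) hDw
  have : w' = w := by
    rcases hclo' u hu w' hw'.1 e with h | h | h | h
    · exact absurd h hw'D
    · exact absurd h (fun h => hw'.2 (by simp [h]))
    · exact absurd h (fun h => hw'.2 (by simp [h]))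
    · exact h
  subst this
  have huA : u ∈ A := (hD hu).1
  obtain ⟨q, hq, hqw, hqu, hncn⟩ := noncontr h h5 hw huA e.symm
    (hnc w' hw u huA e.symm (Set.disjoint_left.mp hDτ hu))
  have hne : (A \ {w', u, q}).Nonempty := by
    obtain ⟨v, hv, hv'⟩ := exists_notMem_of_card (A := A) (S := {w', u, q}) (toFinite _)
      (by have := ncard_triple_le w' u q; omega)
    exact ⟨v, hv, hv'⟩
  obtain ⟨C, hC, hCne, hCne', hCclo⟩ := not_cn hne hncn
  have hux : u ≠ x := fun h => hDx (h ▸ hu)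
  have huy : u ≠ y := fun h => hDy (h ▸ hu)
  -- choose the side that avoids x, y
  obtain ⟨D2, hD2, hD2ne, hD2ne', hD2clo, hD2x, hD2y⟩ : ∃ D2 ⊆ A \ {w', u, q}, D2.Nonempty ∧
      ((A \ {w', u, q}) \ D2).Nonempty ∧ Clo H (A \ {w', u, q}) D2 ∧ x ∉ D2 ∧ y ∉ D2 := by
    by_cases hxC : x ∈ C ∨ y ∈ C
    · refine ⟨(A \ {w', u, q}) \ C, sdiff_subset, hCne', ?_, hCclo.compl, ?_, ?_⟩
      · obtain ⟨v, hv⟩ := hCne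
        exact ⟨v, hC hv, fun h => h.2 hv⟩
      · intro hx'
        rcases hxC with h | h
        · exact hx'.2 h
        · exact hx'.2 (hCclo y h x hx'.1 hxy.symm)
      · intro hx'
        rcases hxC with h | h
        · exact hx'.2 (hCclo x h y hx'.1 hxy)
        · exact hx'.2 h
    · push Not at hxC
      exact ⟨C, hC, hCne, hCne', hCclo, hxC.1, hxC.2⟩
  have hD2' : ∀ v ∈ D2, v ∈ A ∧ v ≠ w' ∧ v ≠ u ∧ v ≠ q := fun v hv => by
    have := hD2 hv
    simp only [mem_sdiff, mem_insert_iff, mem_singleton_iff, not_or] at this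
    exact this
  obtain ⟨v, hv, u', hu', hu'D, e'⟩ := (h.cn2 w' q).edge (C := D2)
    (fun v hv => by have := hD2' v hv; simp; tauto) hD2ne (v := u)
    (by simp [huA, hqu.symm, e.ne]) (fun hh => (hD2' u hh).2.2.1 rfl)
  have hu'u : u' = u := by
    by_contra hne
    apply hu'D
    refine hD2clo v hv u' ⟨hu'.1, ?_⟩ e'
    have := hu'.2
    simp at this ⊢
    tauto
  subst hu'u
  have hvD : v ∈ D := by
    rcases hclo' u' hu v (hD2' v hv).1 e'.symm with h | h | h | h
    · exact h
    · exact absurd (h ▸ hv) hD2x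
    · exact absurd (h ▸ hv) hD2y
    · exact absurd h (hD2' v hv).2.1
  refine ih (D2 ∩ D).ncard ?_ w' u' q (D2 ∩ D) rfl hw huA hq e.symm hqw hqu
    (fun z hz => hD2 hz.1) ⟨v, hv, hvD⟩ ?_ (hDτ.mono_left inter_subset_right)
  · rw [← hDn]
    refine ncard_lt_ncard ⟨inter_subset_right, fun hh => ?_⟩ hDf
    exact (hD2' u' (hh hu).1).2.2.1 rfl
  · intro a ha b hb eab
    have hb2 := hD2clo a ha.1 b hb eab
    refine ⟨hb2, ?_⟩
    rcases hclo' a ha.2 b hb.1 eab with h | h | h | h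
    · exact h
    · exact absurd (h ▸ hb2) hD2x
    · exact absurd (h ▸ hb2) hD2y
    · exact absurd h (hD2' b hb2).2.1

lemma contractible {H : SimpleGraph α} {A : Set α} {z s t : α} (h : TC H A) (h5 : 5 ≤ A.ncard)
    (hzs : H.Adj z s) (hst : H.Adj s t) (hzt : H.Adj z t) :
    ∃ x ∈ A, ∃ y ∈ A, H.Adj x y ∧ y ∉ ({z, s, t} : Set α) ∧ TC (ctr H x y) (A \ {y}) := by
  by_contra hcon
  push Not at hcon
  have hnc : ∀ x ∈ A, ∀ y ∈ A, H.Adj x y → y ∉ ({z, s, t} : Set α) →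
    ¬ TC (ctr H x y) (A \ {y}) := fun x hx y hy e hyt => hcon x hx y hy e hyt
  obtain ⟨y, hy, hyτ⟩ := exists_notMem_of_card (A := A) (S := {z, s, t}) (toFinite _)
    (by have := ncard_triple_le z s t; omega)
  obtain ⟨x, hx, -, -, e⟩ := h.nbr hy z z (fun h => hyτ (by simp [h])) (fun h => hyτ (by simp [h]))
  obtain ⟨w, hw, hwx, hwy, hncn⟩ := noncontr h h5 hx hy e.symm (hnc x hx y hy e.symm hyτ)
  have hne : (A \ {x, y, w}).Nonempty := by
    obtain ⟨v, hv, hv'⟩ := exists_notMem_of_card (A := A) (S := {x, y, w}) (toFinite _)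
      (by have := ncard_triple_le x y w; omega)
    exact ⟨v, hv, hv'⟩
  obtain ⟨C, hC, hCne, hCne', hCclo⟩ := not_cn hne hncn
  have hτ : ∀ u ∈ ({z, s, t} : Set α), ∀ v ∈ ({z, s, t} : Set α), u ≠ v → H.Adj u v := by
    have := hzs.symm; have := hst.symm; have := hzt.symm
    simp only [mem_insert_iff, mem_singleton_iff]
    rintro u (rfl | rfl | rfl) v (rfl | rfl | rfl) hne <;> first | exact absurd rfl hne | assumption
  by_cases hd : Disjoint C {z, s, t}
  · exact contractible_aux h h5 hnc _ x y w C rfl hx hy hw e.symm hwx hwy hC hCne hCclo hd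
  · refine contractible_aux h h5 hnc _ x y w ((A \ {x, y, w}) \ C) rfl hx hy hw e.symm hwx hwy
      sdiff_subset hCne' hCclo.compl ?_
    obtain ⟨u, hu, huτ⟩ := not_disjoint_iff.mp hd
    rw [Set.disjoint_left]
    intro v hv hvτ
    exact hv.2 (hCclo u hu v hv.1 (hτ u huτ v hvτ (fun h => hv.2 (h ▸ hu))))

/-- contraction step for 2-connected graphs -/
lemma bc_contr {H : SimpleGraph α} {A : Set α} (h : BC H A) (h4 : 4 ≤ A.ncard) {v : α}
    (hv : v ∈ A) : ∃ x ∈ A, H.Adj x v ∧ BC (ctr H x v) (A \ {v}) := by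
  by_contra hcon
  push Not at hcon
  have hnc : ∀ x ∈ A, H.Adj x v → ¬ Cn H (A \ {v, x}) := by
    intro x hx e hcn
    refine hcon x hx e ⟨h.1.sdiff, ?_, ?_⟩
    · have := ncard_sdiff_singleton_of_mem hv
      omega
    · intro p hp
      rw [cn_lft e (by simp)]
      by_cases hpx : p = x
      · subst hpx
        rw [lft_of_notMem (by simp), sdiff_sdiff]
        exact hcn
      · have := h.2.2 p hp.1
        convert this using 1
        ext u
        have h1 := hp.2
        have h3 := e.ne
        simp only [lft, mem_sdiff, mem_singleton_iff, mem_ofPred_eq] at *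
        grind
  have aux : ∀ n : ℕ, ∀ w D, D.ncard = n → w ∈ A → w ≠ v → D ⊆ A \ {v, w} → D.Nonempty →
      Clo H (A \ {v, w}) D → False := by
    intro n
    induction n using Nat.strong_induction_on with
    | _ n ih =>
    intro w D hDn hw hwv hD hDne hclo
    have hDf : D.Finite := h.1.subset (fun u hu => (hD hu).1)
    have hD' : ∀ u ∈ D, u ∈ A ∧ u ≠ v ∧ u ≠ w := fun u hu => by
      have := hD hu
      simpa only [mem_sdiff, mem_insert_iff, mem_singleton_iff, not_or] using this
    obtain ⟨x, hx, v', hv', hv'D, e⟩ := (h.2.2 w hw).edge (C := D)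
      (fun u hu => ⟨(hD' u hu).1, (hD' u hu).2.2⟩) hDne (v := v) ⟨hv, hwv.symm⟩
      (fun hh => (hD' v hh).2.1 rfl)
    have : v' = v := by
      by_contra hne
      exact hv'D (hclo x hx v' ⟨hv'.1, by have := hv'.2; simp at this ⊢; tauto⟩ e)
    subst this
    have hxA := (hD' x hx).1
    have hne : (A \ {v', x}).Nonempty := by
      obtain ⟨u, hu, hu'⟩ := exists_notMem_of_card (A := A) (S := {v', x}) (toFinite _)
        (by have := ncard_pair_le v' x; omega)
      exact ⟨u, hu, hu'⟩
    obtain ⟨C, hC, hCne, hCne', hCclo⟩ := not_cn hne (hnc x hxA e)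
    obtain ⟨D2, hD2, hD2ne, hD2clo, hD2w⟩ : ∃ D2 ⊆ A \ {v', x}, D2.Nonempty ∧
        Clo H (A \ {v', x}) D2 ∧ w ∉ D2 := by
      by_cases hwC : w ∈ C
      · exact ⟨_, sdiff_subset, hCne', hCclo.compl, fun h => h.2 hwC⟩
      · exact ⟨C, hC, hCne, hCclo, hwC⟩
    have hD2' : ∀ u ∈ D2, u ∈ A ∧ u ≠ v' ∧ u ≠ x := fun u hu => by
      have := hD2 hu
      simpa only [mem_sdiff, mem_insert_iff, mem_singleton_iff, not_or] using this
    obtain ⟨a, ha, x', hx', hx'D, e'⟩ := (h.2.2 v' hv).edge (C := D2)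
      (fun u hu => ⟨(hD2' u hu).1, (hD2' u hu).2.1⟩) hD2ne (v := x)
      ⟨hxA, (hD' x hx).2.1⟩ (fun hh => (hD2' x hh).2.2 rfl)
    have : x' = x := by
      by_contra hne
      exact hx'D (hD2clo a ha x' ⟨hx'.1, by have := hx'.2; simp at this ⊢; tauto⟩ e')
    subst this
    have haD : a ∈ D := hclo x' hx a ⟨(hD2' a ha).1, by
      have := (hD2' a ha).2.1
      have : a ≠ w := fun h => hD2w (h ▸ ha)
      simp; tauto⟩ e'.symm
    refine ih (D2 ∩ D).ncard ?_ x' (D2 ∩ D) rfl hxA (hD' x' hx).2.1 (fun u hu => hD2 hu.1)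
      ⟨a, ha, haD⟩ ?_
    · rw [← hDn]
      refine ncard_lt_ncard ⟨inter_subset_right, fun hh => ?_⟩ hDf
      exact (hD2' x' (hh hx).1).2.2 rfl
    · intro p hp q hq epq
      have hq2 := hD2clo p hp.1 q hq epq
      refine ⟨hq2, hclo p hp.2 q ⟨hq.1, ?_⟩ epq⟩
      have := (hD2' q hq2).2.1
      have : q ≠ w := fun h => hD2w (h ▸ hq2)
      simp; tauto
  -- start
  obtain ⟨u, hu, huv⟩ := exists_notMem_of_card (A := A) (S := {v}) (toFinite _)
    (by simp; omega)
  obtain ⟨v', hv', x, hx, hxv, e⟩ := h.cn.edge (C := {v}) (by simpa using hv) ⟨v, rfl⟩ hu huv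
  simp only [mem_singleton_iff] at hv' hxv
  subst hv'
  have hne : (A \ {v', x}).Nonempty := by
    obtain ⟨u, hu, hu'⟩ := exists_notMem_of_card (A := A) (S := {v', x}) (toFinite _)
      (by have := ncard_pair_le v' x; omega)
    exact ⟨u, hu, hu'⟩
  obtain ⟨C, hC, hCne, hCne', hCclo⟩ := not_cn hne (hnc x hx e.symm)
  exact aux _ x C rfl hx hxv hC hCne hCclo

end Comb

end

section
open Set

section Comb

variable {α : Type*}

lemma three_lemma : ∀ m : ℕ, ∀ (H : SimpleGraph α) (A : Set α), A.ncard = m → BC H A →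
    ∀ n : Fin 3 → α, Function.Injective n → (∀ i, n i ∈ A) →
    ∃ N : Fin 3 → Set α, (∀ i, n i ∈ N i ∧ N i ⊆ A ∧ Cn H (N i)) ∧
      (∀ i j, i ≠ j → Disjoint (N i) (N j)) ∧
      ∀ i j, i ≠ j → ∃ u ∈ N i, ∃ v ∈ N j, H.Adj u v := by
  intro m
  induction m using Nat.strong_induction_on with
  | _ m ih =>
  intro H A hm h n hn hnA
  have hr : (range n).ncard = 3 := by
    rw [← image_univ, ncard_image_of_injective _ hn, ncard_univ]; simp
  by_cases h4 : 4 ≤ A.ncard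
  · obtain ⟨v, hv, hv'⟩ := exists_notMem_of_card (A := A) (S := range n) (toFinite _) (by omega)
    obtain ⟨x, hx, e, hbc⟩ := bc_contr h h4 hv
    have hnv : ∀ i, n i ≠ v := fun i hi => hv' ⟨i, hi⟩
    obtain ⟨N, h1, h2, h3⟩ := ih (A \ {v}).ncard
      (by have := ncard_sdiff_singleton_of_mem hv; omega) _ _ rfl hbc n hn
      (fun i => ⟨hnA i, hnv i⟩)
    have hNv : ∀ i, v ∉ N i := fun i hi => ((h1 i).2.1 hi).2 rfl
    refine ⟨fun i => lft x v (N i), fun i => ⟨subset_lft _ _ _ (h1 i).1,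
      lft_subset hv (h1 i).2.1, (cn_lft e (hNv i)).mp (h1 i).2.2⟩,
      fun i j hij => lft_disjoint (hNv i) (hNv j) (h2 i j hij), fun i j hij => ?_⟩
    obtain ⟨u, hu, w, hw, e'⟩ := h3 i j hij
    exact ctr_edge_lft hu hw e'
  · have h3 := h.2.1
    have hA : range n = A := eq_of_subset_of_ncard_le (range_subset_iff.mpr hnA) (by omega) h.1
    refine ⟨fun i => {n i}, fun i => ⟨rfl, by simpa using hnA i, cn_singleton _ _⟩,
      fun i j hij => by simpa using fun h => hij (hn h), fun i j hij => ?_⟩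
    obtain ⟨k, hki, hkj, hk⟩ : ∃ k : Fin 3, k ≠ i ∧ k ≠ j ∧ ∀ m, m = i ∨ m = j ∨ m = k := by
      revert i j; decide
    obtain ⟨u, hu, y, hy, hy', e⟩ := (h.2.2 (n k) (hnA k)).edge (C := {n i})
      (by simpa using ⟨hnA i, fun h => hki (hn h).symm⟩) ⟨n i, rfl⟩ (v := n j)
      ⟨hnA j, fun h => hkj (hn h).symm⟩ (fun h => hij (hn h).symm)
    simp only [mem_singleton_iff] at hu
    subst hu
    rw [← hA] at hy
    obtain ⟨⟨l, rfl⟩, hyk⟩ := hy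
    refine ⟨_, rfl, n j, rfl, ?_⟩
    rcases hk l with rfl | rfl | rfl
    · exact absurd rfl hy'
    · exact e
    · exact absurd rfl hyk

lemma four_lemma : ∀ m : ℕ, ∀ (H : SimpleGraph α) (A : Set α), A.ncard = m → BC H A →
    ∀ n : Fin 4 → α, Function.Injective n → (∀ i, n i ∈ A) →
    (∃ C ⊆ A, ∃ D ⊆ A, Cn H C ∧ Cn H D ∧ Disjoint C D ∧ n 0 ∈ C ∧ n 2 ∈ C ∧ n 1 ∈ D ∧ n 3 ∈ D ∧
      ∃ u ∈ C, ∃ v ∈ D, H.Adj u v) ∨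
    ∃ N : Fin 4 → Set α, (∀ i, n i ∈ N i ∧ N i ⊆ A ∧ Cn H (N i)) ∧
      (∀ i j, i ≠ j → Disjoint (N i) (N j)) ∧
      ∀ i, ∃ u ∈ N i, ∃ v ∈ N (i + 1), H.Adj u v := by
  intro m
  induction m using Nat.strong_induction_on with
  | _ m ih =>
  intro H A hm h n hn hnA
  have hr : (range n).ncard = 4 := by
    rw [← image_univ, ncard_image_of_injective _ hn, ncard_univ]; simp
  have hle : 4 ≤ A.ncard := by
    rw [← hr]; exact ncard_le_ncard (range_subset_iff.mpr hnA) h.1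
  by_cases h5 : 5 ≤ A.ncard
  · obtain ⟨v, hv, hv'⟩ := exists_notMem_of_card (A := A) (S := range n) (toFinite _) (by omega)
    obtain ⟨x, hx, e, hbc⟩ := bc_contr h hle hv
    have hnv : ∀ i, n i ≠ v := fun i hi => hv' ⟨i, hi⟩
    rcases ih (A \ {v}).ncard
      (by have := ncard_sdiff_singleton_of_mem hv; omega) _ _ rfl hbc n hn
      (fun i => ⟨hnA i, hnv i⟩) with ⟨C, hC, D, hD, h1, h2, h3, h4, h5, h6, h7, u, hu, w, hw, e'⟩ |
        ⟨N, h1, h2, h3⟩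
    · left
      have hCv : v ∉ C := fun h => (hC h).2 rfl
      have hDv : v ∉ D := fun h => (hD h).2 rfl
      exact ⟨lft x v C, lft_subset hv hC, lft x v D, lft_subset hv hD, (cn_lft e hCv).mp h1,
        (cn_lft e hDv).mp h2, lft_disjoint hCv hDv h3, Or.inl h4, Or.inl h5, Or.inl h6, Or.inl h7,
        ctr_edge_lft hu hw e'⟩
    · right
      have hNv : ∀ i, v ∉ N i := fun i hi => ((h1 i).2.1 hi).2 rfl
      refine ⟨fun i => lft x v (N i), fun i => ⟨subset_lft _ _ _ (h1 i).1,
        lft_subset hv (h1 i).2.1, (cn_lft e (hNv i)).mp (h1 i).2.2⟩,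
        fun i j hij => lft_disjoint (hNv i) (hNv j) (h2 i j hij), fun i => ?_⟩
      obtain ⟨u, hu, w, hw, e'⟩ := h3 i
      exact ctr_edge_lft hu hw e'
  · have hA : range n = A := eq_of_subset_of_ncard_le (range_subset_iff.mpr hnA) (by omega) h.1
    -- exclude one vertex, get a neighbour among the other two
    have key : ∀ i k j : Fin 4, i ≠ k → i ≠ j → j ≠ k → ∃ l, l ≠ i ∧ l ≠ k ∧ H.Adj (n i) (n l) := by
      intro i k j hik hij hjk
      obtain ⟨u, hu, y, hy, hy', e⟩ := (h.2.2 (n k) (hnA k)).edge (C := {n i})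
        (by simpa using ⟨hnA i, fun h => hik (hn h)⟩) ⟨n i, rfl⟩ (v := n j)
        ⟨hnA j, fun h => hjk (hn h)⟩ (fun h => hij (hn h).symm)
      simp only [mem_singleton_iff] at hu
      subst hu
      rw [← hA] at hy
      obtain ⟨⟨l, rfl⟩, hyk⟩ := hy
      exact ⟨l, fun h => hy' (by simp [h]), fun h => hyk (by simp [h]), e⟩
    have two : ∀ i : Fin 4, ¬ H.Adj (n i) (n (i + 2)) → H.Adj (n i) (n (i + 1)) ∧
        H.Adj (n i) (n (i + 3)) := by
      intro i hni
      constructor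
      · obtain ⟨l, h1, h2, e⟩ := key i (i + 3) (i + 1) (by clear hni; revert i; decide)
          (by clear hni; revert i; decide) (by clear hni; revert i; decide)
        have : l = i + 1 ∨ l = i + 2 := by clear hni e; revert i l; decide
        rcases this with rfl | rfl
        · exact e
        · exact absurd e hni
      · obtain ⟨l, h1, h2, e⟩ := key i (i + 1) (i + 3) (by clear hni; revert i; decide)
          (by clear hni; revert i; decide) (by clear hni; revert i; decide)
        have : l = i + 3 ∨ l = i + 2 := by clear hni e; revert i l; decide
        rcases this with rfl | rfl
        · exact e
        · exact absurd e hni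
    by_cases ha : H.Adj (n 0) (n 2)
    · by_cases hb : H.Adj (n 1) (n 3)
      · left
        refine ⟨{n 0, n 2}, ?_, {n 1, n 3}, ?_, cn_pair ha, cn_pair hb, ?_, by simp, by simp,
          by simp, by simp, ?_⟩
        · simp [insert_subset_iff, hnA]
        · simp [insert_subset_iff, hnA]
        · simp [hn.eq_iff]
        · obtain ⟨l, h1, h2, e⟩ := key 0 2 1 (by decide) (by decide) (by decide)
          have : l = 1 ∨ l = 3 := by clear e; revert l; decide
          rcases this with rfl | rfl
          · exact ⟨n 0, by simp, n 1, by simp, e⟩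
          · exact ⟨n 0, by simp, n 3, by simp, e⟩
      · right
        have h1 := two 1 hb
        have h3 := two 3 (fun h => hb h.symm)
        refine ⟨fun i => {n i}, fun i => ⟨rfl, by simpa using hnA i, cn_singleton _ _⟩,
          fun i j hij => by simpa using fun h => hij (hn h), fun i => ?_⟩
        refine ⟨n i, rfl, n (i + 1), rfl, ?_⟩
        fin_cases i
        · exact h1.2.symm
        · exact h1.1
        · exact h3.2.symm
        · exact h3.1
    · right
      have h1 := two 0 ha
      have h3 := two 2 (fun h => ha h.symm)
      refine ⟨fun i => {n i}, fun i => ⟨rfl, by simpa using hnA i, cn_singleton _ _⟩,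
        fun i j hij => by simpa using fun h => hij (hn h), fun i => ?_⟩
      refine ⟨n i, rfl, n (i + 1), rfl, ?_⟩
      fin_cases i
      · exact h1.1
      · exact h3.2.symm
      · exact h3.1
      · exact h1.2.symm

/-- the triangle stays nonseparating when contracting into a corner -/
lemma corner_cn {H : SimpleGraph α} {A : Set α} {s t z y : α} (h5 : 5 ≤ A.ncard)
    (hs : s ∈ A) (ht : t ∈ A) (hz : z ∈ A) (hst : H.Adj s t) (hsz : H.Adj s z) (htz : t ≠ z)
    (hk : ¬ K33M H A) (hcn : Cn H (A \ {z, s, t})) (hy : y ∈ A) (hyτ : y ∉ ({z, s, t} : Set α))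
    (hsy : H.Adj s y) (hn : TC (ctr H s y) (A \ {y})) : Cn H (A \ {z, s, t, y}) := by
  by_contra hcon
  simp only [mem_insert_iff, mem_singleton_iff, not_or] at hyτ
  obtain ⟨hyz, hys, hyt⟩ := hyτ
  have hne : (A \ {z, s, t, y}).Nonempty := by
    obtain ⟨v, hv, hv'⟩ := exists_notMem_of_card (A := A) (S := {z, s, t, y}) (toFinite _)
      (by have := ncard_quad_le z s t y; omega)
    exact ⟨v, hv, hv'⟩
  obtain ⟨C, hC, ⟨c, hc⟩, ⟨d, hd⟩, hCclo⟩ := not_cn hne hcon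
  obtain ⟨C1, hC1, hc1, hC1n, hC1c⟩ := exists_comp H (hC hc)
  obtain ⟨C2, hC2, hd2, hC2n, hC2c⟩ := exists_comp H hd.1
  have e1 : C1 ⊆ C := by
    have := hC1n.clo_eq (C := C1 ∩ C) inter_subset_left ⟨c, hc1, hc⟩
      (fun u hu v hv e => ⟨hv, hCclo u hu.2 v (hC1 hv) e⟩)
    exact inter_eq_left.mp this
  have e2 : Disjoint C2 C := by
    rw [disjoint_iff_inter_eq_empty]
    by_contra hne
    have := hC2n.clo_eq (C := C2 ∩ C) inter_subset_left (nonempty_iff_ne_empty.mpr hne)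
      (fun u hu v hv e => ⟨hv, hCclo u hu.2 v (hC2 hv) e⟩)
    exact hd.2 (inter_eq_left.mp this hd2)
  -- each component is adjacent to y, t, z
  have key : ∀ D ⊆ A \ {z, s, t, y}, D.Nonempty → Clo H (A \ {z, s, t, y}) D →
      ∀ w, w = t ∨ w = z ∨ w = y → ∃ u ∈ D, ∃ v ∈ ({w} : Set α), H.Adj u v := by
    intro D hD hDne hDc w hw
    have hD' : ∀ u ∈ D, u ∈ A ∧ u ≠ z ∧ u ≠ s ∧ u ≠ t ∧ u ≠ y := fun u hu => by
      have := hD hu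
      simpa only [mem_sdiff, mem_insert_iff, mem_singleton_iff, not_or] using this
    have main : ∀ S : Set α, Cn H (A \ S) → w ∈ A → w ∉ S → (∀ u ∈ S, u ∈ ({z, s, t, y} : Set α)) →
        ({z, s, t, y} : Set α) ⊆ S ∪ {w} → ∃ u ∈ D, ∃ v ∈ ({w} : Set α), H.Adj u v := by
      intro S hS hwA hwS hSs hSw
      obtain ⟨x, hx, v, hv, hv', e⟩ := hS.edge (C := D)
        (fun u hu => ⟨(hD hu).1, fun hu' => (hD hu).2 (hSs u hu')⟩) hDne (v := w) ⟨hwA, hwS⟩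
        (fun hwD => by have := hD' w hwD; grind)
      refine ⟨x, hx, v, ?_, e⟩
      by_contra hvw
      exact hv' (hDc x hx v ⟨hv.1, fun hh => (hSw hh).elim hv.2 hvw⟩ e)
    have hzs := hsz.ne; have hst' := hst.ne
    rcases hw with rfl | rfl | rfl
    · refine main {s, y, z} (contr_cn hs hsy hn hz hsz.ne.symm (Ne.symm hyz)) ht ?_ ?_ ?_
      · simp; grind
      · intro u; simp; tauto
      · intro u; simp; tauto
    · refine main {s, y, t} (contr_cn hs hsy hn ht hst.ne.symm (Ne.symm hyt)) hz ?_ ?_ ?_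
      · simp; grind
      · intro u; simp; tauto
      · intro u; simp; tauto
    · refine main {z, s, t} hcn hy ?_ ?_ ?_
      · simp; grind
      · intro u; simp; tauto
      · intro u; simp; tauto
  have hC1' : ∀ u ∈ C1, u ∈ A ∧ u ≠ z ∧ u ≠ s ∧ u ≠ t ∧ u ≠ y := fun u hu => by
    have := hC1 hu
    simpa only [mem_sdiff, mem_insert_iff, mem_singleton_iff, not_or] using this
  have hC2' : ∀ u ∈ C2, u ∈ A ∧ u ≠ z ∧ u ≠ s ∧ u ≠ t ∧ u ≠ y := fun u hu => by
    have := hC2 hu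
    simpa only [mem_sdiff, mem_insert_iff, mem_singleton_iff, not_or] using this
  have d1 : ∀ w, w = s ∨ w = t ∨ w = z ∨ w = y → w ∉ C1 := fun w hw h => by
    have := hC1' w h; grind
  have d2 : ∀ w, w = s ∨ w = t ∨ w = z ∨ w = y → w ∉ C2 := fun w hw h => by
    have := hC2' w h; grind
  have d12 : Disjoint C1 C2 := (e2.mono_right e1).symm
  have hzs := hsz.ne; have hst' := hst.ne
  apply hk
  refine ⟨![C1, C2, {s}], ![{t}, {z}, {y}], ?_, ?_, ?_, ?_, ?_, ?_⟩
  · intro i; fin_cases i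
    · exact ⟨fun u hu => (hC1' u hu).1, hC1n⟩
    · exact ⟨fun u hu => (hC2' u hu).1, hC2n⟩
    · exact ⟨by simpa using hs, cn_singleton _ _⟩
  · intro i; fin_cases i
    · exact ⟨by simpa using ht, cn_singleton _ _⟩
    · exact ⟨by simpa using hz, cn_singleton _ _⟩
    · exact ⟨by simpa using hy, cn_singleton _ _⟩
  · intro i j; fin_cases i <;> fin_cases j <;> simp [d12, d12.symm, d1, d2]
  · intro i j; fin_cases i <;> fin_cases j <;> simp [htz, htz.symm, hyz, hyt, Ne.symm hyz, Ne.symm hyt]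
  · intro i j; fin_cases i <;> fin_cases j <;> simp [d1, d2, hzs, hst', hst'.symm, hys, hzs.symm, Ne.symm hys]
  · have k1 := key C1 hC1 ⟨c, hc1⟩ hC1c
    have k2 := key C2 hC2 ⟨d, hd2⟩ hC2c
    intro i j
    fin_cases i
    · fin_cases j
      · exact k1 t (by simp)
      · exact k1 z (by simp)
      · exact k1 y (by simp)
    · fin_cases j
      · exact k2 t (by simp)
      · exact k2 z (by simp)
      · exact k2 y (by simp)
    · fin_cases j
      · exact ⟨s, rfl, t, rfl, hst⟩
      · exact ⟨s, rfl, z, rfl, hsz⟩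
      · exact ⟨s, rfl, y, rfl, hsy⟩

end Comb

end

section
open Set Complex Topology Filter

/-! ### Weak drawings have no Kuratowski models -/

section WDr

variable {α : Type*}

/-- weak drawings -/
def WDr (H : SimpleGraph α) (A : Set α) (pos : α → ℂ) (arc : α → α → Set ℂ) : Prop :=
  (∀ u ∈ A, ∀ v ∈ A, H.Adj u v → JoinedIn (arc u v) (pos u) (pos v)) ∧
  ∀ u ∈ A, ∀ v ∈ A, ∀ x ∈ A, ∀ y ∈ A, H.Adj u v → H.Adj x y → u ≠ x → u ≠ y → v ≠ x → v ≠ y →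
    Disjoint (arc u v) (arc x y)

/-- union of the arcs of edges inside `C` -/
def imgE (H : SimpleGraph α) (arc : α → α → Set ℂ) (C : Set α) : Set ℂ :=
  {p | ∃ u ∈ C, ∃ v ∈ C, H.Adj u v ∧ p ∈ arc u v}

lemma imgE_mono {H : SimpleGraph α} {arc : α → α → Set ℂ} {C D : Set α} (h : C ⊆ D) :
    imgE H arc C ⊆ imgE H arc D := by
  rintro p ⟨u, hu, v, hv, e, hp⟩
  exact ⟨u, h hu, v, h hv, e, hp⟩

lemma WDr.disj {H : SimpleGraph α} {A C D : Set α} {pos : α → ℂ} {arc : α → α → Set ℂ}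
    (h : WDr H A pos arc) (hC : C ⊆ A) (hD : D ⊆ A) (hCD : Disjoint C D) :
    Disjoint (imgE H arc C) (imgE H arc D) := by
  rw [Set.disjoint_left]
  rintro p ⟨u, hu, v, hv, e, hp⟩ ⟨x, hx, y, hy, e', hp'⟩
  have hn : ∀ a ∈ C, ∀ b ∈ D, a ≠ b := fun a ha b hb => hCD.ne_of_mem ha hb
  exact Set.disjoint_left.mp (h.2 u (hC hu) v (hC hv) x (hD hx) y (hD hy) e e' (hn u hu x hx)
    (hn u hu y hy) (hn v hv x hx) (hn v hv y hy)) hp hp'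

lemma WDr.joined {H : SimpleGraph α} {A C : Set α} {pos : α → ℂ} {arc : α → α → Set ℂ}
    (h : WDr H A pos arc) (hC : C ⊆ A) (hCn : Cn H C) {u v : α} (hu : u ∈ C) (hv : v ∈ C)
    (huv : u ≠ v) : JoinedIn (imgE H arc C) (pos u) (pos v) := by
  have hstep : ∀ a ∈ C, ∀ b ∈ C, H.Adj a b → JoinedIn (imgE H arc C) (pos a) (pos b) := by
    intro a ha b hb e
    exact (h.1 a (hC ha) b (hC hb) e).mono (fun p hp => ⟨a, ha, b, hb, e, hp⟩)
  have := hCn.clo_eq (C := {w | w ∈ C ∧ (w = u ∨ JoinedIn (imgE H arc C) (pos u) (pos w))})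
    (fun w hw => hw.1) ⟨u, hu, Or.inl rfl⟩ (by
      rintro a ⟨ha, ha'⟩ b hb e
      refine ⟨hb, Or.inr ?_⟩
      rcases ha' with rfl | ha'
      · exact hstep _ ha b hb e
      · exact ha'.trans (hstep a ha b hb e))
  have hv' : v ∈ {w | w ∈ C ∧ (w = u ∨ JoinedIn (imgE H arc C) (pos u) (pos w))} := by
    rw [this]; exact hv
  rcases hv'.2 with h | h
  · exact absurd h.symm huv
  · exact h

lemma WDr.no33 {H : SimpleGraph α} {A : Set α} {pos : α → ℂ} {arc : α → α → Set ℂ}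
    (h : WDr H A pos arc) : ¬ K33M H A := by
  rintro ⟨B, C, hB, hC, dB, dC, dBC, e⟩
  choose b hb using fun i => (hB i).2.1
  choose c hc using fun i => (hC i).2.1
  refine K33top (fun i => pos (b i)) (fun i => pos (c i)) (fun i j => imgE H arc (B i ∪ C j))
    (fun i j => ?_) (fun i j k l hik hjl => ?_)
  · obtain ⟨u, hu, v, hv, e'⟩ := e i j
    exact h.joined (union_subset (hB i).1 (hC j).1)
      ((hB i).2.union (hC j).2 ⟨u, hu, v, hv, Or.inr e'⟩) (Or.inl (hb i)) (Or.inr (hc j))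
      ((dBC i j).ne_of_mem (hb i) (hc j))
  · refine h.disj (union_subset (hB i).1 (hC j).1) (union_subset (hB k).1 (hC l).1) ?_
    simp only [disjoint_union_left, disjoint_union_right]
    exact ⟨⟨dB i k hik.ne, (dBC k j).symm⟩, dBC i l, dC j l hjl⟩

lemma WDr.no5 {H : SimpleGraph α} {A : Set α} {pos : α → ℂ} {arc : α → α → Set ℂ}
    (h : WDr H A pos arc) : ¬ K5M H A := by
  rintro ⟨B, hB, dB, e⟩
  choose b hb using fun i => (hB i).2.1
  refine K5top (fun i => pos (b i)) (fun i j => imgE H arc (B i ∪ B j))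
    (fun i j hij => ?_) (fun i j k l hij hkl h1 h2 h3 h4 => ?_)
  · obtain ⟨u, hu, v, hv, e'⟩ := e i j hij
    exact h.joined (union_subset (hB i).1 (hB j).1)
      ((hB i).2.union (hB j).2 ⟨u, hu, v, hv, Or.inr e'⟩) (Or.inl (hb i)) (Or.inr (hb j))
      ((dB i j hij.ne).ne_of_mem (hb i) (hb j))
  · refine h.disj (union_subset (hB i).1 (hB j).1) (union_subset (hB k).1 (hB l).1) ?_
    simp only [disjoint_union_left, disjoint_union_right]
    exact ⟨⟨dB i k h1, dB j k h3⟩, dB i l h2, dB j l h4⟩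

end WDr

/-! ### Rays and segments -/

/-- `a`, `b` are nonzero and do not point in the same direction -/
def NR (a b : ℂ) : Prop := -(b / a) ∈ slitPlane

lemma NR.ne_left {a b : ℂ} (h : NR a b) : a ≠ 0 := by
  rintro rfl; simp [NR] at h

lemma NR.ne_right {a b : ℂ} (h : NR a b) : b ≠ 0 := by
  rintro rfl; simp [NR] at h

lemma NR.eq_zero {a b : ℂ} (h : NR a b) {r s : ℝ} (hr : 0 ≤ r) (hs : 0 ≤ s)
    (e : (r : ℂ) * a = s * b) : r = 0 ∧ s = 0 := by
  have ha := h.ne_left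
  have hb := h.ne_right
  by_cases hs0 : s = 0
  · subst hs0
    simp [ha] at e
    exact ⟨e, rfl⟩
  · exfalso
    have hsp : 0 < s := lt_of_le_of_ne hs (Ne.symm hs0)
    have : -(b / a) = ((-(r / s) : ℝ) : ℂ) := by
      have : (s : ℂ) ≠ 0 := by exact_mod_cast hs0
      push_cast
      field_simp
      linear_combination e
    unfold NR at h
    rw [this, ofReal_mem_slitPlane] at h
    have : 0 ≤ r / s := by positivity
    linarith

lemma nr_iff {a b : ℂ} (ha : a ≠ 0) (hb : b ≠ 0) : NR a b ↔ ∀ r : ℝ, 0 < r → b ≠ r * a := by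
  constructor
  · intro h r hr e
    have := h.eq_zero (r := r) (s := 1) hr.le zero_le_one (by simp [e])
    exact hr.ne' this.1
  · intro h
    by_contra hn
    unfold NR at hn
    rw [mem_slitPlane_iff] at hn
    push Not at hn
    simp only [neg_re, neg_im, neg_eq_zero, Left.neg_nonpos_iff, ne_eq] at hn
    have hne : (b / a).re ≠ 0 := by
      intro h0
      have : b / a = 0 := Complex.ext h0 (by simpa using hn.2)
      rcases div_eq_zero_iff.mp this with h | h
      · exact hb h
      · exact ha h
    refine h (b / a).re (lt_of_le_of_ne (by simpa using hn.1) hne.symm) ?_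
    have : (((b / a).re : ℝ) : ℂ) = b / a := Complex.ext (by simp) (by simp; simpa using hn.2.symm)
    rw [this]; field_simp

lemma NR.symm {a b : ℂ} (h : NR a b) : NR b a := by
  rw [nr_iff h.ne_right h.ne_left]
  intro r hr e
  have := h.eq_zero (r := 1) (s := r) zero_le_one hr.le (by simp [e])
  exact hr.ne' this.2

lemma NR.eventually {f g : ℝ → ℂ} {l : Filter ℝ} {a b : ℂ} (hf : Tendsto f l (𝓝 a))
    (hg : Tendsto g l (𝓝 b)) (h : NR a b) : ∀ᶠ x in l, NR (f x) (g x) :=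
  ((hg.div hf h.ne_left).neg).eventually (isOpen_slitPlane.mem_nhds h)

lemma mem_seg {a b p : ℂ} : p ∈ segment ℝ a b ↔ ∃ t : ℝ, 0 ≤ t ∧ t ≤ 1 ∧ p = a + t * (b - a) := by
  rw [segment_eq_image']
  simp only [mem_image, mem_Icc, real_smul]
  constructor
  · rintro ⟨t, ⟨h1, h2⟩, rfl⟩; exact ⟨t, h1, h2, rfl⟩
  · rintro ⟨t, h1, h2, rfl⟩; exact ⟨t, ⟨h1, h2⟩, rfl⟩

lemma NR.seg_inter {a b c p : ℂ} (h : NR (b - a) (c - a)) (h1 : p ∈ segment ℝ a b)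
    (h2 : p ∈ segment ℝ a c) : p = a := by
  obtain ⟨t, ht, -, rfl⟩ := mem_seg.mp h1
  obtain ⟨s, hs, -, e⟩ := mem_seg.mp h2
  have := h.eq_zero ht hs (by linear_combination e)
  simp [this.1]

lemma nr_of_seg {a b c : ℂ} (hb : b ≠ a) (hc : c ≠ a)
    (h : ∀ p, p ∈ segment ℝ a b → p ∈ segment ℝ a c → p = a) : NR (b - a) (c - a) := by
  rw [nr_iff (sub_ne_zero.mpr hb) (sub_ne_zero.mpr hc)]
  intro r hr e
  by_cases h1 : r ≤ 1
  · refine hc (h c (mem_seg.mpr ⟨r, hr.le, h1, ?_⟩) (right_mem_segment _ _ _))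
    linear_combination e
  · push Not at h1
    refine hb (h b (right_mem_segment _ _ _) (mem_seg.mpr ⟨1 / r, by positivity, ?_, ?_⟩))
    · rw [div_le_one hr]; exact h1.le
    · rw [e]; push_cast; have : (r : ℂ) ≠ 0 := by exact_mod_cast hr.ne'
      field_simp; ring

lemma seg_compact (a b : ℂ) : IsCompact (segment ℝ a b) := by
  rw [segment_eq_image']
  exact isCompact_Icc.image (by fun_prop)

lemma seg_disj_eventually {f g : ℝ → ℂ} {l : Filter ℝ} {a b : ℂ} (hf : Tendsto f l (𝓝 a))
    (hg : Tendsto g l (𝓝 b)) {K : Set ℂ} (hK : IsClosed K) (h : Disjoint (segment ℝ a b) K) :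
    ∀ᶠ x in l, Disjoint (segment ℝ (f x) (g x)) K := by
  obtain ⟨δ, hδ, hsub⟩ := (seg_compact a b).exists_thickening_subset_open hK.isOpen_compl
    (subset_compl_iff_disjoint_right.mpr h)
  filter_upwards [hf.eventually (Metric.ball_mem_nhds a hδ),
    hg.eventually (Metric.ball_mem_nhds b hδ)] with x hx hy
  rw [← subset_compl_iff_disjoint_right]
  refine Subset.trans ?_ hsub
  intro p hp
  rw [segment_eq_image] at hp
  obtain ⟨t, ⟨h0, h1⟩, rfl⟩ := hp
  rw [Metric.mem_thickening_iff]
  refine ⟨(1 - t) • a + t • b, ⟨1 - t, t, by linarith, h0, by ring, rfl⟩, ?_⟩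
  rw [dist_eq_norm] at hx hy
  have e : dist ((1 - t) • f x + t • g x) ((1 - t) • a + t • b)
      ≤ (1 - t) * ‖f x - a‖ + t * ‖g x - b‖ := by
    rw [dist_eq_norm]
    have : (1 - t) • f x + t • g x - ((1 - t) • a + t • b) =
      (1 - t) • (f x - a) + t • (g x - b) := by
      simp only [smul_sub]; ring
    rw [this]
    refine (norm_add_le _ _).trans ?_
    rw [norm_smul, norm_smul, Real.norm_of_nonneg (by linarith), Real.norm_of_nonneg h0]
  refine lt_of_le_of_lt e ?_
  rcases eq_or_lt_of_le h0 with h | h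
  · subst h; simpa using hx
  · nlinarith

section SLD

variable {α : Type*}

/-- straight line drawings -/
def SLD (H : SimpleGraph α) (A : Set α) (pos : α → ℂ) : Prop :=
  (∀ u ∈ A, ∀ v ∈ A, ∀ x ∈ A, ∀ y ∈ A, H.Adj u v → H.Adj x y → u ≠ x → u ≠ y → v ≠ x → v ≠ y →
    Disjoint (segment ℝ (pos u) (pos v)) (segment ℝ (pos x) (pos y))) ∧
  ∀ u ∈ A, ∀ v ∈ A, ∀ w ∈ A, H.Adj u v → H.Adj u w → v ≠ w → NR (pos v - pos u) (pos w - pos u)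

lemma SLD.vert {H : SimpleGraph α} {A : Set α} {pos : α → ℂ} (h : SLD H A pos) (hT : TC H A)
    {u v w : α} (hu : u ∈ A) (hv : v ∈ A) (hw : w ∈ A) (e : H.Adj u v) (hwu : w ≠ u)
    (hwv : w ≠ v) : pos w ∉ segment ℝ (pos u) (pos v) := by
  obtain ⟨m, hm, hmu, hmv, e'⟩ := hT.nbr hw u v hwu hwv
  intro hp
  exact Set.disjoint_left.mp (h.1 w hw m hm u hu v hv e' e hwu hwv hmu hmv)
    (left_mem_segment _ _ _) hp

lemma SLD.inj {H : SimpleGraph α} {A : Set α} {pos : α → ℂ} (h : SLD H A pos) (hT : TC H A)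
    {u w : α} (hu : u ∈ A) (hw : w ∈ A) (hwu : w ≠ u) : pos w ≠ pos u := by
  obtain ⟨m, hm, hmu, -, e⟩ := hT.nbr hu w w hwu.symm hwu.symm
  intro hp
  exact h.vert hT hu hm hw e hwu hmu.symm (hp ▸ left_mem_segment _ _ _)

lemma seg_joined (a b : ℂ) : JoinedIn (segment ℝ a b) a b :=
  ((convex_segment a b).isPathConnected ⟨a, left_mem_segment _ _ _⟩).joinedIn _
    (left_mem_segment _ _ _) _ (right_mem_segment _ _ _)

end SLD

end

section
open Set Complex Topology Filter

/-! ### polar coordinates around a point -/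

/-- polar coordinates -/
noncomputable def Pol (v κ : ℂ) (r t : ℝ) : ℂ := v + r * exp (t * I) / κ

/-- polar rectangle -/
def PS (v κ : ℂ) (a b c d : ℝ) : Set ℂ :=
  {p | ∃ r ∈ Icc a b, ∃ t ∈ Icc c d, p = Pol v κ r t}

lemma pol_inj {v κ : ℂ} (hκ : κ ≠ 0) {r r' t t' : ℝ} (hr : 0 < r) (hr' : 0 < r')
    (h1 : t < t') (h2 : t' - t < 2 * Real.pi) : Pol v κ r t ≠ Pol v κ r' t' := by
  intro e
  have e1 : (r : ℂ) * exp (t * I) = r' * exp (t' * I) := by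
    unfold Pol at e
    have := add_left_cancel e
    exact (div_left_inj' hκ).mp this
  have e2 : r = r' := by
    have := congrArg norm e1
    simpa [norm_exp_ofReal_mul_I, abs_of_pos hr, abs_of_pos hr'] using this
  subst e2
  have hrc : (r : ℂ) ≠ 0 := by exact_mod_cast hr.ne'
  have e3 := mul_left_cancel₀ hrc e1
  rw [exp_eq_exp_iff_exists_int] at e3
  obtain ⟨n, hn⟩ := e3
  have e4 : t = t' + n * (2 * Real.pi) := by
    have : (t : ℂ) * I = ((t' + n * (2 * Real.pi) : ℝ) : ℂ) * I := by
      rw [hn]; push_cast; ring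
    exact_mod_cast mul_right_cancel₀ I_ne_zero this
  have hpi := Real.pi_pos
  have h3 : (n : ℝ) < 0 := by nlinarith
  have h4 : -1 < (n : ℝ) := by nlinarith
  have h5 : n < 0 := by exact_mod_cast h3
  have h6 : -1 < n := by exact_mod_cast h4
  omega

lemma ps_disj {v κ : ℂ} (hκ : κ ≠ 0) {a b c d a' b' c' d' : ℝ} (ha : 0 < a) (ha' : 0 < a')
    (h1 : d < c') (h2 : d' - c < 2 * Real.pi) : Disjoint (PS v κ a b c d) (PS v κ a' b' c' d') := by
  rw [Set.disjoint_left]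
  rintro p ⟨r, hr, t, ht, rfl⟩ ⟨r', hr', t', ht', e⟩
  refine pol_inj hκ (lt_of_lt_of_le ha hr.1) (lt_of_lt_of_le ha' hr'.1) ?_ ?_ e
  · linarith [ht.2, ht'.1]
  · linarith [ht.1, ht'.2]

lemma ps_joined {v κ : ℂ} {a b c d : ℝ} (h1 : a ≤ b) (h2 : c ≤ d) :
    JoinedIn (PS v κ a b c d) (Pol v κ a c) (Pol v κ b d) := by
  have hps : PS v κ a b c d = (fun q : ℝ × ℝ => Pol v κ q.1 q.2) '' (Icc a b ×ˢ Icc c d) := by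
    ext p; constructor
    · rintro ⟨r, hr, t, ht, rfl⟩; exact ⟨(r, t), ⟨hr, ht⟩, rfl⟩
    · rintro ⟨⟨r, t⟩, ⟨hr, ht⟩, rfl⟩; exact ⟨r, hr, t, ht, rfl⟩
  rw [hps]
  have hc : Continuous (fun q : ℝ × ℝ => Pol v κ q.1 q.2) := by
    unfold Pol; fun_prop
  have hcv : Convex ℝ (Icc a b ×ˢ Icc c d) := (convex_Icc a b).prod (convex_Icc c d)
  have hpc : IsPathConnected (Icc a b ×ˢ Icc c d) := hcv.isPathConnected
    ⟨(a, c), ⟨le_refl _, h1⟩, ⟨le_refl _, h2⟩⟩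
  exact (hpc.image hc).joinedIn _ ⟨(a, c), ⟨⟨le_refl _, h1⟩, ⟨le_refl _, h2⟩⟩, rfl⟩ _
    ⟨(b, d), ⟨⟨h1, le_refl _⟩, ⟨h2, le_refl _⟩⟩, rfl⟩

lemma pol_arg {v κ q : ℂ} (hκ : κ ≠ 0) : Pol v κ ‖(q - v) * κ‖ (arg ((q - v) * κ)) = q := by
  unfold Pol
  rw [norm_mul_exp_arg_mul_I]
  field_simp; ring

lemma pol_seg {v κ q : ℂ} (hκ : κ ≠ 0) (hq : q ≠ v) {r : ℝ} (h0 : 0 ≤ r)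
    (h1 : r ≤ ‖(q - v) * κ‖) : Pol v κ r (arg ((q - v) * κ)) ∈ segment ℝ v q := by
  have hw : (q - v) * κ ≠ 0 := mul_ne_zero (sub_ne_zero.mpr hq) hκ
  have hn : 0 < ‖(q - v) * κ‖ := norm_pos_iff.mpr hw
  rw [mem_seg]
  refine ⟨r / ‖(q - v) * κ‖, by positivity, by rw [div_le_one hn]; exact h1, ?_⟩
  have e : (‖(q - v) * κ‖ : ℂ) * exp (arg ((q - v) * κ) * I) = (q - v) * κ :=
    norm_mul_exp_arg_mul_I _
  have hc : ((‖(q - v) * κ‖ : ℝ) : ℂ) ≠ 0 := by exact_mod_cast hn.ne'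
  unfold Pol
  push_cast
  generalize exp (arg ((q - v) * κ) * I) = E at *
  generalize (‖(q - v) * κ‖ : ℂ) = M at *
  have e' : E = (q - v) * κ / M := by rw [← e]; field_simp
  rw [e']
  field_simp

lemma pol_dist {v κ : ℂ} {r t : ℝ} (h0 : 0 ≤ r) : dist (Pol v κ r t) v = r / ‖κ‖ := by
  unfold Pol
  rw [dist_eq_norm, add_sub_cancel_left, norm_div, norm_mul, norm_exp_ofReal_mul_I]
  simp [abs_of_nonneg h0]

section LD

variable {α : Type*}

/-- drawing near a contracted vertex -/
structure LD (H : SimpleGraph α) (Bs N : Set α) (Q : α → ℂ) (v : ℂ) : Prop where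
  NB : N ⊆ Bs
  BB : ∀ u ∈ Bs, ∀ w ∈ Bs, ∀ x ∈ Bs, ∀ y ∈ Bs, H.Adj u w → H.Adj x y →
    u ≠ x → u ≠ y → w ≠ x → w ≠ y → Disjoint (segment ℝ (Q u) (Q w)) (segment ℝ (Q x) (Q y))
  BBr : ∀ u ∈ Bs, ∀ w ∈ Bs, ∀ x ∈ Bs, H.Adj u w → H.Adj u x → w ≠ x → NR (Q w - Q u) (Q x - Q u)
  SB : ∀ n ∈ N, ∀ x ∈ Bs, ∀ y ∈ Bs, H.Adj x y → n ≠ x → n ≠ y →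
    Disjoint (segment ℝ v (Q n)) (segment ℝ (Q x) (Q y))
  SBr : ∀ n ∈ N, ∀ x ∈ Bs, H.Adj n x → NR (v - Q n) (Q x - Q n)
  SS : ∀ n ∈ N, ∀ m ∈ N, n ≠ m → NR (Q n - v) (Q m - v)
  V : ∀ x ∈ Bs, ∀ y ∈ Bs, H.Adj x y → v ∉ segment ℝ (Q x) (Q y)
  VN : ∀ n ∈ N, Q n ≠ v

lemma LD.wdr {H : SimpleGraph α} {Bs N : Set α} {Q : α → ℂ} {v : ℂ} (h : LD H Bs N Q v) :
    WDr H Bs Q (fun a b => segment ℝ (Q a) (Q b)) :=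
  ⟨fun _ _ _ _ _ => seg_joined _ _, h.BB⟩

lemma LD.star {H : SimpleGraph α} {A Bs N : Set α} {Q : α → ℂ} {v κ : ℂ} (h : LD H Bs N Q v)
    (hκ : κ ≠ 0) (hBC : BC H Bs) (hBA : Bs ⊆ A) {x y : α} (hx : x ∈ A) (hy : y ∈ A)
    (hxB : x ∉ Bs) (hyB : y ∉ Bs) (hxy : H.Adj x y) (hk : ¬ K33M H A)
    (n : Fin 4 → α) (hn : ∀ i, n i ∈ N) (h0 : H.Adj x (n 0)) (h1 : H.Adj y (n 1))
    (h2 : H.Adj x (n 2)) (h3 : H.Adj y (n 3))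
    (hlt : ∀ i j, i < j → arg ((Q (n i) - v) * κ) < arg ((Q (n j) - v) * κ)) : False := by
  have hinj : Function.Injective n := by
    intro i j e
    rcases lt_trichotomy i j with h | h | h
    · exact absurd (hlt i j h) (by rw [e]; exact lt_irrefl _)
    · exact h
    · exact absurd (hlt j i h) (by rw [e]; exact lt_irrefl _)
  have hnB : ∀ i, n i ∈ Bs := fun i => h.NB (hn i)
  rcases four_lemma _ H Bs rfl hBC n hinj hnB with
    ⟨C, hC, D, hD, cC, cD, dCD, nC0, nC2, nD1, nD3, u, huC, w, hwD, e⟩ | ⟨N', hN, hdN, eN⟩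
  · -- topological case
    set arc : α → α → Set ℂ := fun a b => segment ℝ (Q a) (Q b) with harc
    set ψ : Fin 4 → ℝ := fun i => arg ((Q (n i) - v) * κ) with hψ
    set ρ : Fin 4 → ℝ := fun i => ‖(Q (n i) - v) * κ‖ with hρ
    have hρ0 : ∀ i, 0 < ρ i := fun i =>
      norm_pos_iff.mpr (mul_ne_zero (sub_ne_zero.mpr (h.VN _ (hn i))) hκ)
    have hclosed : IsClosed (imgE H arc Bs) := by
      have : imgE H arc Bs = ⋃ q ∈ {q : α × α | q ∈ Bs ×ˢ Bs ∧ H.Adj q.1 q.2},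
          segment ℝ (Q q.1) (Q q.2) := by
        ext p
        simp only [mem_iUnion]
        constructor
        · rintro ⟨a, ha, b, hb, e, hp⟩
          exact ⟨(a, b), ⟨⟨ha, hb⟩, e⟩, hp⟩
        · rintro ⟨⟨a, b⟩, ⟨⟨ha, hb⟩, e⟩, hp⟩
          exact ⟨a, ha, b, hb, e, hp⟩
      rw [this]
      exact ((hBC.1.prod hBC.1).subset (fun q hq => hq.1)).isClosed_biUnion
        (fun q _ => (seg_compact _ _).isClosed)
    have hvn : v ∉ imgE H arc Bs := by
      rintro ⟨a, ha, b, hb, e, hp⟩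
      exact h.V a ha b hb e hp
    obtain ⟨δ, hδ, hball⟩ := Metric.isOpen_iff.mp hclosed.isOpen_compl v hvn
    have hκn : 0 < ‖κ‖ := norm_pos_iff.mpr hκ
    obtain ⟨ε, hε, hεδ, hερ⟩ : ∃ ε > 0, ε < δ * ‖κ‖ ∧ ∀ i, ε ≤ ρ i := by
      refine ⟨min (δ * ‖κ‖ / 2) (min (min (ρ 0) (ρ 1)) (min (ρ 2) (ρ 3))), ?_, ?_, ?_⟩
      · simp only [gt_iff_lt, lt_min_iff]
        exact ⟨by positivity, ⟨hρ0 0, hρ0 1⟩, hρ0 2, hρ0 3⟩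
      · refine lt_of_le_of_lt (min_le_left _ _) ?_
        have : 0 < δ * ‖κ‖ := by positivity
        linarith
      · intro i; fin_cases i <;> simp
    have hcirc : ∀ c d, ∀ S ⊆ Bs, Disjoint (PS v κ ε ε c d) (imgE H arc S) := by
      intro c d S hS
      rw [Set.disjoint_left]
      rintro p ⟨r, hr, t, ht, rfl⟩ hp
      refine hball (show Pol v κ r t ∈ Metric.ball v δ from ?_) (imgE_mono hS hp)
      rw [Metric.mem_ball, pol_dist (le_trans hε.le hr.1), div_lt_iff₀ hκn]
      linarith [hr.2]
    have hray : ∀ i, ∀ S ⊆ Bs, n i ∉ S → Disjoint (PS v κ ε (ρ i) (ψ i) (ψ i)) (imgE H arc S) := by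
      intro i S hS hni
      rw [Set.disjoint_left]
      rintro p ⟨r, hr, t, ht, rfl⟩ ⟨a, ha, b, hb, e, hp⟩
      have : t = ψ i := le_antisymm ht.2 ht.1
      subst this
      exact Set.disjoint_left.mp (h.SB (n i) (hn i) a (hS ha) b (hS hb) e (fun h => hni (h ▸ ha))
        (fun h => hni (h ▸ hb))) (pol_seg hκ (h.VN _ (hn i)) (le_trans hε.le hr.1) hr.2) hp
    have hps : ∀ {a b c d a' b' c' d' : ℝ}, 0 < a → 0 < a' → d < c' → d' - c < 2 * Real.pi →
        Disjoint (PS v κ a b c d) (PS v κ a' b' c' d') := fun h1 h2 h3 h4 => ps_disj hκ h1 h2 h3 h4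
    have h01 : ψ 0 < ψ 1 := hlt 0 1 (by decide)
    have h12 : ψ 1 < ψ 2 := hlt 1 2 (by decide)
    have h23 : ψ 2 < ψ 3 := hlt 2 3 (by decide)
    have h3pi : ψ 3 ≤ Real.pi := arg_le_pi _
    have h0pi : -Real.pi < ψ 0 := neg_pi_lt_arg _
    have hn0D : n 0 ∉ D := fun hh => Set.disjoint_left.mp dCD nC0 hh
    have hn1C : n 1 ∉ C := fun hh => Set.disjoint_left.mp dCD hh nD1
    have hn2D : n 2 ∉ D := fun hh => Set.disjoint_left.mp dCD nC2 hh
    have hn3C : n 3 ∉ C := fun hh => Set.disjoint_left.mp dCD hh nD3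
    have hend : ∀ i, Pol v κ (ρ i) (ψ i) = Q (n i) := fun i => pol_arg hκ
    have hJr : ∀ i, JoinedIn (PS v κ ε (ρ i) (ψ i) (ψ i)) (Pol v κ ε (ψ i)) (Q (n i)) := by
      intro i
      have := ps_joined (v := v) (κ := κ) (hερ i) (le_refl (ψ i))
      rwa [hend i] at this
    have hCD : Disjoint (imgE H arc C) (imgE H arc D) := h.wdr.disj hC hD dCD
    have hJ30 : JoinedIn (PS v κ ε ε (ψ 3) (ψ 0 + 2 * Real.pi)) (Pol v κ ε (ψ 0))
        (Pol v κ ε (ψ 3)) := by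
      have := (ps_joined (v := v) (κ := κ) (le_refl ε)
        (show ψ 3 ≤ ψ 0 + 2 * Real.pi by linarith)).symm
      have e : Pol v κ ε (ψ 0 + 2 * Real.pi) = Pol v κ ε (ψ 0) := by
        unfold Pol
        push_cast
        rw [add_mul, exp_add, exp_two_pi_mul_I, mul_one]
      rwa [e] at this
    refine K33top ![Pol v κ ε (ψ 0), Pol v κ ε (ψ 2), Q (n 1)]
      ![Pol v κ ε (ψ 1), Pol v κ ε (ψ 3), Q (n 0)]
      ![![PS v κ ε ε (ψ 0) (ψ 1), PS v κ ε ε (ψ 3) (ψ 0 + 2 * Real.pi),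
          PS v κ ε (ρ 0) (ψ 0) (ψ 0)],
        ![PS v κ ε ε (ψ 1) (ψ 2), PS v κ ε ε (ψ 2) (ψ 3),
          PS v κ ε (ρ 2) (ψ 2) (ψ 2) ∪ imgE H arc C],
        ![PS v κ ε (ρ 1) (ψ 1) (ψ 1), PS v κ ε (ρ 3) (ψ 3) (ψ 3) ∪ imgE H arc D,
          imgE H arc (C ∪ D)]] ?_ ?_
    · have hC20 := h.wdr.joined hC cC nC2 nC0 (fun e => by have := hinj e; revert this; decide)
      have hD31 := h.wdr.joined hD cD nD3 nD1 (fun e => by have := hinj e; revert this; decide)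
      have hCD10 := h.wdr.joined (union_subset hC hD) (cC.union cD ⟨u, huC, w, hwD, Or.inr e⟩)
        (Or.inr nD1) (Or.inl nC0) (fun e => by have := hinj e; revert this; decide)
      intro i j
      fin_cases i <;> fin_cases j
      · exact ps_joined le_rfl h01.le
      · exact hJ30
      · exact hJr 0
      · exact (ps_joined le_rfl h12.le).symm
      · exact ps_joined le_rfl h23.le
      · exact ((hJr 2).mono subset_union_left).trans (hC20.mono subset_union_right)
      · exact (hJr 1).symm
      · exact (((hJr 3).mono subset_union_left).trans (hD31.mono subset_union_right)).symm
      · exact hCD10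
    · have hρ0' := hρ0
      have hUC : C ∪ D ⊆ Bs := union_subset hC hD
      have hL : ∀ j l : Fin 3, j ≠ l → Disjoint
        ((![PS v κ ε ε (ψ 0) (ψ 1), PS v κ ε ε (ψ 3) (ψ 0 + 2 * Real.pi),
          PS v κ ε (ρ 0) (ψ 0) (ψ 0)] : Fin 3 → Set ℂ) j)
        ((![PS v κ ε ε (ψ 1) (ψ 2), PS v κ ε ε (ψ 2) (ψ 3),
          PS v κ ε (ρ 2) (ψ 2) (ψ 2) ∪ imgE H arc C] : Fin 3 → Set ℂ) l) := by
        intro j l hjl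
        fin_cases j <;> fin_cases l <;> first | exact absurd rfl hjl | skip
        · exact hps hε hε h12 (by linarith)
        · exact disjoint_union_right.mpr ⟨hps hε hε h12 (by linarith), hcirc _ _ _ hC⟩
        · exact (hps hε hε h23 (by linarith)).symm
        · exact disjoint_union_right.mpr ⟨(hps hε hε h23 (by linarith)).symm, hcirc _ _ _ hC⟩
        · exact hps hε hε h01 (by linarith)
        · exact hps hε hε (h01.trans h12) (by linarith)
      have hM : ∀ j l : Fin 3, j ≠ l → Disjoint
        ((![PS v κ ε ε (ψ 0) (ψ 1), PS v κ ε ε (ψ 3) (ψ 0 + 2 * Real.pi),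
          PS v κ ε (ρ 0) (ψ 0) (ψ 0)] : Fin 3 → Set ℂ) j)
        ((![PS v κ ε (ρ 1) (ψ 1) (ψ 1), PS v κ ε (ρ 3) (ψ 3) (ψ 3) ∪ imgE H arc D,
          imgE H arc (C ∪ D)] : Fin 3 → Set ℂ) l) := by
        intro j l hjl
        fin_cases j <;> fin_cases l <;> first | exact absurd rfl hjl | skip
        · exact disjoint_union_right.mpr ⟨hps hε hε (h12.trans h23) (by linarith), hcirc _ _ _ hD⟩
        · exact hcirc _ _ _ hUC
        · exact (hps hε hε (h12.trans h23) (by linarith)).symm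
        · exact hcirc _ _ _ hUC
        · exact hps hε hε h01 (by linarith)
        · exact disjoint_union_right.mpr ⟨hps hε hε (h01.trans (h12.trans h23)) (by linarith),
            hray 0 _ hD hn0D⟩
      have hR : ∀ j l : Fin 3, j ≠ l → Disjoint
        ((![PS v κ ε ε (ψ 1) (ψ 2), PS v κ ε ε (ψ 2) (ψ 3),
          PS v κ ε (ρ 2) (ψ 2) (ψ 2) ∪ imgE H arc C] : Fin 3 → Set ℂ) j)
        ((![PS v κ ε (ρ 1) (ψ 1) (ψ 1), PS v κ ε (ρ 3) (ψ 3) (ψ 3) ∪ imgE H arc D,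
          imgE H arc (C ∪ D)] : Fin 3 → Set ℂ) l) := by
        intro j l hjl
        fin_cases j <;> fin_cases l <;> first | exact absurd rfl hjl | skip
        · exact disjoint_union_right.mpr ⟨hps hε hε h23 (by linarith), hcirc _ _ _ hD⟩
        · exact hcirc _ _ _ hUC
        · exact (hps hε hε h12 (by linarith)).symm
        · exact hcirc _ _ _ hUC
        · exact disjoint_union_left.mpr ⟨(hps hε hε h12 (by linarith)).symm, (hray 1 _ hC hn1C).symm⟩
        · refine disjoint_union_left.mpr ⟨disjoint_union_right.mpr ⟨hps hε hε h23 (by linarith),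
            hray 2 _ hD hn2D⟩, disjoint_union_right.mpr ⟨(hray 3 _ hC hn3C).symm, hCD⟩⟩
      intro i j k l hik hjl
      fin_cases i <;> fin_cases k <;> first | exact absurd hik (by decide) | skip
      · exact hL j l hjl
      · exact hM j l hjl
      · exact hR j l hjl
  · -- K33 model
    apply hk
    have hNx : ∀ i, x ∉ N' i := fun i hh => hxB ((hN i).2.1 hh)
    have hNy : ∀ i, y ∉ N' i := fun i hh => hyB ((hN i).2.1 hh)
    have hNA : ∀ i, N' i ⊆ A ∧ Cn H (N' i) := fun i => ⟨(hN i).2.1.trans hBA, (hN i).2.2⟩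
    have hd : ∀ i j : Fin 4, i ≠ j → Disjoint (N' i) (N' j) := hdN
    have sym : ∀ {S T : Set α}, (∃ u ∈ S, ∃ v ∈ T, H.Adj u v) → ∃ u ∈ T, ∃ v ∈ S, H.Adj u v := by
      rintro S T ⟨u, hu, v, hv, e⟩; exact ⟨v, hv, u, hu, e.symm⟩
    refine ⟨![N' 0, N' 2, {y}], ![N' 1, N' 3, {x}], ?_, ?_, ?_, ?_, ?_, ?_⟩
    · intro i; fin_cases i
      · exact hNA 0
      · exact hNA 2
      · exact ⟨singleton_subset_iff.mpr hy, cn_singleton H y⟩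
    · intro i; fin_cases i
      · exact hNA 1
      · exact hNA 3
      · exact ⟨singleton_subset_iff.mpr hx, cn_singleton H x⟩
    · intro i j hij
      fin_cases i <;> fin_cases j <;> first | exact absurd rfl hij | skip
      · exact hd 0 2 (by decide)
      · exact disjoint_singleton_right.mpr (hNy _)
      · exact hd 2 0 (by decide)
      · exact disjoint_singleton_right.mpr (hNy _)
      · exact disjoint_singleton_left.mpr (hNy _)
      · exact disjoint_singleton_left.mpr (hNy _)
    · intro i j hij
      fin_cases i <;> fin_cases j <;> first | exact absurd rfl hij | skip
      · exact hd 1 3 (by decide)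
      · exact disjoint_singleton_right.mpr (hNx _)
      · exact hd 3 1 (by decide)
      · exact disjoint_singleton_right.mpr (hNx _)
      · exact disjoint_singleton_left.mpr (hNx _)
      · exact disjoint_singleton_left.mpr (hNx _)
    · intro i j
      fin_cases i <;> fin_cases j
      · exact hd 0 1 (by decide)
      · exact hd 0 3 (by decide)
      · exact disjoint_singleton_right.mpr (hNx _)
      · exact hd 2 1 (by decide)
      · exact hd 2 3 (by decide)
      · exact disjoint_singleton_right.mpr (hNx _)
      · exact disjoint_singleton_left.mpr (hNy _)
      · exact disjoint_singleton_left.mpr (hNy _)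
      · exact disjoint_singleton.mpr hxy.ne.symm
    · intro i j
      fin_cases i <;> fin_cases j
      · exact eN 0
      · exact sym (eN 3)
      · exact ⟨n 0, (hN 0).1, x, rfl, h0.symm⟩
      · exact sym (eN 1)
      · exact eN 2
      · exact ⟨n 2, (hN 2).1, x, rfl, h2.symm⟩
      · exact ⟨y, rfl, n 1, (hN 1).1, h1⟩
      · exact ⟨y, rfl, n 3, (hN 3).1, h3⟩
      · exact ⟨y, rfl, x, rfl, hxy.symm⟩

lemma star5 {H : SimpleGraph α} {A Bs : Set α} (hBC : BC H Bs) (hBA : Bs ⊆ A) {x y : α}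
    (hx : x ∈ A) (hy : y ∈ A) (hxB : x ∉ Bs) (hyB : y ∉ Bs) (hxy : H.Adj x y) (hk : ¬ K5M H A)
    (n : Fin 3 → α) (hinj : Function.Injective n) (hn : ∀ i, n i ∈ Bs) (h0 : ∀ i, H.Adj x (n i))
    (h1 : ∀ i, H.Adj y (n i)) : False := by
  obtain ⟨N', hN, hdN, eN⟩ := three_lemma _ H Bs rfl hBC n hinj hn
  apply hk
  have hNx : ∀ i, x ∉ N' i := fun i hh => hxB ((hN i).2.1 hh)
  have hNy : ∀ i, y ∉ N' i := fun i hh => hyB ((hN i).2.1 hh)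
  have hNA : ∀ i, N' i ⊆ A ∧ Cn H (N' i) := fun i => ⟨(hN i).2.1.trans hBA, (hN i).2.2⟩
  refine ⟨![N' 0, N' 1, N' 2, {x}, {y}], ?_, ?_, ?_⟩
  · intro i; fin_cases i
    · exact hNA 0
    · exact hNA 1
    · exact hNA 2
    · exact ⟨singleton_subset_iff.mpr hx, cn_singleton H x⟩
    · exact ⟨singleton_subset_iff.mpr hy, cn_singleton H y⟩
  · have key : ∀ i j : Fin 5, i < j → Disjoint ((![N' 0, N' 1, N' 2, {x}, {y}] : Fin 5 → Set α) i)
        ((![N' 0, N' 1, N' 2, {x}, {y}] : Fin 5 → Set α) j) := by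
      intro i j hij
      fin_cases i <;> fin_cases j <;> first | exact absurd hij (by decide) | skip
      · exact hdN 0 1 (by decide)
      · exact hdN 0 2 (by decide)
      · exact disjoint_singleton_right.mpr (hNx _)
      · exact disjoint_singleton_right.mpr (hNy _)
      · exact hdN 1 2 (by decide)
      · exact disjoint_singleton_right.mpr (hNx _)
      · exact disjoint_singleton_right.mpr (hNy _)
      · exact disjoint_singleton_right.mpr (hNx _)
      · exact disjoint_singleton_right.mpr (hNy _)
      · exact disjoint_singleton.mpr hxy.ne
    intro i j hij
    rcases lt_or_gt_of_ne hij with h | h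
    · exact key i j h
    · exact (key j i h).symm
  · intro i j hij
    fin_cases i <;> fin_cases j <;> first | exact absurd hij (by decide) | skip
    · exact eN 0 1 (by decide)
    · exact eN 0 2 (by decide)
    · exact ⟨n 0, (hN 0).1, x, rfl, (h0 0).symm⟩
    · exact ⟨n 0, (hN 0).1, y, rfl, (h1 0).symm⟩
    · exact eN 1 2 (by decide)
    · exact ⟨n 1, (hN 1).1, x, rfl, (h0 1).symm⟩
    · exact ⟨n 1, (hN 1).1, y, rfl, (h1 1).symm⟩
    · exact ⟨n 2, (hN 2).1, x, rfl, (h0 2).symm⟩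
    · exact ⟨n 2, (hN 2).1, y, rfl, (h1 2).symm⟩
    · exact ⟨x, rfl, y, rfl, hxy⟩

end LD

end

section
open Set Complex Topology Filter

lemma arg_cone_aux {r s γ : ℝ} (hr : 0 ≤ r) (hs : 0 ≤ s) (h0 : 0 ≤ γ) (hγ : γ < Real.pi)
    (hw : (r : ℂ) + s * exp (γ * I) ≠ 0) :
    0 ≤ arg ((r : ℂ) + s * exp (γ * I)) ∧ arg ((r : ℂ) + s * exp (γ * I)) ≤ γ := by
  set w := (r : ℂ) + s * exp (γ * I) with hwd
  have hsin : 0 ≤ Real.sin γ := Real.sin_nonneg_of_nonneg_of_le_pi h0 hγ.le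
  have him : w.im = s * Real.sin γ := by
    rw [hwd]; simp [exp_ofReal_mul_I_re, exp_ofReal_mul_I_im]
  have hre : w.re = r + s * Real.cos γ := by
    rw [hwd]; simp [exp_ofReal_mul_I_re, exp_ofReal_mul_I_im]
  have hn : 0 < ‖w‖ := norm_pos_iff.mpr hw
  have h1 : 0 ≤ arg w := arg_nonneg_iff.mpr (by rw [him]; positivity)
  refine ⟨h1, ?_⟩
  by_contra hlt
  push Not at hlt
  have e1 : ‖w‖ * Real.cos (arg w) = r + s * Real.cos γ := by rw [norm_mul_cos_arg, hre]
  have e2 : ‖w‖ * Real.sin (arg w) = s * Real.sin γ := by rw [norm_mul_sin_arg, him]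
  have e3 : ‖w‖ * Real.sin (arg w - γ) = - (r * Real.sin γ) := by
    rw [Real.sin_sub]
    linear_combination Real.cos γ * e2 - Real.sin γ * e1
  have hpi := arg_le_pi w
  rcases eq_or_lt_of_le (show arg w - γ ≤ Real.pi by linarith) with h | h
  · have hγ0 : γ = 0 := by linarith
    have hpi' : arg w = Real.pi := by linarith
    rw [hpi', hγ0] at e1
    simp at e1
    linarith
  · have : 0 < Real.sin (arg w - γ) := Real.sin_pos_of_pos_of_lt_pi (by linarith) h
    have : 0 < ‖w‖ * Real.sin (arg w - γ) := by positivity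
    have : 0 ≤ r * Real.sin γ := by positivity
    linarith

lemma arg_exp' {r t : ℝ} (hr : 0 < r) (h1 : -Real.pi < t) (h2 : t ≤ Real.pi) :
    arg (r * exp (t * I)) = t := by
  rw [exp_mul_I]
  exact arg_mul_cos_add_sin_mul_I hr ⟨h1, h2⟩

lemma arg_cone {r s θ₁ θ₂ : ℝ} (hr : 0 ≤ r) (hs : 0 ≤ s) (h1 : -Real.pi < θ₁) (h2 : θ₂ ≤ Real.pi)
    (h12 : θ₁ ≤ θ₂) (hlt : θ₂ < θ₁ + Real.pi)
    (hw : (r : ℂ) * exp (θ₁ * I) + s * exp (θ₂ * I) ≠ 0) :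
    θ₁ ≤ arg ((r : ℂ) * exp (θ₁ * I) + s * exp (θ₂ * I)) ∧
      arg ((r : ℂ) * exp (θ₁ * I) + s * exp (θ₂ * I)) ≤ θ₂ := by
  have e : (r : ℂ) * exp (θ₁ * I) + s * exp (θ₂ * I) =
      ((r : ℂ) + s * exp ((θ₂ - θ₁ : ℝ) * I)) * exp (θ₁ * I) := by
    push_cast
    rw [add_mul, mul_assoc (s : ℂ), ← exp_add]
    ring_nf
  set w := (r : ℂ) + s * exp ((θ₂ - θ₁ : ℝ) * I) with hwd
  have hw0 : w ≠ 0 := by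
    intro h; apply hw; rw [e, h, zero_mul]
  obtain ⟨a1, a2⟩ := arg_cone_aux hr hs (by linarith : 0 ≤ θ₂ - θ₁) (by linarith) hw0
  have e2 : w * exp (θ₁ * I) = (‖w‖ : ℝ) * exp ((arg w + θ₁ : ℝ) * I) := by
    conv_lhs => rw [← norm_mul_exp_arg_mul_I w]
    push_cast
    rw [mul_assoc, ← exp_add]; ring_nf
  rw [e, e2, arg_exp' (norm_pos_iff.mpr hw0) (by linarith) (by linarith)]
  constructor <;> linarith

/-- conditions for the splitting direction -/
structure Dir {α : Type*} (X Y : Set α) (w : α → ℂ) (d : ℂ) : Prop where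
  d0 : d ≠ 0
  s1 : ∀ n ∈ X, NR d (w n)
  s2 : ∀ n ∈ Y, NR (-d) (w n)
  s3 : ∀ n' ∈ X, ∀ n ∈ Y, n' ≠ n → ∀ a b : ℝ, 0 ≤ a → 0 ≤ b → w n' ≠ a * d + b * w n

lemma dir_exists {α : Type*} {X Y : Set α} {w : α → ℂ} {κ : ℂ} (hκ : κ ≠ 0)
    (hX0 : ∀ n ∈ X, w n ≠ 0) (hY0 : ∀ n ∈ Y, w n ≠ 0)
    (hinj : ∀ n ∈ X, ∀ m ∈ Y, n ≠ m → arg (w n * κ) ≠ arg (w m * κ))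
    {p q : α} (hp : p ∈ Y) (hq : q ∈ Y) (hpq : arg (w p * κ) < arg (w q * κ))
    (hmin : ∀ n ∈ Y, arg (w p * κ) ≤ arg (w n * κ)) (hmax : ∀ n ∈ Y, arg (w n * κ) ≤ arg (w q * κ))
    (hno : ∀ n ∈ X, ¬ (arg (w p * κ) < arg (w n * κ) ∧ arg (w n * κ) < arg (w q * κ))) :
    ∃ d, Dir X Y w d ∧ (arg (w q * κ) - arg (w p * κ) < Real.pi →
      ∃ a b : ℝ, 0 ≤ a ∧ 0 ≤ b ∧ d = a * w p + b * w q) := by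
  set P := arg (w p * κ) with hP
  set Q := arg (w q * κ) with hQ
  have hP1 : -Real.pi < P := neg_pi_lt_arg _
  have hQ1 : Q ≤ Real.pi := arg_le_pi _
  set m := (P + Q) / 2 with hm
  have hmP : P < m := by rw [hm]; linarith
  have hmQ : m < Q := by rw [hm]; linarith
  have hpol : ∀ n, w n * κ = (‖w n * κ‖ : ℝ) * exp (arg (w n * κ) * I) := fun n =>
    (norm_mul_exp_arg_mul_I _).symm
  have hd : exp (m * I) / κ ≠ 0 := div_ne_zero (exp_ne_zero _) hκ
  refine ⟨exp (m * I) / κ, ⟨hd, ?_, ?_, ?_⟩, ?_⟩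
  · intro n hn
    rw [nr_iff hd (hX0 n hn)]
    intro r hr e
    have : w n * κ = r * exp (m * I) := by rw [e]; field_simp
    have : arg (w n * κ) = m := by
      rw [this]; exact arg_exp' hr (by linarith) (by linarith)
    exact hno n hn (by rw [this]; exact ⟨hmP, hmQ⟩)
  · intro n hn
    rw [nr_iff (neg_ne_zero.mpr hd) (hY0 n hn)]
    intro r hr e
    have e2 : w n * κ = r * exp ((m + Real.pi : ℝ) * I) := by
      rw [e]; push_cast; rw [add_mul, exp_add, exp_pi_mul_I]; field_simp
    have h1 := hmin n hn
    have h2 := hmax n hn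
    have hn0 : 0 < ‖w n * κ‖ := norm_pos_iff.mpr (mul_ne_zero (hY0 n hn) hκ)
    refine pol_inj (v := 0) (κ := 1) one_ne_zero hn0 hr (t := arg (w n * κ)) (t' := m + Real.pi)
      (by linarith) (by linarith) ?_
    unfold Pol
    simp only [zero_add, div_one]
    rw [← e2, ← hpol n]
  · intro n' hn' n hn hne a b ha hb e
    have e2 : w n' * κ = a * exp (m * I) + (b * ‖w n * κ‖ : ℝ) * exp (arg (w n * κ) * I) := by
      rw [e, add_mul]
      congr 1
      · field_simp
      · rw [mul_assoc, hpol n]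
        push_cast
        rw [← hpol n, mul_assoc]
        congr 1
        exact (hpol n)
    have hw' : w n' * κ ≠ 0 := mul_ne_zero (hX0 n' hn') hκ
    have hb' : 0 ≤ b * ‖w n * κ‖ := by positivity
    have hne' := hinj n' hn' n hn hne
    have h1 := hmin n hn
    have h2 := hmax n hn
    have hno' := hno n' hn'
    rcases le_total (arg (w n * κ)) m with hle | hle
    · rw [add_comm] at e2
      have := arg_cone hb' ha (by linarith) (by linarith) hle (by linarith) (e2 ▸ hw')
      rw [← e2] at this
      apply hno'
      exact ⟨lt_of_le_of_lt h1 (lt_of_le_of_ne this.1 (Ne.symm hne')), lt_of_le_of_lt this.2 hmQ⟩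
    · have := arg_cone ha hb' (by linarith) (by linarith) hle (by linarith) (e2 ▸ hw')
      rw [← e2] at this
      apply hno'
      exact ⟨lt_of_lt_of_le hmP this.1, lt_of_lt_of_le (lt_of_le_of_ne this.2 hne') h2⟩
  · intro hlt
    have hc : 0 < Real.cos ((Q - P) / 2) := Real.cos_pos_of_mem_Ioo ⟨by linarith, by linarith⟩
    have hp0 : 0 < ‖w p * κ‖ := norm_pos_iff.mpr (mul_ne_zero (hY0 p hp) hκ)
    have hq0 : 0 < ‖w q * κ‖ := norm_pos_iff.mpr (mul_ne_zero (hY0 q hq) hκ)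
    refine ⟨1 / (2 * Real.cos ((Q - P) / 2)) / ‖w p * κ‖,
      1 / (2 * Real.cos ((Q - P) / 2)) / ‖w q * κ‖, by positivity, by positivity, ?_⟩
    have e1 : exp (P * I) + exp (Q * I) = (2 * Real.cos ((Q - P) / 2) : ℝ) * exp (m * I) := by
      have hcos : ((2 * Real.cos ((Q - P) / 2) : ℝ) : ℂ) =
          exp (((Q - P) / 2 : ℝ) * I) + exp (-((Q - P) / 2 : ℝ) * I) := by
        push_cast
        rw [two_cos]
      rw [hcos, add_mul, ← exp_add, ← exp_add, add_comm]
      congr 2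
      · rw [hm]; push_cast; ring
      · rw [hm]; push_cast; ring
    have e2 : exp (P * I) = w p * κ / (‖w p * κ‖ : ℝ) := by
      have : ((‖w p * κ‖ : ℝ) : ℂ) ≠ 0 := by exact_mod_cast hp0.ne'
      rw [eq_div_iff this, mul_comm]; exact (hpol p).symm
    have e3 : exp (Q * I) = w q * κ / (‖w q * κ‖ : ℝ) := by
      have : ((‖w q * κ‖ : ℝ) : ℂ) ≠ 0 := by exact_mod_cast hq0.ne'
      rw [eq_div_iff this, mul_comm]; exact (hpol q).symm
    rw [e2, e3] at e1
    have hcc : ((2 * Real.cos ((Q - P) / 2) : ℝ) : ℂ) ≠ 0 := by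
      have : (2 * Real.cos ((Q - P) / 2)) ≠ 0 := by positivity
      exact_mod_cast this
    have c1 : ∀ M : ℝ, ((1 / (2 * Real.cos ((Q - P) / 2)) / M : ℝ) : ℂ) =
        1 / ((2 * Real.cos ((Q - P) / 2) : ℝ) : ℂ) / (M : ℂ) := by
      intro M; rw [ofReal_div, ofReal_div, ofReal_one]
    rw [c1, c1]
    generalize ((2 * Real.cos ((Q - P) / 2) : ℝ) : ℂ) = C at *
    have hm' : exp (m * I) = (w p * κ / (‖w p * κ‖ : ℝ) + w q * κ / (‖w q * κ‖ : ℝ)) / C := by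
      rw [e1]; field_simp
    rw [hm']
    generalize ((‖w p * κ‖ : ℝ) : ℂ) = M1
    generalize ((‖w q * κ‖ : ℝ) : ℂ) = M2
    push_cast
    field_simp

lemma NR.smul_left {a b : ℂ} (h : NR a b) {r : ℝ} (hr : 0 < r) : NR (r * a) b := by
  have hrc : (r : ℂ) ≠ 0 := by exact_mod_cast hr.ne'
  rw [nr_iff (mul_ne_zero hrc h.ne_left) h.ne_right]
  intro s hs e
  exact (nr_iff h.ne_left h.ne_right).mp h (s * r) (by positivity) (by rw [e]; push_cast; ring)

section Split

variable {α : Type*}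

open Classical in
/-- positions after splitting -/
noncomputable def spos (Q : α → ℂ) (f g : α) (v w : ℂ) (u : α) : ℂ :=
  if u = f then v else if u = g then w else Q u

lemma LD.split {H : SimpleGraph α} {A Bs N : Set α} {Q : α → ℂ} {v d : ℂ} (h : LD H Bs N Q v)
    (hfin : Bs.Finite) {f g : α} (hA : ∀ u ∈ A, u = f ∨ u = g ∨ u ∈ Bs)
    (hfB : f ∉ Bs) (hgB : g ∉ Bs) (hfg : f ≠ g) (hN : ∀ n ∈ Bs, H.Adj f n ∨ H.Adj g n → n ∈ N)
    (hd : Dir {n | n ∈ Bs ∧ H.Adj f n} {n | n ∈ Bs ∧ H.Adj g n} (fun n => Q n - v) d) :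
    ∀ᶠ ε : ℝ in 𝓝[>] (0 : ℝ), SLD H A (spos Q f g v (v + ε * d)) := by
  have hlim : Tendsto (fun ε : ℝ => v + ε * d) (𝓝[>] (0 : ℝ)) (𝓝 v) := by
    have : Tendsto (fun ε : ℝ => v + ε * d) (𝓝 (0 : ℝ)) (𝓝 (v + ((0 : ℝ) : ℂ) * d)) :=
      Continuous.tendsto (by fun_prop) 0
    simp only [ofReal_zero, zero_mul, add_zero] at this
    exact this.mono_left nhdsWithin_le_nhds
  have ev1 : ∀ {S : Set α} (P : ℝ → α → Prop), S.Finite → (∀ a ∈ S, ∀ᶠ ε : ℝ in 𝓝[>] (0 : ℝ), P ε a) →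
      ∀ᶠ ε : ℝ in 𝓝[>] (0 : ℝ), ∀ a ∈ S, P ε a := fun P hS hh => (eventually_all_finite hS).mpr hh
  have Ec : ∀ᶠ ε : ℝ in 𝓝[>] (0 : ℝ), ∀ n ∈ Bs, H.Adj g n → NR (-d) (Q n - (v + ε * d)) := by
    refine ev1 _ hfin fun n hn => eventually_imp_distrib_left.mpr fun e => ?_
    exact NR.eventually tendsto_const_nhds (tendsto_const_nhds.sub hlim) (hd.s2 n ⟨hn, e⟩)
  have Ed : ∀ᶠ ε : ℝ in 𝓝[>] (0 : ℝ), ∀ n ∈ Bs, ∀ m ∈ Bs, H.Adj g n → H.Adj g m → n ≠ m →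
      NR (Q n - (v + ε * d)) (Q m - (v + ε * d)) := by
    refine ev1 _ hfin fun n hn => ev1 _ hfin fun m hm => ?_
    refine eventually_imp_distrib_left.mpr fun e => eventually_imp_distrib_left.mpr fun e' =>
      eventually_imp_distrib_left.mpr fun hne => ?_
    exact NR.eventually (tendsto_const_nhds.sub hlim) (tendsto_const_nhds.sub hlim)
      (h.SS n (hN n hn (Or.inr e)) m (hN m hm (Or.inr e')) hne)
  have Ee : ∀ᶠ ε : ℝ in 𝓝[>] (0 : ℝ), ∀ n ∈ Bs, ∀ a ∈ Bs, ∀ b ∈ Bs, H.Adj g n → H.Adj a b → n ≠ a →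
      n ≠ b → Disjoint (segment ℝ (v + ε * d) (Q n)) (segment ℝ (Q a) (Q b)) := by
    refine ev1 _ hfin fun n hn => ev1 _ hfin fun a ha => ev1 _ hfin fun b hb => ?_
    refine eventually_imp_distrib_left.mpr fun e => eventually_imp_distrib_left.mpr fun e' =>
      eventually_imp_distrib_left.mpr fun h1 => eventually_imp_distrib_left.mpr fun h2 => ?_
    exact seg_disj_eventually hlim tendsto_const_nhds (seg_compact _ _).isClosed
      (h.SB n (hN n hn (Or.inr e)) a ha b hb e' h1 h2)
  have Er : ∀ᶠ ε : ℝ in 𝓝[>] (0 : ℝ), ∀ n ∈ Bs, ∀ b ∈ Bs, H.Adj g n → H.Adj n b →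
      NR (v + ε * d - Q n) (Q b - Q n) := by
    refine ev1 _ hfin fun n hn => ev1 _ hfin fun b hb => ?_
    refine eventually_imp_distrib_left.mpr fun e => eventually_imp_distrib_left.mpr fun e' => ?_
    exact NR.eventually (hlim.sub tendsto_const_nhds) tendsto_const_nhds
      (h.SBr n (hN n hn (Or.inr e)) b hb e')
  have Ef : ∀ᶠ ε : ℝ in 𝓝[>] (0 : ℝ), ∀ a ∈ Bs, ∀ b ∈ Bs, H.Adj a b →
      Disjoint (segment ℝ v (v + ε * d)) (segment ℝ (Q a) (Q b)) := by
    refine ev1 _ hfin fun a ha => ev1 _ hfin fun b hb => ?_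
    refine eventually_imp_distrib_left.mpr fun e' => ?_
    refine seg_disj_eventually tendsto_const_nhds hlim (seg_compact _ _).isClosed ?_
    rw [segment_same, disjoint_singleton_left]
    exact h.V a ha b hb e'
  filter_upwards [Ec, Ed, Ee, Er, Ef, self_mem_nhdsWithin] with ε Ec Ed Ee Er Ef hε
  rw [mem_Ioi] at hε
  have pf : spos Q f g v (v + ε * d) f = v := by simp [spos]
  have pg : spos Q f g v (v + ε * d) g = v + ε * d := by simp [spos, hfg.symm]
  have pB : ∀ n ∈ Bs, spos Q f g v (v + ε * d) n = Q n := by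
    intro n hn
    have h1 : n ≠ f := fun e => hfB (e ▸ hn)
    have h2 : n ≠ g := fun e => hgB (e ▸ hn)
    simp [spos, h1, h2]
  generalize spos Q f g v (v + ε * d) = pos at *
  have hεc : (ε : ℂ) ≠ 0 := by exact_mod_cast hε.ne'
  -- case (b)
  have Eb : ∀ n' ∈ Bs, ∀ n ∈ Bs, H.Adj f n' → H.Adj g n → n' ≠ n →
      Disjoint (segment ℝ v (Q n')) (segment ℝ (v + ε * d) (Q n)) := by
    intro n' hn' n hn e' e hne
    rw [Set.disjoint_left]
    intro p hp1 hp2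
    obtain ⟨σ, hσ0, hσ1, rfl⟩ := mem_seg.mp hp1
    obtain ⟨τ, hτ0, hτ1, e3⟩ := mem_seg.mp hp2
    rcases eq_or_lt_of_le hσ0 with hσ | hσ
    · subst hσ
      have := (hd.s2 n ⟨hn, e⟩).eq_zero (r := (1 - τ) * ε) (s := τ)
        (mul_nonneg (by linarith) hε.le) hτ0 (by
          push_cast; push_cast at e3; linear_combination e3)
      obtain ⟨h1, h2⟩ := this
      subst h2
      linarith
    · refine hd.s3 n' ⟨hn', e'⟩ n ⟨hn, e⟩ hne ((1 - τ) * ε / σ) (τ / σ)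
        (div_nonneg (mul_nonneg (by linarith) hε.le) hσ.le) (by positivity) ?_
      have hσc : (σ : ℂ) ≠ 0 := by exact_mod_cast hσ.ne'
      push_cast
      field_simp
      linear_combination e3
  have Enn : ∀ n ∈ Bs, H.Adj f n → H.Adj g n → NR (v - Q n) (v + ε * d - Q n) := by
    intro n hn e e'
    have h1 : NR d (Q n - v) := hd.s1 n ⟨hn, e⟩
    have h2 : NR (-d) (Q n - v) := hd.s2 n ⟨hn, e'⟩
    have hw : v - Q n ≠ 0 := by
      have := h1.ne_right; intro hh; apply this; linear_combination -hh
    have hw2 : v + ε * d - Q n ≠ 0 := by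
      intro hh
      have := h1.eq_zero (r := ε) (s := 1) hε.le zero_le_one (by push_cast; linear_combination hh)
      exact hε.ne' this.1
    rw [nr_iff hw hw2]
    intro r hr e3
    rcases le_total r 1 with hr1 | hr1
    · have := h1.eq_zero (r := ε) (s := 1 - r) hε.le (by linarith) (by
        push_cast; linear_combination e3)
      exact hε.ne' this.1
    · have := h2.eq_zero (r := ε) (s := r - 1) hε.le (by linarith) (by
        push_cast; linear_combination -e3)
      exact hε.ne' this.1
  have Efg : ∀ n ∈ Bs, H.Adj g n → NR (v - (v + ε * d)) (Q n - (v + ε * d)) := by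
    intro n hn e
    have := (Ec n hn e).smul_left hε
    have e2 : v - (v + ε * d) = ε * (-d) := by ring
    rwa [e2]
  have Eff : ∀ n ∈ Bs, H.Adj f n → NR (v + ε * d - v) (Q n - v) := by
    intro n hn e
    have := (hd.s1 n ⟨hn, e⟩).smul_left hε
    have e2 : v + ε * d - v = ε * d := by ring
    rwa [e2]
  constructor
  · set T : α → α → Prop := fun u w => (u ∈ Bs ∧ w ∈ Bs) ∨ (u = f ∧ w ∈ Bs) ∨ (u = g ∧ w ∈ Bs) ∨
      (u = f ∧ w = g) with hT
    have hTT : ∀ u ∈ A, ∀ w ∈ A, H.Adj u w → T u w ∨ T w u := by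
      intro u hu w hw e
      have := e.ne
      have h1 := hA u hu
      have h2 := hA w hw
      simp only [hT]
      grind
    have key : ∀ u w x y, T u w → T x y → H.Adj u w → H.Adj x y → u ≠ x → u ≠ y → w ≠ x → w ≠ y →
        Disjoint (segment ℝ (pos u) (pos w)) (segment ℝ (pos x) (pos y)) := by
      intro u w x y hu hx e1 e2 a1 a2 a3 a4
      rcases hu with ⟨hu, hw⟩ | ⟨rfl, hw⟩ | ⟨rfl, hw⟩ | ⟨rfl, rfl⟩ <;>
      rcases hx with ⟨hx, hy⟩ | ⟨rfl, hy⟩ | ⟨rfl, hy⟩ | ⟨rfl, rfl⟩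
      · rw [pB u hu, pB w hw, pB x hx, pB y hy]
        exact h.BB u hu w hw x hx y hy e1 e2 a1 a2 a3 a4
      · rw [pB u hu, pB w hw, pf, pB y hy]
        exact (h.SB y (hN y hy (Or.inl e2)) u hu w hw e1 a2.symm a4.symm).symm
      · rw [pB u hu, pB w hw, pg, pB y hy]
        exact (Ee y hy u hu w hw e2 e1 a2.symm a4.symm).symm
      · rw [pB u hu, pB w hw, pf, pg]
        exact (Ef u hu w hw e1).symm
      · rw [pf, pB w hw, pB x hx, pB y hy]
        exact h.SB w (hN w hw (Or.inl e1)) x hx y hy e2 a3 a4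
      · exact absurd rfl a1
      · rw [pf, pB w hw, pg, pB y hy]
        exact Eb w hw y hy e1 e2 a4
      · exact absurd rfl a1
      · rw [pg, pB w hw, pB x hx, pB y hy]
        exact Ee w hw x hx y hy e1 e2 a3 a4
      · rw [pf, pB w hw, pg, pB y hy]
        exact (Eb y hy w hw e2 e1 a4.symm).symm
      · exact absurd rfl a1
      · exact absurd rfl a2
      · rw [pf, pg, pB x hx, pB y hy]
        exact Ef x hx y hy e2
      · exact absurd rfl a1
      · exact absurd rfl a3
      · exact absurd rfl a1
    intro u hu w hw x hx y hy e1 e2 a1 a2 a3 a4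
    rcases hTT u hu w hw e1 with t1 | t1 <;> rcases hTT x hx y hy e2 with t2 | t2
    · exact key _ _ _ _ t1 t2 e1 e2 a1 a2 a3 a4
    · rw [segment_symm ℝ (pos x)]
      exact key _ _ _ _ t1 t2 e1 e2.symm a2 a1 a4 a3
    · rw [segment_symm ℝ (pos u)]
      exact key _ _ _ _ t1 t2 e1.symm e2 a3 a4 a1 a2
    · rw [segment_symm ℝ (pos u), segment_symm ℝ (pos x)]
      exact key _ _ _ _ t1 t2 e1.symm e2.symm a4 a3 a2 a1
  · intro u hu w hw x hx e1 e2 hne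
    rcases hA u hu with rfl | rfl | hu'
    · rcases hA w hw with rfl | rfl | hw' <;> rcases hA x hx with rfl | rfl | hx' <;>
        first | exact absurd rfl e1.ne | exact absurd rfl e2.ne | exact absurd rfl hne | skip
      · rw [pg, pf, pB x hx']
        exact Eff x hx' e2
      · rw [pg, pf, pB w hw']
        exact (Eff w hw' e1).symm
      · rw [pf, pB w hw', pB x hx']
        exact h.SS w (hN w hw' (Or.inl e1)) x (hN x hx' (Or.inl e2)) hne
    · rcases hA w hw with rfl | rfl | hw' <;> rcases hA x hx with rfl | rfl | hx' <;>
        first | exact absurd rfl e1.ne | exact absurd rfl e2.ne | exact absurd rfl hne | skip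
      · rw [pg, pf, pB x hx']
        exact Efg x hx' e2
      · rw [pg, pf, pB w hw']
        exact (Efg w hw' e1).symm
      · rw [pg, pB w hw', pB x hx']
        exact Ed w hw' x hx' e1 e2 hne
    · rcases hA w hw with rfl | rfl | hw' <;> rcases hA x hx with rfl | rfl | hx' <;>
        first | exact absurd rfl hne | skip
      · rw [pg, pf, pB u hu']
        exact Enn u hu' e1.symm e2.symm
      · rw [pf, pB u hu', pB x hx']
        exact h.SBr u (hN u hu' (Or.inl e1.symm)) x hx' e2
      · rw [pg, pf, pB u hu']
        exact (Enn u hu' e2.symm e1.symm).symm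
      · rw [pg, pB u hu', pB x hx']
        exact Er u hu' x hx' e1.symm e2
      · rw [pf, pB u hu', pB w hw']
        exact (h.SBr u (hN u hu' (Or.inl e2.symm)) w hw' e1).symm
      · rw [pg, pB u hu', pB w hw']
        exact (Er u hu' w hw' e2.symm e1).symm
      · rw [pB w hw', pB u hu', pB x hx']
        exact h.BBr u hu' w hw' x hx' e1 e2 hne

end Split

end

section
open Set Complex Topology Filter

lemma arg_ne_of_nr {a b κ : ℂ} (hκ : κ ≠ 0) (h : NR a b) : arg (a * κ) ≠ arg (b * κ) := by
  intro e
  have ha : a * κ ≠ 0 := mul_ne_zero h.ne_left hκ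
  have hb : b * κ ≠ 0 := mul_ne_zero h.ne_right hκ
  rw [arg_eq_arg_iff ha hb] at e
  refine (nr_iff h.ne_left h.ne_right).mp h (‖b * κ‖ / ‖a * κ‖)
    (div_pos (norm_pos_iff.mpr hb) (norm_pos_iff.mpr ha)) ?_
  have : ((‖b * κ‖ / ‖a * κ‖ : ℝ) : ℂ) * a * κ = b * κ := by
    push_cast
    rw [mul_assoc]; exact e
  exact (mul_right_cancel₀ hκ this).symm

section T

variable {α : Type*}

lemma LD.dir_common {H : SimpleGraph α} {Bs N : Set α} {Q : α → ℂ} {v κ : ℂ} (h : LD H Bs N Q v)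
    (hκ : κ ≠ 0) (hfin : Bs.Finite) {f g : α}
    (hN : ∀ n ∈ Bs, H.Adj f n ∨ H.Adj g n → n ∈ N)
    {a b : α} (ha : a ∈ Bs) (hb : b ∈ Bs) (hab : a ≠ b) (hga : H.Adj g a) (hgb : H.Adj g b)
    (hno : ∀ y₁ ∈ Bs, ∀ k ∈ Bs, ∀ y₂ ∈ Bs, H.Adj g y₁ → H.Adj f k → H.Adj g y₂ →
      arg ((Q y₁ - v) * κ) < arg ((Q k - v) * κ) → arg ((Q k - v) * κ) < arg ((Q y₂ - v) * κ) →
      False) :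
    ∃ d p q, Dir {n | n ∈ Bs ∧ H.Adj f n} {n | n ∈ Bs ∧ H.Adj g n} (fun n => Q n - v) d ∧
      (p ∈ Bs ∧ H.Adj g p) ∧ (q ∈ Bs ∧ H.Adj g q) ∧
      (arg ((Q q - v) * κ) - arg ((Q p - v) * κ) < Real.pi →
        ∃ a b : ℝ, 0 ≤ a ∧ 0 ≤ b ∧ d = a * (Q p - v) + b * (Q q - v)) := by
  have hYf : {n | n ∈ Bs ∧ H.Adj g n}.Finite := hfin.subset fun n hn => hn.1
  obtain ⟨p, hp, hpm⟩ := exists_min_image _ (fun n => arg ((Q n - v) * κ)) hYf ⟨a, ha, hga⟩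
  obtain ⟨q, hq, hqm⟩ := exists_max_image _ (fun n => arg ((Q n - v) * κ)) hYf ⟨a, ha, hga⟩
  have hinj : ∀ n ∈ N, ∀ m ∈ N, n ≠ m → arg ((Q n - v) * κ) ≠ arg ((Q m - v) * κ) :=
    fun n hn m hm hne => arg_ne_of_nr hκ (h.SS n hn m hm hne)
  have hne := hinj a (hN a ha (Or.inr hga)) b (hN b hb (Or.inr hgb)) hab
  have hpq : arg ((Q p - v) * κ) < arg ((Q q - v) * κ) := by
    have h1 := hpm a ⟨ha, hga⟩
    have h2 := hpm b ⟨hb, hgb⟩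
    have h3 := hqm a ⟨ha, hga⟩
    have h4 := hqm b ⟨hb, hgb⟩
    rcases lt_or_gt_of_ne hne with h | h <;> linarith
  obtain ⟨d, hd, hd'⟩ := dir_exists (X := {n | n ∈ Bs ∧ H.Adj f n})
    (Y := {n | n ∈ Bs ∧ H.Adj g n}) (w := fun n => Q n - v) hκ
    (fun n hn => sub_ne_zero.mpr (h.VN n (hN n hn.1 (Or.inl hn.2))))
    (fun n hn => sub_ne_zero.mpr (h.VN n (hN n hn.1 (Or.inr hn.2))))
    (fun n hn m hm hne => hinj n (hN n hn.1 (Or.inl hn.2)) m (hN m hm.1 (Or.inr hm.2)) hne)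
    hp hq hpq hpm hqm
    (fun n hn hh => hno p hp.1 n hn.1 q hq.1 hp.2 hn.2 hq.2 hh.1 hh.2)
  exact ⟨d, p, q, hd, hp, hq, hd'⟩

lemma LD.dir_extra {H : SimpleGraph α} {A Bs N : Set α} {Q : α → ℂ} {v : ℂ} (h : LD H Bs N Q v)
    (hBC : BC H Bs) (hBA : Bs ⊆ A) {f g : α} (hf : f ∈ A) (hg : g ∈ A)
    (hfB : f ∉ Bs) (hgB : g ∉ Bs) (hfg : H.Adj f g) (hk : ¬ K33M H A)
    (hN : ∀ n ∈ Bs, H.Adj f n ∨ H.Adj g n → n ∈ N)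
    {a b n₀ : α} (ha : a ∈ Bs) (hb : b ∈ Bs) (hab : a ≠ b) (hga : H.Adj g a) (hgb : H.Adj g b)
    (hn₀ : n₀ ∈ Bs) (hf0 : H.Adj f n₀) (hg0 : ¬ H.Adj g n₀) :
    ∃ d, Dir {n | n ∈ Bs ∧ H.Adj f n} {n | n ∈ Bs ∧ H.Adj g n} (fun n => Q n - v) d := by
  have hw : Q n₀ - v ≠ 0 := sub_ne_zero.mpr (h.VN _ (hN _ hn₀ (Or.inl hf0)))
  have hκ : -(Q n₀ - v)⁻¹ ≠ 0 := neg_ne_zero.mpr (inv_ne_zero hw)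
  have hpi : arg ((Q n₀ - v) * -(Q n₀ - v)⁻¹) = Real.pi := by
    rw [mul_neg, mul_inv_cancel₀ hw]; simp
  obtain ⟨d, -, -, hd, -⟩ := h.dir_common hκ hBC.1 hN ha hb hab hga hgb (by
    intro y₁ hy₁ k hk' y₂ hy₂ e1 e2 e3 l1 l2
    have l3 : arg ((Q y₂ - v) * -(Q n₀ - v)⁻¹) < arg ((Q n₀ - v) * -(Q n₀ - v)⁻¹) := by
      refine lt_of_le_of_ne (hpi ▸ arg_le_pi _) ?_
      refine arg_ne_of_nr hκ (h.SS _ (hN _ hy₂ (Or.inr e3)) _ (hN _ hn₀ (Or.inl hf0)) ?_)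
      rintro rfl; exact hg0 e3
    refine h.star hκ hBC hBA hg hf hgB hfB hfg.symm hk ![y₁, k, y₂, n₀] ?_ e1 e2 e3 hf0 ?_
    · intro i; fin_cases i
      · exact hN _ hy₁ (Or.inr e1)
      · exact hN _ hk' (Or.inl e2)
      · exact hN _ hy₂ (Or.inr e3)
      · exact hN _ hn₀ (Or.inl hf0)
    · intro i j hij
      fin_cases i <;> fin_cases j <;> first | exact absurd hij (by decide) | skip
      · exact l1
      · exact l1.trans l2
      · exact l1.trans (l2.trans l3)
      · exact l2
      · exact l2.trans l3
      · exact l3)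
  exact ⟨d, hd⟩

lemma LD.dir_corner {H : SimpleGraph α} {A Bs N : Set α} {Q : α → ℂ} {v κ : ℂ} (h : LD H Bs N Q v)
    (hκ : κ ≠ 0) (hBC : BC H Bs) (hBA : Bs ⊆ A) {f g : α} (hf : f ∈ A) (hg : g ∈ A)
    (hfB : f ∉ Bs) (hgB : g ∉ Bs) (hfg : H.Adj f g) (hk : ¬ K33M H A) (hk5 : ¬ K5M H A)
    (hN : ∀ n ∈ Bs, H.Adj f n ∨ H.Adj g n → n ∈ N)
    {a b c₁ c₂ j : α} (ha : a ∈ Bs) (hb : b ∈ Bs) (hab : a ≠ b) (hga : H.Adj g a) (hgb : H.Adj g b)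
    (hc₁ : c₁ ∈ Bs) (hc₂ : c₂ ∈ Bs) (e₁ : H.Adj f c₁) (e₂ : H.Adj f c₂) (hj : j ∈ Bs)
    (hgj : H.Adj g j) (hj1 : j ≠ c₁) (hj2 : j ≠ c₂)
    (h12 : arg ((Q c₁ - v) * κ) < arg ((Q c₂ - v) * κ))
    (hpi : arg ((Q c₂ - v) * κ) - arg ((Q c₁ - v) * κ) < Real.pi)
    (hcone : ∀ n ∈ N, arg ((Q c₁ - v) * κ) ≤ arg ((Q n - v) * κ) ∧
      arg ((Q n - v) * κ) ≤ arg ((Q c₂ - v) * κ)) :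
    ∃ d p q, Dir {n | n ∈ Bs ∧ H.Adj f n} {n | n ∈ Bs ∧ H.Adj g n} (fun n => Q n - v) d ∧
      p ∈ Bs ∧ q ∈ Bs ∧ ∃ a b : ℝ, 0 ≤ a ∧ 0 ≤ b ∧ d = a * (Q p - v) + b * (Q q - v) := by
  have hinj : ∀ n ∈ N, ∀ m ∈ N, n ≠ m → arg ((Q n - v) * κ) ≠ arg ((Q m - v) * κ) :=
    fun n hn m hm hne => arg_ne_of_nr hκ (h.SS n hn m hm hne)
  have n1 := hN _ hc₁ (Or.inl e₁)
  have n2 := hN _ hc₂ (Or.inl e₂)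
  have hlow : ∀ n ∈ N, n ≠ c₁ → arg ((Q c₁ - v) * κ) < arg ((Q n - v) * κ) := fun n hn hne =>
    lt_of_le_of_ne (hcone n hn).1 (hinj _ n1 _ hn hne.symm)
  have hhigh : ∀ n ∈ N, n ≠ c₂ → arg ((Q n - v) * κ) < arg ((Q c₂ - v) * κ) := fun n hn hne =>
    lt_of_le_of_ne (hcone n hn).2 (hinj _ hn _ n2 hne)
  have st : ∀ {x y : α}, x ∈ A → y ∈ A → x ∉ Bs → y ∉ Bs → H.Adj x y → ∀ p q r s : α,
      p ∈ N → q ∈ N → r ∈ N → s ∈ N → H.Adj x p → H.Adj y q → H.Adj x r → H.Adj y s →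
      arg ((Q p - v) * κ) < arg ((Q q - v) * κ) → arg ((Q q - v) * κ) < arg ((Q r - v) * κ) →
      arg ((Q r - v) * κ) < arg ((Q s - v) * κ) → False := by
    intro x y hx hy hxB hyB hxy p q r s hp hq hr hs a1 a2 a3 a4 l1 l2 l3
    refine h.star hκ hBC hBA hx hy hxB hyB hxy hk ![p, q, r, s] ?_ a1 a2 a3 a4 ?_
    · intro i; fin_cases i
      exacts [hp, hq, hr, hs]
    · intro i j hij
      fin_cases i <;> fin_cases j <;> first | exact absurd hij (by decide) | skip
      · exact l1
      · exact l1.trans l2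
      · exact l1.trans (l2.trans l3)
      · exact l2
      · exact l2.trans l3
      · exact l3
  obtain ⟨d, p, q, hd, hp, hq, hpq⟩ := h.dir_common hκ hBC.1 hN ha hb hab hga hgb (by
    intro y₁ hy₁ k hk' y₂ hy₂ a1 a2 a3 l1 l2
    have m1 := hN _ hy₁ (Or.inr a1)
    have mk := hN _ hk' (Or.inl a2)
    have m2 := hN _ hy₂ (Or.inr a3)
    have mj := hN _ hj (Or.inr hgj)
    by_cases c1 : y₁ = c₁
    · by_cases c2 : y₂ = c₂
      · subst c1 c2
        by_cases hgk : H.Adj g k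
        · refine star5 hBC hBA hf hg hfB hgB hfg hk5 ![y₁, k, y₂] ?_ ?_ ?_ ?_
          · have d1 : y₁ ≠ k := by rintro rfl; exact lt_irrefl _ l1
            have d2 : k ≠ y₂ := by rintro rfl; exact lt_irrefl _ l2
            have d3 : y₁ ≠ y₂ := by rintro rfl; exact lt_irrefl _ (l1.trans l2)
            intro i j; fin_cases i <;> fin_cases j <;>
              simp [d1, d2, d3, d1.symm, d2.symm, d3.symm]
          · intro i; fin_cases i
            exacts [hy₁, hk', hy₂]
          · intro i; fin_cases i
            exacts [e₁, a2, e₂]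
          · intro i; fin_cases i
            exacts [a1, hgk, a3]
        · have hjk : j ≠ k := by rintro rfl; exact hgk hgj
          rcases lt_or_gt_of_ne (hinj _ mj _ mk hjk) with l | l
          · exact st hf hg hfB hgB hfg y₁ j k y₂ m1 mj mk m2 e₁ hgj a2 a3 (hlow _ mj hj1) l l2
          · exact st hg hf hgB hfB hfg.symm y₁ k j y₂ m1 mk mj m2 a1 a2 hgj e₂ l1 l
              (hhigh _ mj hj2)
      · exact st hg hf hgB hfB hfg.symm y₁ k y₂ c₂ m1 mk m2 n2 a1 a2 a3 e₂ l1 l2 (hhigh _ m2 c2)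
    · exact st hf hg hfB hgB hfg c₁ y₁ k y₂ n1 m1 mk m2 e₁ a1 a2 a3 (hlow _ m1 c1) l1 l2)
  refine ⟨d, p, q, hd, hp.1, hq.1, hpq ?_⟩
  have := (hcone q (hN q hq.1 (Or.inr hq.2))).2
  have := (hcone p (hN p hp.1 (Or.inr hp.2))).1
  linarith

lemma ctr_adj_of {H : SimpleGraph α} {x y a b : α} (e : H.Adj a b) (ha : a ≠ y) (hb : b ≠ y) :
    (ctr H x y).Adj a b := ⟨e.ne, ha, hb, Or.inl e⟩

lemma LD.of_sld {H : SimpleGraph α} {A : Set α} {Q : α → ℂ} {x y : α}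
    (hS : SLD (ctr H x y) (A \ {y}) Q) (hT : TC (ctr H x y) (A \ {y})) (hx : x ∈ A) (hxy : x ≠ y) :
    LD H (A \ {x, y}) {n | n ∈ A \ {x, y} ∧ (H.Adj x n ∨ H.Adj y n)} Q (Q x) := by
  have hB : ∀ u ∈ A \ {x, y}, u ∈ A \ {y} ∧ u ≠ x ∧ u ≠ y := by
    rintro u ⟨hu, hu'⟩
    simp only [mem_insert_iff, mem_singleton_iff, not_or] at hu'
    exact ⟨⟨hu, hu'.2⟩, hu'⟩
  have hB1 : ∀ u ∈ A \ {x, y}, u ∈ A \ {y} := fun u hu => (hB u hu).1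
  have hx' : x ∈ A \ {y} := ⟨hx, hxy⟩
  have hadj : ∀ u ∈ A \ {x, y}, ∀ w ∈ A \ {x, y}, H.Adj u w → (ctr H x y).Adj u w :=
    fun u hu w hw e => ctr_adj_of e (hB u hu).2.2 (hB w hw).2.2
  have hadjx : ∀ n, (n ∈ A \ {x, y} ∧ (H.Adj x n ∨ H.Adj y n)) → (ctr H x y).Adj x n := by
    rintro n ⟨hn, e⟩
    refine ⟨(hB n hn).2.1.symm, hxy, (hB n hn).2.2, ?_⟩
    rcases e with e | e
    · exact Or.inl e
    · exact Or.inr (Or.inl ⟨rfl, e⟩)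
  refine ⟨fun n hn => hn.1, ?_, ?_, ?_, ?_, ?_, ?_, ?_⟩
  · intro u hu w hw a ha b hb e1 e2
    exact hS.1 u (hB1 u hu) w (hB1 w hw) a (hB1 a ha) b (hB1 b hb) (hadj u hu w hw e1)
      (hadj a ha b hb e2)
  · intro u hu w hw a ha e1 e2
    exact hS.2 u (hB1 u hu) w (hB1 w hw) a (hB1 a ha) (hadj u hu w hw e1) (hadj u hu a ha e2)
  · intro n hn a ha b hb e h1 h2
    exact hS.1 x hx' n (hB1 n hn.1) a (hB1 a ha) b (hB1 b hb) (hadjx n hn) (hadj a ha b hb e)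
      (hB a ha).2.1.symm (hB b hb).2.1.symm h1 h2
  · intro n hn a ha e
    exact hS.2 n (hB1 n hn.1) x hx' a (hB1 a ha) (hadjx n hn).symm (hadj n hn.1 a ha e)
      (hB a ha).2.1.symm
  · intro n hn m hm hne
    exact hS.2 x hx' n (hB1 n hn.1) m (hB1 m hm.1) (hadjx n hn) (hadjx m hm) hne
  · intro a ha b hb e
    exact hS.vert hT (hB1 a ha) (hB1 b hb) hx' (hadj a ha b hb e) (hB a ha).2.1.symm
      (hB b hb).2.1.symm
  · intro n hn
    exact hS.inj hT hx' (hB1 n hn.1) (hB n hn.1).2.1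

end T

end

section
open Set Complex Topology Filter

/-- the standard triangle -/
def Tri : Set ℂ := {p | 0 ≤ p.re ∧ 0 ≤ p.im ∧ p.re + p.im ≤ 1}

section T

variable {α : Type*}

lemma TC.two_nbr {H : SimpleGraph α} {A : Set α} (h : TC H A) {f g : α} (hg : g ∈ A) (hfg : f ≠ g) :
    ∃ a ∈ A \ {f, g}, ∃ b ∈ A \ {f, g}, a ≠ b ∧ H.Adj g a ∧ H.Adj g b := by
  obtain ⟨a, ha, haf, -, e⟩ := h.nbr hg f f hfg.symm hfg.symm
  obtain ⟨b, hb, hbf, hba, e'⟩ := h.nbr hg f a hfg.symm e.ne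
  exact ⟨a, by simp [ha, haf, e.ne.symm], b, by simp [hb, hbf, e'.ne.symm], hba.symm, e, e'⟩

lemma corner_step_aux {H : SimpleGraph α} {A : Set α} (h : TC H A) (h5 : 5 ≤ A.ncard)
    (hk : ¬ K33M H A) (hk5 : ¬ K5M H A) {c y c₁ c₂ : α} (hc : c ∈ A) (hy : y ∈ A) (hc₁ : c₁ ∈ A)
    (hc₂ : c₂ ∈ A) (e₁ : H.Adj c c₁) (e₂ : H.Adj c c₂) (hcy : H.Adj c y)
    (hy1 : y ≠ c₁) (hy2 : y ≠ c₂) (hn : TC (ctr H c y) (A \ {y})) (hcn : Cn H (A \ {c, c₁, c₂}))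
    {Q : α → ℂ} (hS : SLD (ctr H c y) (A \ {y}) Q) (hTri : ∀ u ∈ A \ {y}, Q u ∈ Tri)
    {κ : ℂ} (hκ : κ ≠ 0) (hre1 : 0 < ((Q c₁ - Q c) * κ).re) (hre2 : 0 < ((Q c₂ - Q c) * κ).re)
    (hcone : ∀ p ∈ Tri, ∃ a b : ℝ, 0 ≤ a ∧ 0 ≤ b ∧ p - Q c = a * (Q c₁ - Q c) + b * (Q c₂ - Q c))
    (h12 : arg ((Q c₁ - Q c) * κ) < arg ((Q c₂ - Q c) * κ)) :
    ∃ pos, SLD H A pos ∧ (∀ u ∈ A, u ≠ y → pos u = Q u) ∧ pos y ∈ Tri := by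
  have hLD := LD.of_sld hS hn hc hcy.ne
  have hBC : BC H (A \ {c, y}) := h.bc h5 hc hy hcy.ne
    (fun w hw h1 h2 => contr_cn hc hcy hn hw h1 h2)
  have hcB : c ∉ A \ {c, y} := by simp
  have hyB : y ∉ A \ {c, y} := by simp
  have hB : ∀ u ∈ A, u ≠ c → u ≠ y → u ∈ A \ {c, y} := fun u hu h1 h2 => by simp [hu, h1, h2]
  obtain ⟨a, ha, b, hb, hab, hga, hgb⟩ := h.two_nbr (f := c) hy hcy.ne
  obtain ⟨j, hj, hjc, hj1, hj2, hgj⟩ : ∃ j ∈ A, j ≠ c ∧ j ≠ c₁ ∧ j ≠ c₂ ∧ H.Adj y j := by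
    obtain ⟨v, hv, hv'⟩ := exists_notMem_of_card (A := A) (S := {y, c, c₁, c₂}) (toFinite _)
      (by have := ncard_quad_le y c c₁ c₂; omega)
    simp only [mem_insert_iff, mem_singleton_iff, not_or] at hv'
    obtain ⟨x', hx', j, hj, hj', e⟩ := hcn.edge (C := {y})
      (by simp [hy, hy1, hy2, hcy.ne.symm]) ⟨y, rfl⟩ (v := v) (by simp [hv, hv']) (by simp [hv'])
    simp only [mem_singleton_iff] at hx'
    subst hx'
    simp only [Set.mem_sdiff, mem_insert_iff, mem_singleton_iff, not_or] at hj
    exact ⟨j, hj.1, hj.2.1, hj.2.2.1, hj.2.2.2, e⟩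
  set u₁ := (Q c₁ - Q c) * κ with hu₁
  set u₂ := (Q c₂ - Q c) * κ with hu₂
  have ab1 : |arg u₁| < Real.pi / 2 := abs_arg_lt_pi_div_two_iff.mpr (Or.inl hre1)
  have ab2 : |arg u₂| < Real.pi / 2 := abs_arg_lt_pi_div_two_iff.mpr (Or.inl hre2)
  rw [abs_lt] at ab1 ab2
  have hpi := Real.pi_pos
  obtain ⟨d, p, q, hd, hp, hq, a', b', ha', hb', hdd⟩ := hLD.dir_corner hκ hBC sdiff_subset hc hy
    hcB hyB hcy hk hk5 (fun n hn e => ⟨hn, e⟩) ha hb hab hga hgb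
    (hB c₁ hc₁ e₁.ne.symm hy1.symm) (hB c₂ hc₂ e₂.ne.symm hy2.symm) e₁ e₂
    (hB j hj hjc hgj.ne.symm) hgj hj1 hj2 h12 (by linarith) (by
      intro n hnN
      have hnA : n ∈ A \ {y} := by
        have := hnN.1
        simp only [Set.mem_sdiff, mem_insert_iff, mem_singleton_iff, not_or] at this
        exact ⟨this.1, this.2.2⟩
      obtain ⟨r, s, hr, hs, e⟩ := hcone _ (hTri n hnA)
      have hne : (Q n - Q c) * κ ≠ 0 := mul_ne_zero (sub_ne_zero.mpr (hLD.VN n hnN)) hκ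
      have e' : (Q n - Q c) * κ = ((r * ‖u₁‖ : ℝ) : ℂ) * exp (arg u₁ * I) +
          ((s * ‖u₂‖ : ℝ) : ℂ) * exp (arg u₂ * I) := by
        push_cast
        rw [mul_assoc, norm_mul_exp_arg_mul_I, mul_assoc, norm_mul_exp_arg_mul_I, e]
        rw [hu₁, hu₂]; ring
      rw [e']
      exact arg_cone (by positivity) (by positivity) (by linarith) (by linarith) h12.le
        (by linarith) (e' ▸ hne))
  have hsplit := hLD.split (A := A) h.1.sdiff (f := c) (g := y)
    (fun u hu => by
      by_cases h1 : u = c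
      · exact Or.inl h1
      · by_cases h2 : u = y
        · exact Or.inr (Or.inl h2)
        · exact Or.inr (Or.inr (hB u hu h1 h2)))
    hcB hyB hcy.ne (fun n hn e => ⟨hn, e⟩) hd
  have hev : ∀ᶠ ε : ℝ in 𝓝[>] (0 : ℝ), ε * (a' + b') < 1 := by
    have : Tendsto (fun ε : ℝ => ε * (a' + b')) (𝓝 0) (𝓝 (0 * (a' + b'))) :=
      Continuous.tendsto (by fun_prop) 0
    rw [zero_mul] at this
    exact (this.mono_left nhdsWithin_le_nhds).eventually (gt_mem_nhds one_pos)
  obtain ⟨ε, ⟨hε1, hε2⟩, hε⟩ := ((hsplit.and hev).and self_mem_nhdsWithin).exists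
  refine ⟨_, hε1, ?_, ?_⟩
  · intro u hu huy
    by_cases h1 : u = c
    · simp [spos, h1]
    · simp [spos, h1, huy]
  · have hyc : spos Q c y (Q c) (Q c + ε * d) y = Q c + ε * d := by simp [spos, hcy.ne.symm]
    rw [hyc, hdd]
    have hBy : ∀ u ∈ A \ {c, y}, u ∈ A \ {y} := by
      intro u hu
      simp only [Set.mem_sdiff, mem_insert_iff, mem_singleton_iff, not_or] at hu
      exact ⟨hu.1, hu.2.2⟩
    obtain ⟨x1, x2, x3⟩ := hTri p (hBy p hp)
    obtain ⟨y1, y2, y3⟩ := hTri q (hBy q hq)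
    obtain ⟨z1, z2, z3⟩ := hTri c ⟨hc, hcy.ne⟩
    have k1 : 0 ≤ ε * a' := by positivity
    have k2 : 0 ≤ ε * b' := by positivity
    have k3 : 0 ≤ 1 - ε * a' - ε * b' := by linarith
    simp only [Tri, mem_ofPred_eq, add_re, add_im, mul_re, mul_im, ofReal_re, ofReal_im, sub_re,
      sub_im, zero_mul, sub_zero, add_zero]
    refine ⟨?_, ?_, ?_⟩
    · nlinarith [mul_nonneg k1 x1, mul_nonneg k2 y1, mul_nonneg k3 z1]
    · nlinarith [mul_nonneg k1 x2, mul_nonneg k2 y2, mul_nonneg k3 z2]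
    · nlinarith [mul_nonneg k1 (sub_nonneg.mpr x3), mul_nonneg k2 (sub_nonneg.mpr y3),
        mul_nonneg k3 (sub_nonneg.mpr z3)]

lemma corner_step {H : SimpleGraph α} {A : Set α} (h : TC H A) (h5 : 5 ≤ A.ncard)
    (hk : ¬ K33M H A) (hk5 : ¬ K5M H A) {c y c₁ c₂ : α} (hc : c ∈ A) (hy : y ∈ A) (hc₁ : c₁ ∈ A)
    (hc₂ : c₂ ∈ A) (e₁ : H.Adj c c₁) (e₂ : H.Adj c c₂) (h12 : c₁ ≠ c₂) (hcy : H.Adj c y)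
    (hy1 : y ≠ c₁) (hy2 : y ≠ c₂) (hn : TC (ctr H c y) (A \ {y})) (hcn : Cn H (A \ {c, c₁, c₂}))
    {Q : α → ℂ} (hS : SLD (ctr H c y) (A \ {y}) Q) (hTri : ∀ u ∈ A \ {y}, Q u ∈ Tri)
    {κ : ℂ} (hκ : κ ≠ 0) (hre1 : 0 < ((Q c₁ - Q c) * κ).re) (hre2 : 0 < ((Q c₂ - Q c) * κ).re)
    (hcone : ∀ p ∈ Tri, ∃ a b : ℝ, 0 ≤ a ∧ 0 ≤ b ∧
      p - Q c = a * (Q c₁ - Q c) + b * (Q c₂ - Q c)) :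
    ∃ pos, SLD H A pos ∧ (∀ u ∈ A, u ≠ y → pos u = Q u) ∧ pos y ∈ Tri := by
  have hLD := LD.of_sld hS hn hc hcy.ne
  have hne := arg_ne_of_nr hκ (hLD.SS c₁ ⟨by simp [hc₁, e₁.ne.symm, hy1.symm], Or.inl e₁⟩ c₂
    ⟨by simp [hc₂, e₂.ne.symm, hy2.symm], Or.inl e₂⟩ h12)
  rcases lt_or_gt_of_ne hne with hlt | hlt
  · exact corner_step_aux h h5 hk hk5 hc hy hc₁ hc₂ e₁ e₂ hcy hy1 hy2 hn hcn hS hTri hκ hre1 hre2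
      hcone hlt
  · refine corner_step_aux h h5 hk hk5 hc hy hc₂ hc₁ e₂ e₁ hcy hy2 hy1 hn ?_ hS hTri hκ hre2 hre1
      ?_ hlt
    · rwa [pair_comm c₂ c₁]
    · intro p hp
      obtain ⟨a, b, ha, hb, e⟩ := hcone p hp
      exact ⟨b, a, hb, ha, by rw [e]; ring⟩

lemma interior_step {H : SimpleGraph α} {A : Set α} (h : TC H A) (h5 : 5 ≤ A.ncard)
    (hk : ¬ K33M H A) (hk5 : ¬ K5M H A) {x y : α} (hx : x ∈ A) (hy : y ∈ A)
    (hxy : H.Adj x y) (hn : TC (ctr H x y) (A \ {y}))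
    {Q : α → ℂ} (hS : SLD (ctr H x y) (A \ {y}) Q)
    (h1 : 0 < (Q x).re) (h2 : 0 < (Q x).im) (h3 : (Q x).re + (Q x).im < 1) :
    ∃ pos, SLD H A pos ∧ (∀ u ∈ A, u ≠ x → u ≠ y → pos u = Q u) ∧ pos x ∈ Tri ∧ pos y ∈ Tri := by
  have hLD := LD.of_sld hS hn hx hxy.ne
  have hBC : BC H (A \ {x, y}) := h.bc h5 hx hy hxy.ne
    (fun w hw h1 h2 => contr_cn hx hxy hn hw h1 h2)
  have hB : ∀ u ∈ A, u ≠ x → u ≠ y → u ∈ A \ {x, y} := fun u hu h1 h2 => by simp [hu, h1, h2]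
  have main : ∃ f g d, ((f = x ∧ g = y) ∨ (f = y ∧ g = x)) ∧
      Dir {n | n ∈ A \ {x, y} ∧ H.Adj f n} {n | n ∈ A \ {x, y} ∧ H.Adj g n}
        (fun n => Q n - Q x) d := by
    by_cases hX : ∃ n₀ ∈ A \ {x, y}, H.Adj x n₀ ∧ ¬ H.Adj y n₀
    · obtain ⟨n₀, hn₀, e1, e2⟩ := hX
      obtain ⟨a, ha, b, hb, hab, hga, hgb⟩ := h.two_nbr (f := x) hy hxy.ne
      obtain ⟨d, hd⟩ := hLD.dir_extra hBC sdiff_subset hx hy (by simp) (by simp) hxy hk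
        (fun n hn e => ⟨hn, e⟩) ha hb hab hga hgb hn₀ e1 e2
      exact ⟨x, y, d, Or.inl ⟨rfl, rfl⟩, hd⟩
    · by_cases hY : ∃ n₀ ∈ A \ {x, y}, H.Adj y n₀ ∧ ¬ H.Adj x n₀
      · obtain ⟨n₀, hn₀, e1, e2⟩ := hY
        obtain ⟨a, ha, b, hb, hab, hga, hgb⟩ := h.two_nbr (f := y) hx hxy.ne.symm
        rw [pair_comm] at ha hb
        obtain ⟨d, hd⟩ := hLD.dir_extra hBC sdiff_subset hy hx (by simp) (by simp) hxy.symm hk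
          (fun n hn e => ⟨hn, e.symm⟩) ha hb hab hga hgb hn₀ e1 e2
        exact ⟨y, x, d, Or.inr ⟨rfl, rfl⟩, hd⟩
      · exfalso
        push Not at hX hY
        obtain ⟨a, ha, b, hb, hab, hga, hgb⟩ := h.two_nbr (f := x) hy hxy.ne
        have ha' := ha
        have hb' := hb
        simp only [Set.mem_sdiff, mem_insert_iff, mem_singleton_iff, not_or] at ha' hb'
        obtain ⟨v, hv, hv'⟩ := exists_notMem_of_card (A := A) (S := {x, y, a, b}) (toFinite _)
          (by have := ncard_quad_le x y a b; omega)
        simp only [mem_insert_iff, mem_singleton_iff, not_or] at hv'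
        obtain ⟨w, hw, m, hm, hm', e⟩ := (h.cn2 a b).edge (C := {x, y}) (by
            rintro u (rfl | rfl)
            · simp only [Set.mem_sdiff, mem_insert_iff, mem_singleton_iff, not_or]
              exact ⟨hx, fun h => ha'.2.1 h.symm, fun h => hb'.2.1 h.symm⟩
            · simp only [Set.mem_sdiff, mem_insert_iff, mem_singleton_iff, not_or]
              exact ⟨hy, fun h => ha'.2.2 h.symm, fun h => hb'.2.2 h.symm⟩)
          ⟨x, by simp⟩ (v := v) (by simp [hv, hv']) (by simp [hv'])
        simp only [mem_insert_iff, mem_singleton_iff, not_or] at hm'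
        simp only [Set.mem_sdiff, mem_insert_iff, mem_singleton_iff, not_or] at hm
        have hmB := hB m hm.1 hm'.1 hm'.2
        have hxm : H.Adj x m := by
          rcases hw with rfl | rfl
          · exact e
          · exact hY m hmB e
        have d1 : a ≠ m := fun h => hm.2.1 h.symm
        have d2 : b ≠ m := fun h => hm.2.2 h.symm
        refine star5 hBC sdiff_subset hx hy (by simp) (by simp) hxy hk5 ![a, b, m] ?_ ?_ ?_ ?_
        · intro i j; fin_cases i <;> fin_cases j <;>
            simp [d1, d2, hab, d1.symm, d2.symm, hab.symm]
        · intro i; fin_cases i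
          exacts [ha, hb, hmB]
        · intro i; fin_cases i
          exacts [hY a ha hga, hY b hb hgb, hxm]
        · intro i; fin_cases i
          exacts [hga, hgb, hX m hmB hxm]
  obtain ⟨f, g, d, hfg, hd⟩ := main
  have hsplit := hLD.split (A := A) h.1.sdiff (f := f) (g := g)
    (fun u hu => by
      by_cases hux : u = x
      · rcases hfg with ⟨rfl, rfl⟩ | ⟨rfl, rfl⟩
        · exact Or.inl hux
        · exact Or.inr (Or.inl hux)
      · by_cases huy : u = y
        · rcases hfg with ⟨rfl, rfl⟩ | ⟨rfl, rfl⟩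
          · exact Or.inr (Or.inl huy)
          · exact Or.inl huy
        · exact Or.inr (Or.inr (hB u hu hux huy)))
    (by rcases hfg with ⟨rfl, rfl⟩ | ⟨rfl, rfl⟩ <;> simp)
    (by rcases hfg with ⟨rfl, rfl⟩ | ⟨rfl, rfl⟩ <;> simp)
    (by rcases hfg with ⟨rfl, rfl⟩ | ⟨rfl, rfl⟩
        · exact hxy.ne
        · exact hxy.ne.symm)
    (by rcases hfg with ⟨rfl, rfl⟩ | ⟨rfl, rfl⟩
        · exact fun n hn e => ⟨hn, e⟩
        · exact fun n hn e => ⟨hn, e.symm⟩) hd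
  have hlim : Tendsto (fun ε : ℝ => Q x + ε * d) (𝓝[>] (0 : ℝ)) (𝓝 (Q x)) := by
    have : Tendsto (fun ε : ℝ => Q x + ε * d) (𝓝 (0 : ℝ)) (𝓝 (Q x + ((0 : ℝ) : ℂ) * d)) :=
      Continuous.tendsto (by fun_prop) 0
    simp only [ofReal_zero, zero_mul, add_zero] at this
    exact this.mono_left nhdsWithin_le_nhds
  have hev : ∀ᶠ ε : ℝ in 𝓝[>] (0 : ℝ), Q x + ε * d ∈ Tri := by
    have hr := (continuous_re.tendsto _).comp hlim
    have hi := (continuous_im.tendsto _).comp hlim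
    filter_upwards [hr.eventually (lt_mem_nhds h1), hi.eventually (lt_mem_nhds h2),
      (hr.add hi).eventually (gt_mem_nhds h3)] with ε a1 a2 a3
    exact ⟨le_of_lt a1, le_of_lt a2, le_of_lt a3⟩
  obtain ⟨ε, hε1, hε2⟩ := (hsplit.and hev).exists
  have hxT : Q x ∈ Tri := ⟨h1.le, h2.le, h3.le⟩
  refine ⟨_, hε1, ?_, ?_, ?_⟩
  · intro u hu a1 a2
    rcases hfg with ⟨rfl, rfl⟩ | ⟨rfl, rfl⟩ <;> simp [spos, a1, a2]
  · rcases hfg with ⟨rfl, rfl⟩ | ⟨rfl, rfl⟩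
    · simpa [spos] using hxT
    · simpa [spos, hxy.ne] using hε2
  · rcases hfg with ⟨rfl, rfl⟩ | ⟨rfl, rfl⟩
    · simpa [spos, hxy.ne.symm] using hε2
    · simpa [spos] using hxT

end T

end

section
open Set Complex Topology Filter

section base4

noncomputable def Px : Fin 4 → ℝ := ![0, 1, 0, 1 / 3]
noncomputable def Py : Fin 4 → ℝ := ![0, 0, 1, 1 / 3]

lemma P_disj (i j k l : Fin 4) (h1 : i ≠ k) (h2 : i ≠ l) (h3 : j ≠ k) (h4 : j ≠ l) (h5 : i ≠ j)
    (h6 : k ≠ l) : Disjoint (segment ℝ (⟨Px i, Py i⟩ : ℂ) ⟨Px j, Py j⟩)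
      (segment ℝ (⟨Px k, Py k⟩ : ℂ) ⟨Px l, Py l⟩) := by
  rw [Set.disjoint_left]
  intro p hp hq
  obtain ⟨t, t0, t1, e⟩ := mem_seg.mp hp
  obtain ⟨s, s0, s1, e'⟩ := mem_seg.mp hq
  have h := e.symm.trans e'
  have hr := congrArg Complex.re h
  have hi := congrArg Complex.im h
  simp only [add_re, mul_re, ofReal_re, sub_re, ofReal_im, sub_im, zero_mul, sub_zero] at hr
  simp only [add_im, mul_im, ofReal_re, sub_re, ofReal_im, sub_im, zero_mul, add_zero] at hi
  clear h e e' hp hq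
  fin_cases i <;> fin_cases j <;> simp at h5 <;> fin_cases k <;> simp at h1 h3 <;> fin_cases l <;>
    simp at h2 h4 h6 <;> simp [Px, Py] at hr hi <;> linarith

lemma P_nr (i j k : Fin 4) (h1 : j ≠ i) (h2 : k ≠ i) (h3 : j ≠ k) :
    NR ((⟨Px j, Py j⟩ : ℂ) - ⟨Px i, Py i⟩) ((⟨Px k, Py k⟩ : ℂ) - ⟨Px i, Py i⟩) := by
  have hne : ∀ a b : Fin 4, a ≠ b → (⟨Px a, Py a⟩ : ℂ) - ⟨Px b, Py b⟩ ≠ 0 := by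
    intro a b hab h
    rw [sub_eq_zero, Complex.ext_iff] at h
    fin_cases a <;> fin_cases b <;> simp [Px, Py] at hab h
  rw [nr_iff (hne _ _ h1) (hne _ _ h2)]
  intro r hr0 h
  have hr := congrArg Complex.re h
  have hi := congrArg Complex.im h
  simp only [mul_re, ofReal_re, sub_re, ofReal_im, sub_im, zero_mul, sub_zero] at hr
  simp only [mul_im, ofReal_re, sub_re, ofReal_im, sub_im, zero_mul, add_zero] at hi
  clear h hne
  fin_cases i <;> fin_cases j <;> simp at h1 <;> fin_cases k <;> simp at h2 h3 <;>
    simp [Px, Py] at hr hi <;> linarith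

end base4

section T

variable {α : Type*}

theorem thmT_base {H : SimpleGraph α} {A : Set α} {z s t : α} (h4 : A.ncard = 4) 
    (hz : z ∈ A) (hs : s ∈ A) (ht : t ∈ A)
    (hzs : z ≠ s) (hst : s ≠ t) (hzt : z ≠ t) :
    ∃ pos : α → ℂ, SLD H A pos ∧ pos s = 0 ∧ pos t = 1 ∧ pos z = I ∧ ∀ v ∈ A, pos v ∈ Tri := by
  classical
  let idx : α → Fin 4 := fun v => if v = s then 0 else if v = t then 1 else if v = z then 2 else 3
  have hfin : A.Finite := finite_of_ncard_ne_zero (by omega)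
  have hinj : ∀ u ∈ A, ∀ v ∈ A, u ≠ v → idx u ≠ idx v := by
    intro u hu v hv huv e
    simp only [idx] at e
    by_cases hall : (u = s ∨ u = t ∨ u = z) ∨ (v = s ∨ v = t ∨ v = z)
    · split_ifs at e <;> simp_all
    · simp only [not_or] at hall
      have : ({u, v, s, t, z} : Set α).ncard = 5 := by
        rw [ncard_insert_of_notMem, ncard_insert_of_notMem, ncard_insert_of_notMem, ncard_pair] <;>
          simp [huv, hall, hst, hzs.symm, hzt.symm]
      have h' : ({u, v, s, t, z} : Set α) ⊆ A := by
        rintro w (rfl | rfl | rfl | rfl | rfl) <;> assumption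
      have := ncard_le_ncard h' hfin
      omega
  refine ⟨fun v => ⟨Px (idx v), Py (idx v)⟩, ⟨?_, ?_⟩, ?_, ?_, ?_, ?_⟩
  · intro u hu v hv x hx y hy e1 e2 a1 a2 a3 a4
    exact P_disj _ _ _ _ (hinj _ hu _ hx a1) (hinj _ hu _ hy a2) (hinj _ hv _ hx a3)
      (hinj _ hv _ hy a4) (hinj _ hu _ hv e1.ne) (hinj _ hx _ hy e2.ne)
  · intro u hu v hv w hw e1 e2 a
    exact P_nr _ _ _ (hinj _ hv _ hu e1.ne.symm) (hinj _ hw _ hu e2.ne.symm) (hinj _ hv _ hw a)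
  · apply Complex.ext <;> simp [idx, Px, Py]
  · apply Complex.ext <;> simp [idx, Px, Py, hst.symm]
  · apply Complex.ext <;> simp [idx, Px, Py, hzs, hzt]
  · intro v hv
    have : ∀ i, (⟨Px i, Py i⟩ : ℂ) ∈ Tri := by
      intro i; fin_cases i <;> norm_num [Tri, Px, Py]
    exact this _

lemma cone_s {p : ℂ} (hp : p ∈ Tri) : ∃ a b : ℝ, 0 ≤ a ∧ 0 ≤ b ∧
    p - 0 = a * (1 - 0) + b * (I - 0) :=
  ⟨p.re, p.im, hp.1, hp.2.1, by simp⟩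

lemma cone_t {p : ℂ} (hp : p ∈ Tri) : ∃ a b : ℝ, 0 ≤ a ∧ 0 ≤ b ∧
    p - 1 = a * (0 - 1) + b * (I - 1) :=
  ⟨1 - p.re - p.im, p.im, by linarith [hp.2.2], hp.2.1, by apply Complex.ext <;> simp; ring⟩

lemma cone_z {p : ℂ} (hp : p ∈ Tri) : ∃ a b : ℝ, 0 ≤ a ∧ 0 ≤ b ∧
    p - I = a * (0 - I) + b * (1 - I) :=
  ⟨1 - p.re - p.im, p.re, by linarith [hp.2.2], hp.1, by apply Complex.ext <;> simp; ring⟩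

/-- the key straight line theorem -/
theorem thmT (n : ℕ) : ∀ {H : SimpleGraph α} {A : Set α} {z s t : α}, A.ncard = n → TC H A →
    ¬ K33M H A → ¬ K5M H A → z ∈ A → s ∈ A → t ∈ A → H.Adj z s → H.Adj s t → H.Adj z t →
    Cn H (A \ {z, s, t}) →
    ∃ pos : α → ℂ, SLD H A pos ∧ pos s = 0 ∧ pos t = 1 ∧ pos z = I ∧ ∀ v ∈ A, pos v ∈ Tri := by
  induction n using Nat.strong_induction_on with
  | _ n ih =>
  intro H A z s t hcard h hk hk5 hz hs ht hzs hst hzt hcn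
  by_cases h4 : A.ncard = 4
  · exact thmT_base h4 hz hs ht hzs.ne hst.ne hzt.ne
  have h5 : 5 ≤ A.ncard := by have := h.2.1; omega
  obtain ⟨x, hx, y, hy, hxy, hyτ, hn⟩ := contractible h h5 hzs hst hzt
  have hyτ' := hyτ
  simp only [mem_insert_iff, mem_singleton_iff, not_or] at hyτ'
  obtain ⟨hyz, hys, hyt⟩ := hyτ'
  have hcn' : Cn (ctr H x y) ((A \ {y}) \ {z, s, t}) := by
    rw [cn_lft hxy (by simp)]
    by_cases hxτ : x ∈ ({z, s, t} : Set α)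
    · rw [lft_of_notMem (fun h => h.2 hxτ), sdiff_sdiff]
      rcases hxτ with rfl | rfl | rfl
      · have := corner_cn h5 hz hs ht hzs hzt hst.ne hk (z := t) (s := x) (t := s)
          (by convert hcn using 2; ext u; simp; tauto) hy (by simp [hyz, hys, hyt]) hxy hn
        convert this using 2; ext u; simp; tauto
      · have := corner_cn h5 hs ht hz hst hzs.symm hzt.ne.symm hk hcn hy hyτ hxy hn
        convert this using 2; ext u; simp only [mem_union, mem_insert_iff, mem_singleton_iff]; tauto
      · have := corner_cn h5 ht hs hz hst.symm hzt.symm hzs.ne.symm hk (z := z) (s := x) (t := s)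
          (by convert hcn using 2; ext u; simp; tauto) hy (by simp [hyz, hys, hyt]) hxy hn
        convert this using 2; ext u; simp; tauto
    · have : lft x y ((A \ {y}) \ {z, s, t}) = A \ {z, s, t} := by
        ext u
        simp only [lft, mem_ofPred_eq, Set.mem_sdiff, mem_singleton_iff]
        constructor
        · rintro (⟨⟨a, b⟩, c⟩ | ⟨rfl, -⟩)
          · exact ⟨a, c⟩
          · exact ⟨hy, hyτ⟩
        · rintro ⟨a, b⟩
          by_cases hu : u = y
          · exact Or.inr ⟨hu, ⟨hx, hxy.ne⟩, hxτ⟩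
          · exact Or.inl ⟨⟨a, hu⟩, b⟩
      rw [this]; exact hcn
  have hlt : (A \ {y}).ncard < n := by
    rw [← hcard]; exact ncard_sdiff_singleton_lt_of_mem hy h.1
  obtain ⟨Q, hS, Qs, Qt, Qz, hTri⟩ := ih _ hlt rfl hn (fun h => hk (h.lift hxy hy))
    (fun h => hk5 (h.lift hxy hy)) ⟨hz, Ne.symm hyz⟩ ⟨hs, Ne.symm hys⟩ ⟨ht, Ne.symm hyt⟩
    (ctr_adj_of hzs (Ne.symm hyz) (Ne.symm hys)) (ctr_adj_of hst (Ne.symm hys) (Ne.symm hyt))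
    (ctr_adj_of hzt (Ne.symm hyz) (Ne.symm hyt)) hcn'
  by_cases hxτ : x ∈ ({z, s, t} : Set α)
  · have fin : (∃ pos, SLD H A pos ∧ (∀ u ∈ A, u ≠ y → pos u = Q u) ∧ pos y ∈ Tri) →
      ∃ pos : α → ℂ, SLD H A pos ∧ pos s = 0 ∧ pos t = 1 ∧ pos z = I ∧ ∀ v ∈ A, pos v ∈ Tri := by
      rintro ⟨pos, p1, p2, p3⟩
      refine ⟨pos, p1, by rw [p2 s hs (Ne.symm hys), Qs], by rw [p2 t ht (Ne.symm hyt), Qt],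
        by rw [p2 z hz (Ne.symm hyz), Qz], fun v hv => ?_⟩
      by_cases hvy : v = y
      · rw [hvy]; exact p3
      · rw [p2 v hv hvy]; exact hTri v ⟨hv, hvy⟩
    apply fin
    rcases hxτ with rfl | rfl | rfl
    · refine corner_step (κ := 1 / (1 - 2 * I)) h h5 hk hk5 hz hy hs ht hzs hzt hst.ne hxy hys hyt
        hn hcn hS hTri ?_ ?_ ?_ ?_
      · intro h0; rw [one_div, inv_eq_zero, Complex.ext_iff] at h0; norm_num at h0
      · rw [Qs, Qz]; norm_num [div_re, normSq_apply, div_im]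
      · rw [Qt, Qz]; norm_num [div_re, normSq_apply, div_im]
      · rw [Qs, Qt, Qz]; exact fun p hp => cone_z hp
    · refine corner_step (κ := 1 / (1 + I)) h h5 hk hk5 hs hy ht hz hst hzs.symm hzt.ne.symm hxy hyt
        hyz hn (by convert hcn using 2; ext u; simp; tauto) hS hTri ?_ ?_ ?_ ?_
      · intro h0; rw [one_div, inv_eq_zero, Complex.ext_iff] at h0; norm_num at h0
      · rw [Qs, Qt]; norm_num [div_re, normSq_apply, div_im]
      · rw [Qs, Qz]; norm_num [div_re, normSq_apply, div_im]
      · rw [Qs, Qt, Qz]; exact fun p hp => cone_s hp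
    · refine corner_step (κ := 1 / (I - 2)) h h5 hk hk5 ht hy hs hz hst.symm hzt.symm hzs.ne.symm
        hxy hys hyz hn (by convert hcn using 2; ext u; simp; tauto) hS hTri ?_ ?_ ?_ ?_
      · intro h0; rw [one_div, inv_eq_zero, Complex.ext_iff] at h0; norm_num at h0
      · rw [Qs, Qt]; norm_num [div_re, normSq_apply, div_im]
      · rw [Qt, Qz]; norm_num [div_re, normSq_apply, div_im]
      · rw [Qs, Qt, Qz]; exact fun p hp => cone_t hp
  · have hxτ' := hxτ
    simp only [mem_insert_iff, mem_singleton_iff, not_or] at hxτ'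
    obtain ⟨hxz, hxs, hxt⟩ := hxτ'
    obtain ⟨q1, q2, q3⟩ := hTri x ⟨hx, hxy.ne⟩
    have v1 := hS.vert hn ⟨hs, Ne.symm hys⟩ ⟨ht, Ne.symm hyt⟩ ⟨hx, hxy.ne⟩
      (ctr_adj_of hst (Ne.symm hys) (Ne.symm hyt)) hxs hxt
    have v2 := hS.vert hn ⟨hz, Ne.symm hyz⟩ ⟨hs, Ne.symm hys⟩ ⟨hx, hxy.ne⟩
      (ctr_adj_of hzs (Ne.symm hyz) (Ne.symm hys)) hxz hxs
    have v3 := hS.vert hn ⟨hz, Ne.symm hyz⟩ ⟨ht, Ne.symm hyt⟩ ⟨hx, hxy.ne⟩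
      (ctr_adj_of hzt (Ne.symm hyz) (Ne.symm hyt)) hxz hxt
    rw [Qs, Qt] at v1
    rw [Qz, Qs] at v2
    rw [Qz, Qt] at v3
    have r1 : 0 < (Q x).re := by
      refine lt_of_le_of_ne q1 (fun e => v2 (mem_seg.mpr ⟨1 - (Q x).im, by linarith, by linarith, ?_⟩))
      apply Complex.ext <;> simp [← e]
    have r2 : 0 < (Q x).im := by
      refine lt_of_le_of_ne q2 (fun e => v1 (mem_seg.mpr ⟨(Q x).re, by linarith, by linarith, ?_⟩))
      apply Complex.ext <;> simp [← e]
    have r3 : (Q x).re + (Q x).im < 1 := by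
      refine lt_of_le_of_ne q3 (fun e => v3 (mem_seg.mpr ⟨(Q x).re, by linarith, by linarith, ?_⟩))
      apply Complex.ext <;> simp; linarith
    obtain ⟨pos, p1, p2, p3, p4⟩ := interior_step h h5 hk hk5 hx hy hxy hn hS r1 r2 r3
    refine ⟨pos, p1, by rw [p2 s hs (Ne.symm hxs) (Ne.symm hys), Qs],
      by rw [p2 t ht (Ne.symm hxt) (Ne.symm hyt), Qt],
      by rw [p2 z hz (Ne.symm hxz) (Ne.symm hyz), Qz], fun v hv => ?_⟩
    by_cases hvx : v = x
    · rw [hvx]; exact p3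
    by_cases hvy : v = y
    · rw [hvy]; exact p4
    rw [p2 v hv hvx hvy]; exact hTri v ⟨hv, hvy⟩

end T

end

section
open Set Complex Topology Filter

section B1

variable {V : Type*}

/-- drawings in the complex plane -/
structure CDr (H : SimpleGraph V) (R : Set V) (pos : V → ℂ) (arc : Sym2 V → Set ℂ) : Prop where
  inj : InjOn pos R
  spec : ∀ ⦃u v : V⦄, u ∈ R → v ∈ R → H.Adj u v →
    ∃ f : ℝ → ℂ, ContinuousOn f (Icc 0 1) ∧ InjOn f (Icc 0 1) ∧
      f 0 = pos u ∧ f 1 = pos v ∧ f '' Icc 0 1 = arc s(u, v)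
  inter : ∀ ⦃u v x y : V⦄, u ∈ R → v ∈ R → H.Adj u v → x ∈ R → y ∈ R → H.Adj x y →
    s(u, v) ≠ s(x, y) → ∀ p ∈ arc s(u, v), p ∈ arc s(x, y) →
    ∃ w ∈ R, w ∈ s(u, v) ∧ w ∈ s(x, y) ∧ p = pos w
  vert : ∀ ⦃u v : V⦄, u ∈ R → v ∈ R → H.Adj u v → ∀ w ∈ R, pos w ∈ arc s(u, v) → w = u ∨ w = v

/-- image of a drawing -/
def cimg (H : SimpleGraph V) (R : Set V) (pos : V → ℂ) (arc : Sym2 V → Set ℂ) : Set ℂ :=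
  {p | (∃ v ∈ R, p = pos v) ∨ ∃ u ∈ R, ∃ v ∈ R, H.Adj u v ∧ p ∈ arc s(u, v)}

/-- faces as needed -/
structure CFace (K F : Set ℂ) : Prop where
  op : IsOpen F
  pc : IsPathConnected F
  disj : Disjoint F K
  fr : frontier F ⊆ K

lemma CDr.arc_closed {H : SimpleGraph V} {R : Set V} {pos : V → ℂ} {arc : Sym2 V → Set ℂ}
    (h : CDr H R pos arc) {u v : V} (hu : u ∈ R) (hv : v ∈ R) (e : H.Adj u v) :
    IsClosed (arc s(u, v)) := by
  obtain ⟨f, hf, -, -, -, h'⟩ := h.spec hu hv e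
  rw [← h']
  exact (isCompact_Icc.image_of_continuousOn hf).isClosed

lemma face_join {F K : Set ℂ} (ho : IsOpen F) (hp : IsPathConnected F) (hK : IsClosed K)
    (hd : Disjoint F K) {q : ℂ} (hq : q ∈ frontier F) (hqK : q ∉ K) :
    ∃ Z, (∀ x ∈ F, JoinedIn Z x q) ∧ Disjoint Z K := by
  obtain ⟨ε, hε, hb⟩ := Metric.isOpen_iff.mp hK.isOpen_compl q hqK
  obtain ⟨x, hx, hxq⟩ := Metric.mem_closure_iff.mp (frontier_subset_closure hq) ε hε
  have hseg : segment ℝ x q ⊆ Metric.ball q ε :=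
    (convex_ball q ε).segment_subset (by rwa [Metric.mem_ball, _root_.dist_comm])
      (Metric.mem_ball_self hε)
  refine ⟨F ∪ segment ℝ x q, fun y hy => ?_, ?_⟩
  · exact ((hp.joinedIn y hy x hx).mono subset_union_left).trans
      ((seg_joined x q).mono subset_union_right)
  · rw [disjoint_union_left]
    exact ⟨hd, Set.disjoint_left.mpr fun p hp => hb (hseg hp)⟩

/-- accessibility of a vertex from a face -/
def FAcc (H : SimpleGraph V) (R : Set V) (pos : V → ℂ) (arc : Sym2 V → Set ℂ) (F : Set ℂ)
    (w : V) : Prop :=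
  ∃ Z, (∀ x ∈ F, JoinedIn Z x (pos w)) ∧
    ∀ u ∈ R, ∀ v ∈ R, H.Adj u v → u ≠ w → v ≠ w → Disjoint Z (arc s(u, v))

lemma CDr.union_closed [Finite V] {H : SimpleGraph V} {R : Set V} {pos : V → ℂ}
    {arc : Sym2 V → Set ℂ} (h : CDr H R pos arc) (P : V → V → Prop) :
    IsClosed {p | ∃ u v, (u ∈ R ∧ v ∈ R ∧ H.Adj u v ∧ P u v) ∧ p ∈ arc s(u, v)} := by
  have : {p | ∃ u v, (u ∈ R ∧ v ∈ R ∧ H.Adj u v ∧ P u v) ∧ p ∈ arc s(u, v)} =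
      ⋃ e ∈ {e : V × V | e.1 ∈ R ∧ e.2 ∈ R ∧ H.Adj e.1 e.2 ∧ P e.1 e.2}, arc s(e.1, e.2) := by
    ext p; simp
  rw [this]
  exact (toFinite _).isClosed_biUnion (fun e he => h.arc_closed he.1 he.2.1 he.2.2.1)

lemma CDr.acc [Finite V] {H : SimpleGraph V} {R : Set V} {pos : V → ℂ} {arc : Sym2 V → Set ℂ}
    (h : CDr H R pos arc) {F : Set ℂ} (hF : CFace (cimg H R pos arc) F) {w : V} (hw : w ∈ R)
    (hwF : pos w ∈ frontier F) : FAcc H R pos arc F w := by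
  obtain ⟨Z, hZ, hd⟩ := face_join hF.op hF.pc (h.union_closed fun u v => u ≠ w ∧ v ≠ w) (q := pos w)
    (hF.disj.mono_right (by
      rintro p ⟨u, v, ⟨hu, hv, e, -⟩, hp⟩
      exact Or.inr ⟨u, hu, v, hv, e, hp⟩)) hwF (by
      rintro ⟨u, v, ⟨hu, hv, e, h1, h2⟩, hp⟩
      rcases h.vert hu hv e w hw hp with h | h
      exacts [h1 h.symm, h2 h.symm])
  refine ⟨Z, hZ, fun u hu v hv e h1 h2 => hd.mono_right ?_⟩
  intro p hp
  exact ⟨u, v, ⟨hu, hv, e, h1, h2⟩, hp⟩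

lemma CDr.acc_extra_aux [Finite V] {H : SimpleGraph V} {R : Set V} {pos : V → ℂ}
    {arc : Sym2 V → Set ℂ} (h : CDr H R pos arc) {F : Set ℂ} (hF : CFace (cimg H R pos arc) F)
    {c c' : V} (hc : c ∈ R) (hc' : c' ∈ R) (e : H.Adj c' c) {q : ℂ} (hq : q ∈ frontier F)
    (hqe : q ∈ arc s(c', c)) (hqv : ∀ v ∈ R, q ≠ pos v) : FAcc H R pos arc F c := by
  obtain ⟨Z, hZ, hd⟩ := face_join hF.op hF.pc (h.union_closed fun u v => s(u, v) ≠ s(c', c))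
    (q := q) (hF.disj.mono_right (by
      rintro p ⟨u, v, ⟨hu, hv, e, -⟩, hp⟩
      exact Or.inr ⟨u, hu, v, hv, e, hp⟩)) hq (by
      rintro ⟨u, v, ⟨hu, hv, e', h1⟩, hp⟩
      obtain ⟨w, hw, -, -, hp'⟩ := h.inter hu hv e' hc' hc e h1 q hp hqe
      exact hqv w hw hp')
  obtain ⟨f, hf, hfi, f0, f1, hfe⟩ := h.spec hc' hc e
  rw [← hfe] at hqe
  obtain ⟨τ, ⟨hτ0, hτ1⟩, rfl⟩ := hqe
  have hτ : 0 < τ := lt_of_le_of_ne hτ0 (by rintro rfl; exact hqv c' hc' f0)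
  have hsub : Icc τ 1 ⊆ Icc (0 : ℝ) 1 := Icc_subset_Icc_left hτ0
  refine ⟨Z ∪ f '' Icc τ 1, fun x hx => ?_, ?_⟩
  · refine ((hZ x hx).mono subset_union_left).trans (JoinedIn.mono ?_ subset_union_right)
    have hpc : IsPathConnected (Icc τ (1 : ℝ)) :=
      (convex_Icc τ 1).isPathConnected ⟨τ, le_refl _, hτ1⟩
    have := (hpc.image' (hf.mono hsub)).joinedIn (f τ) ⟨τ, ⟨le_refl _, hτ1⟩, rfl⟩ (f 1)
      ⟨1, ⟨hτ1, le_refl _⟩, rfl⟩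
    rwa [f1] at this
  · intro u hu v hv e' h1 h2
    have hne : s(u, v) ≠ s(c', c) := by
      intro h
      rw [Sym2.eq_iff] at h
      rcases h with ⟨-, h⟩ | ⟨h, -⟩
      exacts [h2 h, h1 h]
    rw [disjoint_union_left]
    refine ⟨hd.mono_right (fun p hp => (⟨u, v, ⟨hu, hv, e', hne⟩, hp⟩ : ∃ u v, (u ∈ R ∧ v ∈ R ∧ H.Adj u v ∧ s(u, v) ≠ s(c', c)) ∧ p ∈ arc s(u, v))), ?_⟩
    rw [Set.disjoint_left]
    rintro p ⟨σ, hσ, rfl⟩ hp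
    obtain ⟨w, hw, hw1, hw2, hpw⟩ := h.inter hu hv e' hc' hc e hne (f σ) hp
      (by rw [← hfe]; exact ⟨σ, hsub hσ, rfl⟩)
    rw [Sym2.mem_iff] at hw1 hw2
    have hwc : w = c' := by
      rcases hw2 with h | h
      · exact h
      · rcases hw1 with h' | h'
        · exact absurd (h'.symm.trans h) h1
        · exact absurd (h'.symm.trans h) h2
    rw [hwc, ← f0] at hpw
    have := hfi (hsub hσ) ⟨le_refl _, zero_le_one⟩ hpw
    linarith [hσ.1]

lemma CDr.acc_extra [Finite V] {H : SimpleGraph V} {R : Set V} {pos : V → ℂ}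
    {arc : Sym2 V → Set ℂ} (h : CDr H R pos arc) {F : Set ℂ} (hF : CFace (cimg H R pos arc) F)
    {s t : V} (hs : s ∈ R) (ht : t ∈ R) (e : H.Adj s t) (h3 : ∃ w ∈ R, w ≠ s ∧ w ≠ t) :
    ∃ c ∈ R, c ≠ s ∧ c ≠ t ∧ FAcc H R pos arc F c := by
  obtain ⟨f, hf, hfi, f0, f1, hfe⟩ := h.spec hs ht e
  have hnot : ¬ frontier F ⊆ arc s(s, t) := by
    intro hfr
    rw [← hfe] at hfr
    have hd : Disjoint F (f '' Icc 0 1) := by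
      refine hF.disj.mono_right ?_
      rw [hfe]
      exact fun p hp => Or.inr ⟨s, hs, t, ht, e, hp⟩
    have hu := arc_not_sep hf hfi hF.op hF.pc.nonempty hfr hd
    obtain ⟨w, hw, h1, h2⟩ := h3
    have : pos w ∈ F ∪ f '' Icc 0 1 := by rw [hu]; trivial
    rcases this with h' | h'
    · exact Set.disjoint_left.mp hF.disj h' (Or.inl ⟨w, hw, rfl⟩)
    · rw [hfe] at h'
      rcases h.vert hs ht e w hw h' with h | h
      exacts [h1 h, h2 h]
  obtain ⟨q, hq, hqn⟩ := not_subset.mp hnot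
  by_cases hqv : ∃ v ∈ R, q = pos v
  · obtain ⟨c, hc, rfl⟩ := hqv
    refine ⟨c, hc, ?_, ?_, h.acc hF hc hq⟩
    · rintro rfl
      exact hqn (by rw [← hfe, ← f0]; exact ⟨0, by simp, rfl⟩)
    · rintro rfl
      exact hqn (by rw [← hfe, ← f1]; exact ⟨1, by simp, rfl⟩)
  · push Not at hqv
    rcases hF.fr hq with ⟨v, hv, h'⟩ | ⟨u, hu, v, hv, e', hp⟩
    · exact absurd h' (hqv v hv)
    · have hne : s(u, v) ≠ s(s, t) := by intro h; rw [h] at hp; exact hqn hp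
      by_cases hvst : v ≠ s ∧ v ≠ t
      · exact ⟨v, hv, hvst.1, hvst.2, h.acc_extra_aux hF hv hu e' hq hp hqv⟩
      · refine ⟨u, hu, ?_, ?_, h.acc_extra_aux hF hu hv e'.symm hq (by rwa [Sym2.eq_swap]) hqv⟩
        · rintro rfl
          apply hne
          have : v = t := by
            by_contra h
            exact hvst ⟨e'.ne.symm, h⟩
          rw [this]
        · rintro rfl
          apply hne
          have : v = s := by
            by_contra h
            exact hvst ⟨h, e'.ne.symm⟩
          rw [this, Sym2.eq_swap]

/-- the graph with an apex -/
def Hz (Γ : SimpleGraph V) (S : Set V) : SimpleGraph (Option V) where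
  Adj
    | some u, some v => Γ.Adj u v
    | none, some v => v ∈ S
    | some u, none => u ∈ S
    | none, none => False
  symm := ⟨by rintro (_ | u) (_ | v) h <;> first | exact h | exact h.symm⟩
  loopless := ⟨by rintro (_ | u) h; exacts [h, Γ.loopless.irrefl u h]⟩

/-- the arcs of the drawing with apex -/
def zarc (arc : Sym2 V → Set ℂ) (Z : V → Set ℂ) : Option V → Option V → Set ℂ
  | some u, some v => arc s(u, v)
  | none, some v => Z v
  | some u, none => Z u
  | none, none => ∅

lemma CDr.joined {H : SimpleGraph V} {R : Set V} {pos : V → ℂ} {arc : Sym2 V → Set ℂ}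
    (h : CDr H R pos arc) {u v : V} (hu : u ∈ R) (hv : v ∈ R) (e : H.Adj u v) :
    JoinedIn (arc s(u, v)) (pos u) (pos v) := by
  obtain ⟨f, hf, hfi, f0, f1, hfe⟩ := h.spec hu hv e
  have := (((convex_Icc 0 1).isPathConnected ⟨(0 : ℝ), by simp⟩).image' hf).joinedIn (f 0)
    ⟨0, by simp, rfl⟩ (f 1) ⟨1, by simp, rfl⟩
  rwa [f0, f1, hfe] at this

lemma CDr.wdr {H : SimpleGraph V} {R : Set V} {pos : V → ℂ} {arc : Sym2 V → Set ℂ}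
    (h : CDr H R pos arc) {F : Set ℂ} {x₀ : ℂ} (hx : x₀ ∈ F) {S : Set V}
    (hS : ∀ w ∈ S, FAcc H R pos arc F w) :
    ∃ pos' arc', WDr (Hz H S) (insert none (some '' R)) pos' arc' := by
  classical
  choose! Z hZ hd using hS
  have hR : ∀ {u : V}, (some u : Option V) ∈ insert none (some '' R) → u ∈ R := by
    intro u hu; simpa using hu
  have hsym : ∀ u v, zarc arc Z u v = zarc arc Z v u := by
    rintro (_ | u) (_ | v) <;> simp [zarc, Sym2.eq_swap]
  refine ⟨fun o => o.elim x₀ pos, zarc arc Z, ?_, ?_⟩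
  · rintro (_ | u) hu (_ | v) hv e
    · exact e.elim
    · exact hZ v e x₀ hx
    · exact (hZ u e x₀ hx).symm
    · exact h.joined (hR hu) (hR hv) e
  · rintro (_ | u) hu (_ | v) hv (_ | x) hx' (_ | y) hy e e' h1 h2 h3 h4
    all_goals first | exact e.elim | exact e'.elim | exact absurd rfl h1 | exact absurd rfl h2 |
      exact absurd rfl h3 | exact absurd rfl h4 | skip
    · exact hd v e x (hR hx') y (hR hy) e' (fun h => h3 (by rw [h])) (fun h => h4 (by rw [h]))
    · exact hd u e x (hR hx') y (hR hy) e' (fun h => h1 (by rw [h])) (fun h => h2 (by rw [h]))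
    · exact (hd y e' u (hR hu) v (hR hv) e (fun h => h2 (by rw [h])) (fun h => h4 (by rw [h]))).symm
    · exact (hd x e' u (hR hu) v (hR hv) e (fun h => h1 (by rw [h])) (fun h => h3 (by rw [h]))).symm
    · rw [Set.disjoint_left]
      intro p hp hp'
      obtain ⟨w, -, hw1, hw2, -⟩ := h.inter (hR hu) (hR hv) e (hR hx') (hR hy) e' (by
        intro h
        rw [Sym2.eq_iff] at h
        rcases h with ⟨h, -⟩ | ⟨h, -⟩
        · exact h1 (by rw [h])
        · exact h2 (by rw [h])) p hp hp'
      rw [Sym2.mem_iff] at hw1 hw2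
      rcases hw1 with rfl | rfl <;> rcases hw2 with h | h
      exacts [h1 (by rw [h]), h2 (by rw [h]), h3 (by rw [h]), h4 (by rw [h])]

end B1

end

section
open Set Complex Topology Filter

section B2

variable {V : Type*}

lemma walk_cross {G : SimpleGraph V} {A C : Set V} {u v : V} (p : G.Walk u v) :
    (∀ x ∈ p.support, x ∈ A) → u ∈ C → v ∉ C → ∃ x ∈ C, ∃ y ∈ A, y ∉ C ∧ G.Adj x y := by
  induction p with
  | nil => intro _ h1 h2; exact absurd h1 h2
  | @cons a b c e p ih =>
    intro hA h1 h2
    by_cases hb : b ∈ C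
    · exact ih (fun x hx => hA x (by simp [hx])) hb h2
    · exact ⟨a, h1, b, hA b (by simp), hb, e⟩

lemma ConnectedOn.cn {G : SimpleGraph V} {A : Set V} (h : ConnectedOn G A) : Cn G A := by
  refine ⟨h.1, fun C hC ⟨u, hu⟩ ⟨v, hv, hv'⟩ => ?_⟩
  obtain ⟨p, hp⟩ := h.2 (hC hu) hv
  obtain ⟨x, hx, y, hy, hy', e⟩ := walk_cross p hp hu hv'
  exact ⟨x, hx, y, ⟨hy, hy'⟩, e⟩

lemma KConnectedOn.tc [Finite V] {G : SimpleGraph V} {A : Set V} (h : KConnectedOn 3 G A) :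
    TC G A := by
  obtain ⟨⟨f, hf, hfA⟩, h2⟩ := h
  refine ⟨toFinite _, ?_, fun p hp q hq hpq => ?_⟩
  · have : (range f).ncard = 4 := by
      rw [← image_univ, ncard_image_of_injective _ hf]
      simp [ncard_univ]
    rw [← this]
    exact ncard_le_ncard (range_subset_iff.mpr hfA) (toFinite _)
  · exact (h2 {p, q} (toFinite _) (by rw [ncard_pair hpq]; norm_num)).cn

lemma cn_some {Γ : SimpleGraph V} {S C : Set V} (h : Cn Γ C) : Cn (Hz Γ S) (some '' C) := by
  refine ⟨h.1.image _, fun D hD hn hn' => ?_⟩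
  obtain ⟨x, hx, y, hy, e⟩ := h.2 {v | some v ∈ D}
    (by intro v hv; simpa using hD hv)
    (by
      obtain ⟨d, hd⟩ := hn
      obtain ⟨v, -, rfl⟩ := hD hd
      exact ⟨v, hd⟩)
    (by
      obtain ⟨d, ⟨v, hv, rfl⟩, hd⟩ := hn'
      exact ⟨v, hv, hd⟩)
  exact ⟨some x, hx, some y, ⟨⟨y, hy.1, rfl⟩, hy.2⟩, e⟩

lemma tc_hz {Γ : SimpleGraph V} {R S : Set V} (h : TC Γ R) (hS : S ⊆ R) {s t c : V} (hs : s ∈ S)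
    (ht : t ∈ S) (hc : c ∈ S) (hst : s ≠ t) (hcs : c ≠ s) (hct : c ≠ t) :
    TC (Hz Γ S) (insert none (some '' R)) := by
  have hfin : (insert none (some '' R)).Finite := (h.1.image _).insert _
  have hcard : (some '' R).ncard = R.ncard := ncard_image_of_injective _ (Option.some_injective V)
  refine ⟨hfin, ?_, ?_⟩
  · have := ncard_le_ncard (subset_insert none (some '' R)) hfin
    have := h.2.1
    omega
  · have one : ∀ v, Cn (Hz Γ S) (insert none (some '' R) \ {none, some v}) := by
      intro v
      have := cn_some (S := S) (h.cn2 v v)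
      convert this using 1
      ext (_ | u) <;> simp
    rintro (_ | p) hp (_ | q) hq hpq
    · exact absurd rfl hpq
    · exact one q
    · rw [pair_comm]; exact one p
    · have h1 := cn_some (S := S) (h.cn2 p q)
      obtain ⟨w, hw, hwp, hwq⟩ : ∃ w ∈ S, w ≠ p ∧ w ≠ q := by
        by_contra hcon
        push Not at hcon
        by_cases a1 : s = p
        · by_cases a2 : t = p
          · exact hst (a1.trans a2.symm)
          · have := hcon t ht a2
            have := hcon c hc (fun h => hcs (h.trans a1.symm))
            grind
        · have := hcon s hs a1
          by_cases a2 : t = p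
          · have := hcon c hc (fun h => hct (h.trans a2.symm))
            grind
          · have := hcon t ht a2
            grind
      have := (cn_singleton (Hz Γ S) none).union h1
        ⟨none, rfl, some w, ⟨w, ⟨hS hw, by simp [hwp, hwq]⟩, rfl⟩, Or.inr hw⟩
      convert this using 1
      ext (_ | u) <;> simp

/-- planar straight line drawing -/
structure PL (Γ : SimpleGraph V) (X : Set V) (pos : V → ℂ) : Prop where
  sub : ∀ ⦃u v⦄, Γ.Adj u v → u ∈ X ∧ v ∈ X
  inj : InjOn pos X
  edge : ∀ ⦃u v x y⦄, Γ.Adj u v → Γ.Adj x y → s(u, v) ≠ s(x, y) →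
    ∀ p ∈ segment ℝ (pos u) (pos v), p ∈ segment ℝ (pos x) (pos y) →
    ∃ w, w ∈ s(u, v) ∧ w ∈ s(x, y) ∧ p = pos w
  vert : ∀ ⦃u v⦄, Γ.Adj u v → ∀ w ∈ X, pos w ∈ segment ℝ (pos u) (pos v) → w = u ∨ w = v

/-- drawing in the standard triangle with a free apex -/
structure TD (Γ : SimpleGraph V) (X M : Set V) (s t : V) (pos : V → ℂ) : Prop
    extends PL Γ X pos where
  adj : Γ.Adj s t
  hM : M ⊆ X
  sM : s ∈ M
  tM : t ∈ M
  ps : pos s = 0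
  pt : pos t = 1
  int : ∀ v ∈ X, v ≠ s → v ≠ t → 0 < (pos v).re ∧ 0 < (pos v).im ∧ (pos v).re + (pos v).im < 1
  zed : ∀ m ∈ M, ∀ ⦃u v⦄, Γ.Adj u v → ∀ p ∈ segment ℝ I (pos m),
    p ∈ segment ℝ (pos u) (pos v) → p = pos m
  zv : ∀ m ∈ M, ∀ w ∈ X, pos w ∈ segment ℝ I (pos m) → w = m

theorem td_of_cdr [Finite V] {Γ : SimpleGraph V} {R : Set V} {pos : V → ℂ} {arc : Sym2 V → Set ℂ}
    (h : CDr Γ R pos arc) {F : Set ℂ} (hF : CFace (cimg Γ R pos arc) F) (hT : TC Γ R)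
    (hsub : ∀ ⦃u v⦄, Γ.Adj u v → u ∈ R ∧ v ∈ R)
    {S : Set V} (hS : S ⊆ R) (hSF : ∀ v ∈ S, pos v ∈ frontier F) {s t : V} (hs : s ∈ S)
    (ht : t ∈ S) (e : Γ.Adj s t) :
    ∃ (M : Set V) (pos : V → ℂ), S ⊆ M ∧ TD Γ R M s t pos ∧
      ∀ m ∈ M, ∀ n ∈ M, m ≠ n → ∀ p ∈ segment ℝ I (pos m), p ∈ segment ℝ I (pos n) → p = I := by
  obtain ⟨c, hc, hcs, hct, hacc⟩ := h.acc_extra hF (hS hs) (hS ht) e (by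
    obtain ⟨v, hv, hv'⟩ := exists_notMem_of_card (A := R) (S := {s, t}) (toFinite _)
      (by have := ncard_pair_le s t; have := hT.2.1; omega)
    simp only [mem_insert_iff, mem_singleton_iff, not_or] at hv'
    exact ⟨v, hv, hv'⟩)
  obtain ⟨x₀, hx₀⟩ := hF.pc.nonempty
  have hMR : insert c S ⊆ R := insert_subset hc hS
  obtain ⟨pos', arc', hW⟩ := h.wdr hx₀ (S := insert c S) (by
    rintro w (rfl | hw)
    · exact hacc
    · exact h.acc hF (hS hw) (hSF w hw))
  have hTC := tc_hz hT hMR (mem_insert_of_mem c hs) (mem_insert_of_mem c ht) (mem_insert c S)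
    e.ne hcs hct
  have hsome : ∀ {v}, v ∈ R → (some v : Option V) ∈ insert none (some '' R) := by
    intro v hv; simp [hv]
  have hnone : (none : Option V) ∈ insert none (some '' R) := by simp
  obtain ⟨P, hP, Ps, Pt, Pz, hTri⟩ := thmT _ rfl hTC hW.no33 hW.no5 hnone (hsome (hS hs))
    (hsome (hS ht)) (mem_insert_of_mem c hs : (Hz Γ (insert c S)).Adj none (some s)) e
    (mem_insert_of_mem c ht) (by
      have := cn_some (S := insert c S) (hT.cn2 s t)
      convert this using 1
      ext (_ | u) <;> simp)
  have hA : ∀ {u v}, Γ.Adj u v → (Hz Γ (insert c S)).Adj (some u) (some v) := fun e => e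
  have hAz : ∀ {m}, m ∈ insert c S → (Hz Γ (insert c S)).Adj none (some m) := fun e => e
  have hvert : ∀ ⦃u v⦄, Γ.Adj u v → ∀ w ∈ R,
      P (some w) ∈ segment ℝ (P (some u)) (P (some v)) → w = u ∨ w = v := by
    intro u v e' w hw hp
    by_contra hcon
    rw [not_or] at hcon
    exact hP.vert hTC (hsome (hsub e').1) (hsome (hsub e').2) (hsome hw) (hA e')
      (fun h => hcon.1 (Option.some_injective _ h)) (fun h => hcon.2 (Option.some_injective _ h)) hp
  have hzv : ∀ m ∈ insert c S, ∀ w ∈ R, P (some w) ∈ segment ℝ I (P (some m)) → w = m := by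
    intro m hm w hw hp
    by_contra hcon
    rw [← Pz] at hp
    exact hP.vert hTC hnone (hsome (hMR hm)) (hsome hw) (hAz hm) (by simp)
      (fun h => hcon (Option.some_injective _ h)) hp
  -- two edges with a common endpoint
  have hcom : ∀ {a b d : Option V}, a ∈ insert none (some '' R) → b ∈ insert none (some '' R) →
      d ∈ insert none (some '' R) → (Hz Γ (insert c S)).Adj a b → (Hz Γ (insert c S)).Adj a d →
      b ≠ d → ∀ p ∈ segment ℝ (P a) (P b), p ∈ segment ℝ (P a) (P d) → p = P a := by
    intro a b d ha hb hd e1 e2 hbd p hp hp'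
    exact (hP.2 a ha b hb d hd e1 e2 hbd).seg_inter hp hp'
  refine ⟨insert c S, fun v => P (some v), subset_insert _ _, ?_, ?_⟩
  · refine ⟨⟨hsub, ?_, ?_, hvert⟩, e, hMR, mem_insert_of_mem c hs, mem_insert_of_mem c ht, Ps, Pt,
      ?_, ?_, hzv⟩
    · intro u hu v hv huv
      by_contra hne
      exact hP.inj hTC (hsome hv) (hsome hu) (fun h => hne (Option.some_injective _ h)) huv
    · intro u v x y e1 e2 hne p hp hp'
      by_contra hcon
      push Not at hcon
      have ne : ∀ {a b : V}, a ≠ b → (some a : Option V) ≠ some b :=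
        fun h h' => h (Option.some_injective _ h')
      obtain ⟨hu, hv⟩ := hsub e1
      obtain ⟨hx, hy⟩ := hsub e2
      by_cases h1 : u = x
      · subst h1
        exact hcon u (by simp) (by simp) (hcom (hsome hu) (hsome hv) (hsome hy) (hA e1) (hA e2)
          (ne (by rintro rfl; exact hne rfl)) p hp hp')
      by_cases h2 : u = y
      · subst h2
        rw [segment_symm] at hp'
        exact hcon u (by simp) (by simp) (hcom (hsome hu) (hsome hv) (hsome hx) (hA e1)
          (hA e2.symm) (ne (by rintro rfl; exact hne (Sym2.eq_swap))) p hp hp')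
      by_cases h3 : v = x
      · subst h3
        rw [segment_symm] at hp
        exact hcon v (by simp) (by simp) (hcom (hsome hv) (hsome hu) (hsome hy) (hA e1.symm) (hA e2)
          (ne h2) p hp hp')
      by_cases h4 : v = y
      · subst h4
        rw [segment_symm] at hp hp'
        exact hcon v (by simp) (by simp) (hcom (hsome hv) (hsome hu) (hsome hx) (hA e1.symm)
          (hA e2.symm) (ne h1) p hp hp')
      exact Set.disjoint_left.mp (hP.1 _ (hsome hu) _ (hsome hv) _ (hsome hx) _ (hsome hy) (hA e1)
        (hA e2) (ne h1) (ne h2) (ne h3) (ne h4)) hp hp'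
    · intro v hv hvs hvt
      obtain ⟨q1, q2, q3⟩ := hTri _ (hsome hv)
      have v1 : P (some v) ∉ segment ℝ (P (some s)) (P (some t)) := fun hp => by
        rcases hvert e v hv hp with h | h
        exacts [hvs h, hvt h]
      have v2 : P (some v) ∉ segment ℝ I (P (some s)) := fun hp =>
        hvs (hzv s (mem_insert_of_mem c hs) v hv hp)
      have v3 : P (some v) ∉ segment ℝ I (P (some t)) := fun hp =>
        hvt (hzv t (mem_insert_of_mem c ht) v hv hp)
      rw [Ps, Pt] at v1
      rw [Ps] at v2
      rw [Pt] at v3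
      set q := P (some v)
      refine ⟨?_, ?_, ?_⟩
      · refine lt_of_le_of_ne q1 (fun e => v2 (mem_seg.mpr ⟨1 - q.im, by linarith, by linarith, ?_⟩))
        apply Complex.ext <;> simp [← e]
      · refine lt_of_le_of_ne q2 (fun e => v1 (mem_seg.mpr ⟨q.re, by linarith, by linarith, ?_⟩))
        apply Complex.ext <;> simp [← e]
      · refine lt_of_le_of_ne q3 (fun e => v3 (mem_seg.mpr ⟨q.re, by linarith, by linarith, ?_⟩))
        apply Complex.ext <;> simp; linarith
    · intro m hm u v e' p hp hp'
      rw [← Pz] at hp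
      rw [segment_symm] at hp
      by_cases h1 : m = u
      · subst h1
        exact hcom (hsome (hMR hm)) hnone (hsome (hsub e').2) (hAz hm).symm (hA e') (by simp) p
          hp hp'
      by_cases h2 : m = v
      · subst h2
        rw [segment_symm ℝ (P (some u))] at hp'
        exact hcom (hsome (hMR hm)) hnone (hsome (hsub e').1) (hAz hm).symm (hA e'.symm) (by simp) p
          hp hp'
      exact absurd hp' (Set.disjoint_left.mp (hP.1 _ (hsome (hMR hm)) _ hnone _ (hsome (hsub e').1) _
        (hsome (hsub e').2) (hAz hm).symm (hA e') (fun h => h1 (Option.some_injective _ h))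
        (fun h => h2 (Option.some_injective _ h)) (by simp) (by simp)) hp)
  · intro m hm n hn hmn p hp hp'
    rw [← Pz] at hp hp' ⊢
    exact hcom hnone (hsome (hMR hm)) (hsome (hMR hn)) (hAz hm) (hAz hn)
      (fun h => hmn (Option.some_injective _ h)) p hp hp'

end B2

end

section
open Set Complex Topology Filter

section B3

variable {V : Type*}

/-- identification of the planes -/
noncomputable def phi : (ℝ × ℝ) ≃ₜ ℂ := Complex.equivRealProdCLM.symm.toHomeomorph

lemma comp_frontier {X : Type*} [TopologicalSpace X] [LocallyConnectedSpace X] {K : Set X}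
    (hK : IsClosed K) {x : X} : frontier (connectedComponentIn Kᶜ x) ⊆ K := by
  intro y hy
  by_contra hyK
  have ho : IsOpen (connectedComponentIn Kᶜ y) := hK.isOpen_compl.connectedComponentIn
  have hyy : y ∈ connectedComponentIn Kᶜ y := mem_connectedComponentIn hyK
  obtain ⟨w, hw1, hw2⟩ := mem_closure_iff.mp (frontier_subset_closure hy) _ ho hyy
  have e : connectedComponentIn Kᶜ x = connectedComponentIn Kᶜ y :=
    (connectedComponentIn_eq hw2).trans (connectedComponentIn_eq hw1).symm
  rw [e, ho.frontier_eq] at hy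
  exact hy.2 hyy

lemma drawing_closed [Finite V] {G : SimpleGraph V} {A : Set V} (D : PlanarDrawingOn G A) :
    IsClosed D.image := by
  refine IsClosed.union ((toFinite _).image _).isClosed ?_
  refine (toFinite _).isClosed_biUnion ?_
  intro e
  induction e using Sym2.ind with
  | _ u v =>
    rintro ⟨he, hA⟩
    obtain ⟨f, hf, -, -, -, h⟩ := D.arc_spec (hA u (by simp)) (hA v (by simp)) he
    rw [← h]
    exact (isCompact_Icc.image_of_continuousOn hf).isClosed

theorem td_of_face [Finite V] {Γ : SimpleGraph V} {R S : Set V} (h : OnCommonFace Γ R S)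
    (hK : KConnectedOn 3 Γ R) (hsub : ∀ ⦃u v⦄, Γ.Adj u v → u ∈ R ∧ v ∈ R) (hS : S ⊆ R) {s t : V}
    (hs : s ∈ S) (ht : t ∈ S) (e : Γ.Adj s t) :
    ∃ (M : Set V) (pos : V → ℂ), S ⊆ M ∧ TD Γ R M s t pos ∧
      ∀ m ∈ M, ∀ n ∈ M, m ≠ n → ∀ p ∈ segment ℝ I (pos m), p ∈ segment ℝ I (pos n) → p = I := by
  obtain ⟨D, F, ⟨x, hx, rfl⟩, hSF⟩ := h
  have hcl := drawing_closed D
  have hmem : ∀ {u v : V}, u ∈ R → v ∈ R → ∀ x ∈ s(u, v), x ∈ R := by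
    intro u v hu hv x hx
    rw [Sym2.mem_iff] at hx
    rcases hx with rfl | rfl <;> assumption
  have hC : CDr Γ R (fun v => phi (D.pos v)) (fun e => phi '' D.arc e) := by
    refine ⟨fun u hu v hv h => D.pos_inj hu hv (phi.injective h), ?_, ?_, ?_⟩
    · intro u v hu hv e'
      obtain ⟨f, hf, hi, f0, f1, hfe⟩ := D.arc_spec hu hv e'
      refine ⟨phi ∘ f, phi.continuous.comp_continuousOn hf, phi.injective.comp_injOn hi, ?_, ?_, ?_⟩
      · simp [f0]
      · simp [f1]
      · rw [image_comp, hfe]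
    · rintro u v x y hu hv e1 hx hy e2 hne p ⟨q, hq, rfl⟩ ⟨q', hq', hqq⟩
      obtain rfl := phi.injective hqq
      obtain ⟨w, hw, h1, h2, h3⟩ := D.arc_inter (e₁ := s(u, v)) (e₂ := s(x, y)) e1 e2 (hmem hu hv)
        (hmem hx hy) hne ⟨hq, hq'⟩
      exact ⟨w, hw, h1, h2, by rw [h3]⟩
    · rintro u v hu hv e' w hw ⟨q, hq, hqq⟩
      obtain rfl := phi.injective hqq
      simpa using D.pos_arc (e := s(u, v)) e' (hmem hu hv) w hw hq
  have himg : cimg Γ R (fun v => phi (D.pos v)) (fun e => phi '' D.arc e) = phi '' D.image := by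
    ext p
    constructor
    · rintro (⟨v, hv, rfl⟩ | ⟨u, hu, v, hv, e', q, hq, rfl⟩)
      · exact ⟨_, Or.inl ⟨v, hv, rfl⟩, rfl⟩
      · refine ⟨q, Or.inr ?_, rfl⟩
        simp only [mem_iUnion]
        exact ⟨s(u, v), ⟨e', hmem hu hv⟩, hq⟩
    · rintro ⟨q, ⟨v, hv, rfl⟩ | hq, rfl⟩
      · exact Or.inl ⟨v, hv, rfl⟩
      · simp only [mem_iUnion] at hq
        obtain ⟨e', he', hq⟩ := hq
        induction e' using Sym2.ind with
        | _ u v =>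
        exact Or.inr ⟨u, he'.2 u (by simp), v, he'.2 v (by simp), he'.1, q, hq, rfl⟩
  have ho : IsOpen (connectedComponentIn D.imageᶜ x) := hcl.isOpen_compl.connectedComponentIn
  have hcF : CFace (cimg Γ R (fun v => phi (D.pos v)) (fun e => phi '' D.arc e))
      (phi '' connectedComponentIn D.imageᶜ x) := by
    rw [himg]
    refine ⟨phi.isOpenMap _ ho, ?_, ?_, ?_⟩
    · refine IsPathConnected.image ?_ phi.continuous
      exact ho.isConnected_iff_isPathConnected.mp (isConnected_connectedComponentIn_iff.mpr hx)
    · rw [disjoint_image_iff phi.injective]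
      exact Set.disjoint_left.mpr fun p hp => connectedComponentIn_subset _ _ hp
    · rw [← phi.image_frontier]
      exact image_mono (comp_frontier hcl)
  exact td_of_cdr hC hcF hK.tc hsub hS (fun v hv => by
    rw [← phi.image_frontier]; exact ⟨_, hSF v hv, rfl⟩) hs ht e

end B3

end

section
open Set Complex Topology Filter

section E1

variable {V : Type*}

lemma PL.congr {Γ : SimpleGraph V} {X : Set V} {pos pos' : V → ℂ} (h : PL Γ X pos)
    (he : EqOn pos' pos X) : PL Γ X pos' := by
  have hseg : ∀ {u v}, Γ.Adj u v → segment ℝ (pos' u) (pos' v) = segment ℝ (pos u) (pos v) := by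
    intro u v e
    rw [he (h.sub e).1, he (h.sub e).2]
  refine ⟨h.sub, fun u hu v hv huv => h.inj hu hv (by rwa [he hu, he hv] at huv), ?_, ?_⟩
  · intro u v x y e1 e2 hne p hp hp'
    rw [hseg e1] at hp
    rw [hseg e2] at hp'
    obtain ⟨w, h1, h2, h3⟩ := h.edge e1 e2 hne p hp hp'
    refine ⟨w, h1, h2, ?_⟩
    rw [he, h3]
    rw [Sym2.mem_iff] at h1
    rcases h1 with rfl | rfl
    exacts [(h.sub e1).1, (h.sub e1).2]
  · intro u v e w hw hp
    rw [hseg e, he hw] at hp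
    exact h.vert e w hw hp

lemma PL.map {Γ : SimpleGraph V} {X : Set V} {pos : V → ℂ} (h : PL Γ X pos) (φ : ℂ →ᵃ[ℝ] ℂ)
    (hφ : Function.Injective φ) : PL Γ X (fun v => φ (pos v)) := by
  refine ⟨h.sub, fun u hu v hv huv => h.inj hu hv (hφ huv), ?_, ?_⟩
  · intro u v x y e1 e2 hne p hp hp'
    rw [← image_segment] at hp hp'
    obtain ⟨q, hq, rfl⟩ := hp
    obtain ⟨q', hq', e⟩ := hp'
    obtain rfl := hφ e
    obtain ⟨w, h1, h2, h3⟩ := h.edge e1 e2 hne q' hq hq'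
    exact ⟨w, h1, h2, by rw [h3]⟩
  · intro u v e w hw hp
    rw [← image_segment] at hp
    obtain ⟨q, hq, e'⟩ := hp
    obtain rfl := hφ e'
    exact h.vert e w hw hq

lemma adj_of_sym2 {Γ Γ' : SimpleGraph V} {u v s t : V} (h : s(u, v) = s(s, t)) (e : Γ.Adj s t) :
    Γ.Adj u v := by
  rw [Sym2.eq_iff] at h
  rcases h with ⟨rfl, rfl⟩ | ⟨rfl, rfl⟩
  exacts [e, e.symm]

lemma PL.glue {Γ₁ Γ₂ : SimpleGraph V} {X₁ X₂ : Set V} {pos : V → ℂ} (h₁ : PL Γ₁ X₁ pos)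
    (h₂ : PL Γ₂ X₂ pos) {s t : V} (a₁ : Γ₁.Adj s t) (a₂ : Γ₂.Adj s t) {K : Set ℂ}
    (hK : Convex ℝ K) (hX : ∀ v ∈ X₂, pos v ∈ K)
    (hC : ∀ u v, Γ₁.Adj u v → s(u, v) ≠ s(s, t) → ∀ p ∈ segment ℝ (pos u) (pos v), p ∈ K →
      p = pos s ∨ p = pos t)
    (hV : ∀ w ∈ X₁, pos w ∈ K → w = s ∨ w = t) : PL (Γ₁ ⊔ Γ₂) (X₁ ∪ X₂) pos := by
  have hseg : ∀ {u v}, Γ₂.Adj u v → ∀ p ∈ segment ℝ (pos u) (pos v), p ∈ K := by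
    intro u v e p hp
    exact hK.segment_subset (hX u (h₂.sub e).1) (hX v (h₂.sub e).2) hp
  have s1 := (h₁.sub a₁).1
  have t1 := (h₁.sub a₁).2
  have s2 := (h₂.sub a₂).1
  have t2 := (h₂.sub a₂).2
  have hin : ∀ w ∈ X₁, pos w ∈ K → w ∈ X₂ := by
    intro w hw hp
    rcases hV w hw hp with rfl | rfl
    exacts [s2, t2]
  have hcross : ∀ {u v x y}, Γ₁.Adj u v → Γ₂.Adj x y → s(u, v) ≠ s(x, y) →
      ∀ p ∈ segment ℝ (pos u) (pos v), p ∈ segment ℝ (pos x) (pos y) →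
      ∃ w, w ∈ s(u, v) ∧ w ∈ s(x, y) ∧ p = pos w := by
    intro u v x y e1 e2 hne p hp hp'
    by_cases hst : s(u, v) = s(s, t)
    · exact h₂.edge (adj_of_sym2 (Γ' := Γ₁) hst a₂) e2 hne p hp hp'
    · rcases hC u v e1 hst p hp (hseg e2 p hp') with rfl | rfl
      · exact ⟨s, Sym2.mem_iff.mpr (h₁.vert e1 s s1 hp), Sym2.mem_iff.mpr (h₂.vert e2 s s2 hp'), rfl⟩
      · exact ⟨t, Sym2.mem_iff.mpr (h₁.vert e1 t t1 hp), Sym2.mem_iff.mpr (h₂.vert e2 t t2 hp'), rfl⟩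
  refine ⟨?_, ?_, ?_, ?_⟩
  · rintro u v (e | e)
    · exact ⟨Or.inl (h₁.sub e).1, Or.inl (h₁.sub e).2⟩
    · exact ⟨Or.inr (h₂.sub e).1, Or.inr (h₂.sub e).2⟩
  · rintro u (hu | hu) v (hv | hv) huv
    · exact h₁.inj hu hv huv
    · exact h₂.inj (hin u hu (huv ▸ hX v hv)) hv huv
    · exact h₂.inj hu (hin v hv (huv ▸ hX u hu)) huv
    · exact h₂.inj hu hv huv
  · rintro u v x y (e1 | e1) (e2 | e2) hne p hp hp'
    · exact h₁.edge e1 e2 hne p hp hp'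
    · exact hcross e1 e2 hne p hp hp'
    · obtain ⟨w, h1, h2, h3⟩ := hcross e2 e1 hne.symm p hp' hp
      exact ⟨w, h2, h1, h3⟩
    · exact h₂.edge e1 e2 hne p hp hp'
  · rintro u v (e | e) w (hw | hw) hp
    · exact h₁.vert e w hw hp
    · by_cases hst : s(u, v) = s(s, t)
      · exact h₂.vert (adj_of_sym2 (Γ' := Γ₁) hst a₂) w hw hp
      · rcases hC u v e hst _ hp (hX w hw) with h | h
        · rw [h₂.inj hw s2 h] at hp ⊢; exact h₁.vert e s s1 hp
        · rw [h₂.inj hw t2 h] at hp ⊢; exact h₁.vert e t t1 hp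
    · exact h₂.vert e w (hin w hw (hseg e _ hp)) hp
    · exact h₂.vert e w hw hp

/-- the affine map with prescribed values at `0, 1, I` -/
noncomputable def aff (a b c : ℂ) : ℂ →ᵃ[ℝ] ℂ :=
  ((Complex.reLm.smulRight (b - a) + Complex.imLm.smulRight (c - a) : ℂ →ₗ[ℝ] ℂ)).toAffineMap +
    AffineMap.const ℝ ℂ a

lemma aff_apply (a b c p : ℂ) : aff a b c p = a + p.re * (b - a) + p.im * (c - a) := by
  simp [aff]; ring

lemma aff_re (a b c p : ℂ) :
    (aff a b c p).re = (1 - p.re - p.im) * a.re + p.re * b.re + p.im * c.re := by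
  simp [aff_apply]; ring

lemma aff_im (a b c p : ℂ) :
    (aff a b c p).im = (1 - p.re - p.im) * a.im + p.re * b.im + p.im * c.im := by
  simp [aff_apply]; ring

@[simp] lemma aff_zero (a b c : ℂ) : aff a b c 0 = a := by simp [aff_apply]
@[simp] lemma aff_one (a b c : ℂ) : aff a b c 1 = b := by simp [aff_apply]
@[simp] lemma aff_I (a b c : ℂ) : aff a b c I = c := by simp [aff_apply]

lemma aff_inj {a b c : ℂ}
    (h : (b - a).re * (c - a).im - (b - a).im * (c - a).re ≠ 0) : Function.Injective (aff a b c) := by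
  intro p q hpq
  rw [aff_apply, aff_apply] at hpq
  have hr := congrArg Complex.re hpq
  have hi := congrArg Complex.im hpq
  simp only [add_re, mul_re, ofReal_re, ofReal_im, zero_mul, sub_zero] at hr
  simp only [add_im, mul_im, ofReal_re, ofReal_im, zero_mul, add_zero] at hi
  set x := b - a
  set y := c - a
  have h1 : (p.re - q.re) * (x.re * y.im - x.im * y.re) = 0 := by linear_combination hr * y.im - hi * y.re
  have h2 : (p.im - q.im) * (x.re * y.im - x.im * y.re) = 0 := by linear_combination hi * x.re - hr * x.im
  have h1' := (mul_eq_zero.mp h1).resolve_right h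
  have h2' := (mul_eq_zero.mp h2).resolve_right h
  exact Complex.ext (by linarith) (by linarith)

lemma aff_surj {a b c : ℂ} (h : Function.Injective (aff a b c)) :
    Function.Surjective (aff a b c) := by
  set L : ℂ →ₗ[ℝ] ℂ := Complex.reLm.smulRight (b - a) + Complex.imLm.smulRight (c - a)
  have e : ∀ p, aff a b c p = L p + a := fun p => rfl
  have hL : Function.Injective L := fun p q hpq => h (by rw [e, e, hpq])
  have hs := LinearMap.injective_iff_surjective.mp hL
  intro q
  obtain ⟨p, hp⟩ := hs (q - a)
  exact ⟨p, by rw [e, hp]; ring⟩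

lemma tri_convex : Convex ℝ Tri := by
  intro p hp q hq a b ha hb hab
  obtain ⟨p1, p2, p3⟩ := hp
  obtain ⟨q1, q2, q3⟩ := hq
  simp only [Tri, mem_ofPred_eq, add_re, add_im, smul_re, smul_im, smul_eq_mul]
  refine ⟨by positivity, by positivity, ?_⟩
  nlinarith

lemma tri_closed : IsClosed Tri := by
  refine IsClosed.inter (isClosed_le continuous_const continuous_re)
    (IsClosed.inter (isClosed_le continuous_const continuous_im)
      (isClosed_le (continuous_re.add continuous_im) continuous_const))

lemma tri_cross {r r' : ℂ} (h : r ∈ Tri) (h' : r' ∉ Tri) : ∃ q ∈ segment ℝ r r',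
    q ∈ segment ℝ 0 1 ∨ q ∈ segment ℝ I 0 ∨ q ∈ segment ℝ I 1 := by
  have hpc : IsPreconnected (segment ℝ r r') := (convex_segment r r').isPreconnected
  obtain ⟨q, hq, hqf⟩ : ∃ q ∈ segment ℝ r r', q ∈ frontier Tri := by
    by_contra hcon
    push Not at hcon
    have hT : ∀ q ∈ segment ℝ r r', q ∈ Tri → q ∈ interior Tri := fun q hq hqT => by
      by_contra hi
      exact hcon q hq ⟨subset_closure hqT, hi⟩
    obtain ⟨x, -, hx1, hx2⟩ := hpc (interior Tri) Triᶜ isOpen_interior tri_closed.isOpen_compl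
      (fun q hq => by
        by_cases hqT : q ∈ Tri
        · exact Or.inl (hT q hq hqT)
        · exact Or.inr hqT)
      ⟨r, left_mem_segment _ _ _, hT r (left_mem_segment _ _ _) h⟩
      ⟨r', right_mem_segment _ _ _, h'⟩
    exact hx2 (interior_subset hx1)
  refine ⟨q, hq, ?_⟩
  obtain ⟨q1, q2, q3⟩ := tri_closed.frontier_subset hqf
  by_cases e1 : q.re = 0
  · refine Or.inr (Or.inl (mem_seg.mpr ⟨1 - q.im, by linarith, by linarith, ?_⟩))
    apply Complex.ext <;> simp [e1]
  by_cases e2 : q.im = 0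
  · refine Or.inl (mem_seg.mpr ⟨q.re, by linarith, by linarith, ?_⟩)
    apply Complex.ext <;> simp [e2]
  by_cases e3 : q.re + q.im = 1
  · refine Or.inr (Or.inr (mem_seg.mpr ⟨q.re, by linarith, by linarith, ?_⟩))
    apply Complex.ext <;> simp; linarith
  exfalso
  have hop : IsOpen {p : ℂ | 0 < p.re ∧ 0 < p.im ∧ p.re + p.im < 1} :=
    (isOpen_lt continuous_const continuous_re).inter
      ((isOpen_lt continuous_const continuous_im).inter
        (isOpen_lt (continuous_re.add continuous_im) continuous_const))
  have hsub : {p : ℂ | 0 < p.re ∧ 0 < p.im ∧ p.re + p.im < 1} ⊆ interior Tri :=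
    interior_maximal (fun p hp => ⟨hp.1.le, hp.2.1.le, hp.2.2.le⟩) hop
  exact hqf.2 (hsub ⟨lt_of_le_of_ne q1 (Ne.symm e1), lt_of_le_of_ne q2 (Ne.symm e2),
    lt_of_le_of_ne q3 e3⟩)

lemma aff_cross {a b c : ℂ} (h : Function.Injective (aff a b c)) {p v : ℂ}
    (hp : p ∈ aff a b c '' Tri) (hv : v ∉ aff a b c '' Tri) : ∃ q ∈ segment ℝ p v,
    q ∈ segment ℝ a b ∨ q ∈ segment ℝ c a ∨ q ∈ segment ℝ c b := by
  obtain ⟨r, hr, rfl⟩ := hp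
  obtain ⟨r', rfl⟩ := aff_surj h v
  obtain ⟨q, hq, hq'⟩ := tri_cross hr (fun h' => hv ⟨r', h', rfl⟩)
  refine ⟨aff a b c q, ?_, ?_⟩
  · rw [← image_segment]; exact ⟨q, hq, rfl⟩
  · rcases hq' with h | h | h
    · left; have := mem_image_of_mem (aff a b c) h; rw [image_segment] at this; simpa using this
    · right; left
      have := mem_image_of_mem (aff a b c) h; rw [image_segment] at this; simpa using this
    · right; right
      have := mem_image_of_mem (aff a b c) h; rw [image_segment] at this; simpa using this

/-- betweenness antisymmetry -/
lemma seg_antisymm {a p v : ℂ} (h1 : p ∈ segment ℝ a v) (h2 : a ∈ segment ℝ p v) : p = a := by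
  obtain ⟨t, t0, t1, rfl⟩ := mem_seg.mp h1
  obtain ⟨r, r0, r1, e⟩ := mem_seg.mp h2
  by_cases hv : v = a
  · simp [hv]
  have hva : v - a ≠ 0 := sub_ne_zero.mpr hv
  have : ((t + r * (1 - t) : ℝ) : ℂ) * (v - a) = 0 := by push_cast; linear_combination -e
  have h0 := (mul_eq_zero.mp this).resolve_right hva
  have h0' : t + r * (1 - t) = 0 := by exact_mod_cast h0
  have : t = 0 := by nlinarith
  simp [this]

lemma seg_sub_seg {a p v q : ℂ} (h1 : p ∈ segment ℝ a v) (h2 : q ∈ segment ℝ p v) :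
    q ∈ segment ℝ a v :=
  (convex_segment a v).segment_subset h1 (right_mem_segment _ _ _) h2

lemma exists_common {X₁ X₂ : Set V} {f g : V → ℂ} (h : ∀ v ∈ X₁, v ∈ X₂ → f v = g v) :
    ∃ pos : V → ℂ, EqOn pos f X₁ ∧ EqOn pos g X₂ := by
  classical
  refine ⟨fun v => if v ∈ X₁ then f v else g v, fun v hv => by simp [hv], fun v hv => ?_⟩
  by_cases h1 : v ∈ X₁
  · simp [h1, h v h1 hv]
  · simp [h1]

end E1

end

section
open Set Complex Topology Filter

section E2

variable {V : Type*}

lemma TD.congr {Γ : SimpleGraph V} {X M : Set V} {s t : V} {pos pos' : V → ℂ}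
    (h : TD Γ X M s t pos) (he : EqOn pos' pos X) : TD Γ X M s t pos' := by
  have hs := h.hM h.sM
  have ht := h.hM h.tM
  refine ⟨h.toPL.congr he, h.adj, h.hM, h.sM, h.tM, by rw [he hs, h.ps], by rw [he ht, h.pt], ?_, ?_,
    ?_⟩
  · intro v hv; rw [he hv]; exact h.int v hv
  · intro m hm u v e; rw [he (h.hM hm), he (h.sub e).1, he (h.sub e).2]; exact h.zed m hm e
  · intro m hm w hw; rw [he (h.hM hm), he hw]; exact h.zv m hm w hw

lemma TD.swap {Γ : SimpleGraph V} {X M : Set V} {s t : V} {pos : V → ℂ}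
    (h : TD Γ X M s t pos) : TD Γ X M t s (fun v => aff 1 0 I (pos v)) := by
  have hi : Function.Injective (aff 1 0 I) := aff_inj (by simp)
  have hI : ∀ p, segment ℝ I (aff 1 0 I p) = aff 1 0 I '' segment ℝ I p := by
    intro p; rw [image_segment, aff_I]
  refine ⟨h.toPL.map _ hi, h.adj.symm, h.hM, h.tM, h.sM, by simp [h.pt], by simp [h.ps], ?_, ?_, ?_⟩
  · intro v hv h1 h2
    obtain ⟨a, b, c⟩ := h.int v hv h2 h1
    rw [aff_re, aff_im]
    simp
    refine ⟨?_, ?_, ?_⟩ <;> linarith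
  · intro m hm u v e p hp hp'
    rw [hI] at hp
    rw [← image_segment] at hp'
    obtain ⟨q, hq, rfl⟩ := hp
    obtain ⟨q', hq', e'⟩ := hp'
    obtain rfl := hi e'
    rw [h.zed m hm e q' hq hq']
  · intro m hm w hw hp
    rw [hI] at hp
    obtain ⟨q, hq, e'⟩ := hp
    obtain rfl := hi e'
    exact h.zv m hm w hw hq

lemma TD.bd {Γ : SimpleGraph V} {X M : Set V} {s t : V} {pos : V → ℂ}
    (h : TD Γ X M s t pos) {v : V} (hv : v ∈ X) :
    0 ≤ (pos v).re ∧ 0 ≤ (pos v).im ∧ (pos v).re + (pos v).im ≤ 1 ∧ (pos v).im < 1 := by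
  by_cases h1 : v = s
  · subst h1; simp [h.ps]
  by_cases h2 : v = t
  · subst h2; simp [h.pt]
  obtain ⟨a, b, c⟩ := h.int v hv h1 h2
  refine ⟨a.le, b.le, c.le, by linarith⟩

lemma TD.eq_s {Γ : SimpleGraph V} {X M : Set V} {s t : V} {pos : V → ℂ}
    (h : TD Γ X M s t pos) {v : V} (hv : v ∈ X) (h0 : (pos v).re = 0) : v = s := by
  by_contra h1
  by_cases h2 : v = t
  · subst h2; simp [h.pt] at h0
  have := (h.int v hv h1 h2).1
  linarith

lemma TD.eq_t {Γ : SimpleGraph V} {X M : Set V} {s t : V} {pos : V → ℂ}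
    (h : TD Γ X M s t pos) {v : V} (hv : v ∈ X) (h0 : (pos v).re + (pos v).im = 1) : v = t := by
  by_contra h2
  by_cases h1 : v = s
  · subst h1; simp [h.ps] at h0
  have := (h.int v hv h1 h2).2.2
  linarith

lemma TD.tri {Γ : SimpleGraph V} {X M : Set V} {s t : V} {pos : V → ℂ}
    (h : TD Γ X M s t pos) {v : V} (hv : v ∈ X) : pos v ∈ Tri :=
  ⟨(h.bd hv).1, (h.bd hv).2.1, (h.bd hv).2.2.1⟩

lemma col_seg {a b : ℂ} (ha : a.im < 1) (hb : b.im ≤ 1)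
    (h : b.re * (1 - a.im) = a.re * (1 - b.im)) (hle : a.im ≤ b.im) : b ∈ segment ℝ I a := by
  have h0 : 0 < 1 - a.im := by linarith
  refine mem_seg.mpr ⟨(1 - b.im) / (1 - a.im), by apply div_nonneg <;> linarith,
    by rw [div_le_one h0]; linarith, ?_⟩
  apply Complex.ext
  · simp only [add_re, mul_re, I_re, ofReal_re, ofReal_im, sub_re, sub_im, I_im]
    field_simp
    linarith
  · simp only [add_im, mul_im, I_re, ofReal_re, ofReal_im, sub_re, sub_im, I_im]
    field_simp
    ring

lemma wsum {w1 w2 w3 x y z : ℝ} (h1 : 0 ≤ w1) (h2 : 0 ≤ w2) (h3 : 0 ≤ w3) (h : w1 + w2 + w3 = 1)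
    (hx : 0 < x) (hy : 0 < y) (hz : 0 < z) : 0 < w1 * x + w2 * y + w3 * z := by
  have a1 := mul_nonneg h1 hx.le
  have a2 := mul_nonneg h2 hy.le
  have a3 := mul_nonneg h3 hz.le
  by_contra hcon
  have e1 : w1 * x = 0 := by linarith
  have e2 : w2 * y = 0 := by linarith
  have e3 : w3 * z = 0 := by linarith
  have f1 := (mul_eq_zero.mp e1).resolve_right hx.ne'
  have f2 := (mul_eq_zero.mp e2).resolve_right hy.ne'
  have f3 := (mul_eq_zero.mp e3).resolve_right hz.ne'
  linarith

lemma TD.aff_inj {Γ : SimpleGraph V} {X M : Set V} {s t s' t' : V} {pos : V → ℂ}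
    (h : TD Γ X M s t pos) (hs : s' ∈ M) (ht : t' ∈ M) (hne : s' ≠ t') :
    Function.Injective (aff (pos s') (pos t') I) := by
  obtain ⟨a1, a2, a3, a4⟩ := h.bd (h.hM hs)
  obtain ⟨b1, b2, b3, b4⟩ := h.bd (h.hM ht)
  refine _root_.aff_inj fun h0 => ?_
  simp only [sub_re, sub_im, I_re, I_im] at h0
  rcases le_total (pos s').im (pos t').im with hle | hle
  · exact hne (h.zv s' hs t' (h.hM ht) (col_seg a4 b4.le (by linarith) hle)).symm
  · exact hne (h.zv t' ht s' (h.hM hs) (col_seg b4 a4.le (by linarith) hle))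

theorem TD.g1 {Γ₁ Γ₂ : SimpleGraph V} {R M₁ X M₂ : Set V} {s t s' t' : V} {pos₁ pos₂ : V → ℂ}
    (h1 : TD Γ₁ R M₁ s t pos₁)
    (hz : ∀ m ∈ M₁, ∀ n ∈ M₁, m ≠ n → ∀ p ∈ segment ℝ I (pos₁ m), p ∈ segment ℝ I (pos₁ n) → p = I)
    (hs' : s' ∈ M₁) (ht' : t' ∈ M₁) (e : Γ₁.Adj s' t') (hne : s(s', t') ≠ s(s, t))
    (hcn : Cn Γ₁ (R \ {s', t'})) (h2 : TD Γ₂ X M₂ s' t' pos₂)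
    (hX : ∀ v ∈ R, v ∈ X → v = s' ∨ v = t') :
    ∃ pos, TD (Γ₁ ⊔ Γ₂) (R ∪ X) (M₁ ∪ M₂) s t pos := by
  have hi := h1.aff_inj hs' ht' e.ne
  obtain ⟨pos, hp1, hp2⟩ := exists_common (X₁ := R) (X₂ := X) (f := pos₁)
    (g := fun v => aff (pos₁ s') (pos₁ t') I (pos₂ v)) (by
      intro v hv hv'
      rcases hX v hv hv' with rfl | rfl
      · simp [h2.ps]
      · simp [h2.pt])
  have hsR := h1.hM hs'
  have htR := h1.hM ht'
  have hsX := h2.hM h2.sM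
  have htX := h2.hM h2.tM
  replace hz : ∀ m ∈ M₁, ∀ n ∈ M₁, m ≠ n → ∀ p ∈ segment ℝ I (pos m), p ∈ segment ℝ I (pos n) →
      p = I := by
    intro m hm n hn
    rw [hp1 (h1.hM hm), hp1 (h1.hM hn)]
    exact hz m hm n hn
  replace h1 := h1.congr hp1
  rw [← hp1 hsR, ← hp1 htR] at hi hp2
  clear hp1 pos₁
  set φ := aff (pos s') (pos t') I with hφ
  set K := φ '' Tri with hKd
  have hK : Convex ℝ K := tri_convex.affine_image φ
  have hIK : I ∈ K := ⟨I, by simp [Tri], by simp [φ]⟩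
  have hPL2 : PL Γ₂ X pos := (h2.toPL.map φ hi).congr hp2
  have hXK : ∀ v ∈ X, pos v ∈ K := fun v hv => ⟨pos₂ v, h2.tri hv, (hp2 hv).symm⟩
  have hIseg : ∀ m ∈ X, segment ℝ I (pos m) = φ '' segment ℝ I (pos₂ m) := by
    intro m hm; rw [image_segment, hp2 hm]; simp [φ]
  have zed2 : ∀ m ∈ M₂, ∀ ⦃u v⦄, Γ₂.Adj u v → ∀ p ∈ segment ℝ I (pos m),
      p ∈ segment ℝ (pos u) (pos v) → p = pos m := by
    intro m hm u v e p hp hp'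
    rw [hIseg m (h2.hM hm)] at hp
    rw [hp2 (h2.sub e).1, hp2 (h2.sub e).2, ← image_segment] at hp'
    obtain ⟨q, hq, rfl⟩ := hp
    obtain ⟨q', hq', e'⟩ := hp'
    obtain rfl := hi e'
    rw [h2.zed m hm e q' hq hq', hp2 (h2.hM hm)]
  have zv2 : ∀ m ∈ M₂, ∀ w ∈ X, pos w ∈ segment ℝ I (pos m) → w = m := by
    intro m hm w hw hp
    rw [hIseg m (h2.hM hm), hp2 hw] at hp
    obtain ⟨q, hq, e'⟩ := hp
    obtain rfl := hi e'
    exact h2.zv m hm w hw hq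
  obtain ⟨a1, a2, a3, a4⟩ := h1.bd hsR
  obtain ⟨b1, b2, b3, b4⟩ := h1.bd htR
  -- points on the boundary of `K`
  have key : ∀ {u v}, Γ₁.Adj u v → s(u, v) ≠ s(s', t') → ∀ q ∈ segment ℝ (pos u) (pos v),
      (q ∈ segment ℝ (pos s') (pos t') ∨ q ∈ segment ℝ I (pos s') ∨ q ∈ segment ℝ I (pos t')) →
      ∃ w, (w = s' ∨ w = t') ∧ (w = u ∨ w = v) ∧ q = pos w := by
    rintro u v e' hn q hq (h | h | h)
    · obtain ⟨w, w1, w2, w3⟩ := h1.edge e' e hn q hq h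
      exact ⟨w, Sym2.mem_iff.mp w2, Sym2.mem_iff.mp w1, w3⟩
    · obtain rfl := h1.zed s' hs' e' q h hq
      exact ⟨s', Or.inl rfl, h1.vert e' s' hsR hq, rfl⟩
    · obtain rfl := h1.zed t' ht' e' q h hq
      exact ⟨t', Or.inr rfl, h1.vert e' t' htR hq, rfl⟩
  have hV : ∀ w ∈ R, pos w ∈ K → w = s' ∨ w = t' := by
    intro w hw hwK
    by_contra hcon
    have hC : {w ∈ R \ {s', t'} | pos w ∈ K} = R \ {s', t'} := by
      refine hcn.clo_eq (fun w hw => hw.1) ⟨w, ⟨hw, by simpa using hcon⟩, hwK⟩ ?_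
      intro x hx y hy exy
      refine ⟨hy, ?_⟩
      by_contra hyK
      obtain ⟨q, hq, hq'⟩ := aff_cross hi hx.2 hyK
      have hxs := hx.1.2
      have hys := hy.2
      simp only [mem_insert_iff, mem_singleton_iff, not_or] at hxs hys
      obtain ⟨w, w1, w2, w3⟩ := key exy (by
        intro h; rw [Sym2.eq_iff] at h
        rcases h with h | h
        · exact hxs.1 h.1
        · exact hxs.2 h.1) q hq hq'
      grind
    have hst : (s ≠ s' ∧ s ≠ t') ∨ (t ≠ s' ∧ t ≠ t') := by
      by_contra hc
      have hst := h1.adj.ne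
      have hst' := e.ne
      apply hne
      rw [Sym2.eq_iff]
      grind
    rcases hst with ⟨g1, g2⟩ | ⟨g1, g2⟩
    · have : s ∈ {w ∈ R \ {s', t'} | pos w ∈ K} := by
        rw [hC]; exact ⟨h1.hM h1.sM, by simp [g1, g2]⟩
      obtain ⟨r, ⟨r1, r2, r3⟩, hr⟩ := this.2
      rw [h1.ps] at hr
      have q1 := aff_re (pos s') (pos t') I r
      have q2 := aff_im (pos s') (pos t') I r
      rw [← hφ, hr] at q1 q2
      have l1 : 0 < (pos s').re := lt_of_le_of_ne a1 (fun h => g1 (h1.eq_s hsR h.symm).symm)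
      have l2 : 0 < (pos t').re := lt_of_le_of_ne b1 (fun h => g2 (h1.eq_s htR h.symm).symm)
      have := wsum (w1 := 1 - r.re - r.im) (w2 := r.re) (w3 := r.im) (by linarith) r1 r2 (by ring)
        (x := (pos s').re + (pos s').im) (y := (pos t').re + (pos t').im) (by linarith) (by linarith) one_pos
      simp only [zero_re, zero_im, I_re, I_im] at q1 q2
      linarith
    · have : t ∈ {w ∈ R \ {s', t'} | pos w ∈ K} := by
        rw [hC]; exact ⟨h1.hM h1.tM, by simp [g1, g2]⟩
      obtain ⟨r, ⟨r1, r2, r3⟩, hr⟩ := this.2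
      rw [h1.pt] at hr
      have q1 := aff_re (pos s') (pos t') I r
      rw [← hφ, hr] at q1
      have l1 : 0 < 1 - (pos s').re := by
        by_contra hcon
        exact g1 (h1.eq_t hsR (by linarith)).symm
      have l2 : 0 < 1 - (pos t').re := by
        by_contra hcon
        exact g2 (h1.eq_t htR (by linarith)).symm
      have := wsum (w1 := 1 - r.re - r.im) (w2 := r.re) (w3 := r.im) (by linarith) r1 r2 (by ring)
        l1 l2 one_pos
      simp only [one_re, I_re] at q1
      linarith
  have hC0 : ∀ u v, Γ₁.Adj u v → v ≠ s' → v ≠ t' → ∀ p ∈ segment ℝ (pos u) (pos v), p ∈ K →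
      p = pos s' ∨ p = pos t' := by
    intro u v e' n1 n2 p hp hpK
    have hvK : pos v ∉ K := fun h => by
      rcases hV v (h1.sub e').2 h with h | h
      exacts [n1 h, n2 h]
    obtain ⟨q, hq, hq'⟩ := aff_cross hi hpK hvK
    obtain ⟨w, w1, w2, w3⟩ := key e' (by
        intro h; rw [Sym2.eq_iff] at h
        rcases h with h | h
        · exact n2 h.2
        · exact n1 h.2) q (seg_sub_seg hp hq) hq'
    have hwu : w = u := by grind
    subst hwu
    subst w3
    rw [seg_antisymm hp hq]
    rcases w1 with rfl | rfl
    exacts [Or.inl rfl, Or.inr rfl]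
  have hC : ∀ u v, Γ₁.Adj u v → s(u, v) ≠ s(s', t') → ∀ p ∈ segment ℝ (pos u) (pos v), p ∈ K →
      p = pos s' ∨ p = pos t' := by
    intro u v e' hn p hp hpK
    by_cases hv : v ≠ s' ∧ v ≠ t'
    · exact hC0 u v e' hv.1 hv.2 p hp hpK
    · refine hC0 v u e'.symm ?_ ?_ p (by rwa [segment_symm]) hpK
      · intro h; apply hn; rw [Sym2.eq_iff]; have := e'.ne; grind
      · intro h; apply hn; rw [Sym2.eq_iff]; have := e'.ne; grind
  have hZ : ∀ m ∈ M₁, m ≠ s' → m ≠ t' → ∀ p ∈ segment ℝ I (pos m), p ∈ K → p = I := by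
    intro m hm n1 n2 p hp hpK
    have hmK : pos m ∉ K := fun h => by
      rcases hV m (h1.hM hm) h with h | h
      exacts [n1 h, n2 h]
    obtain ⟨q, hq, hq'⟩ := aff_cross hi hpK hmK
    have hqI := seg_sub_seg hp hq
    have hqe : q = I := by
      rcases hq' with h | h | h
      · obtain rfl := h1.zed m hm e q hqI h
        rcases h1.vert e m (h1.hM hm) h with h | h
        exacts [absurd h n1, absurd h n2]
      · exact hz m hm s' hs' n1 q hqI h
      · exact hz m hm t' ht' n2 q hqI h
    subst hqe
    exact seg_antisymm hp hq
  have hIpos : I ≠ pos s' := fun h => by rw [← h] at a4; simp at a4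
  have hIno : ∀ {u v}, Γ₂.Adj u v → I ∉ segment ℝ (pos u) (pos v) := fun e' h =>
    hIpos (zed2 s' h2.sM e' I (left_mem_segment _ _ _) h)
  have hIno' : ∀ w ∈ X, pos w ≠ I := fun w hw h => by
    have := zv2 s' h2.sM w hw (h ▸ left_mem_segment _ _ _)
    subst this
    exact hIpos h.symm
  refine ⟨pos, h1.toPL.glue hPL2 e h2.adj hK hXK hC hV, Or.inl h1.adj,
    union_subset_union h1.hM h2.hM, Or.inl h1.sM, Or.inl h1.tM, h1.ps, h1.pt, ?_, ?_, ?_⟩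
  · rintro v (hv | hv) n1 n2
    · exact h1.int v hv n1 n2
    · by_cases m1 : v = s'
      · subst m1; exact h1.int _ hsR n1 n2
      by_cases m2 : v = t'
      · subst m2; exact h1.int _ htR n1 n2
      obtain ⟨c1, c2, c3⟩ := h2.int v hv m1 m2
      rw [hp2 hv]
      simp only [hφ]
      rw [aff_re, aff_im, I_re, I_im]
      set w := pos₂ v
      have w1 : 0 < 1 - w.re - w.im := by linarith
      have f1 := mul_nonneg w1.le a1
      have f2 := mul_nonneg c1.le b1
      have f3 := mul_nonneg w1.le a2
      have f4 := mul_nonneg c1.le b2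
      refine ⟨?_, by linarith, ?_⟩
      · by_contra hcon
        have k1 : (1 - w.re - w.im) * (pos s').re = 0 := by linarith
        have k2 : w.re * (pos t').re = 0 := by linarith
        have k3 := h1.eq_s hsR ((mul_eq_zero.mp k1).resolve_left w1.ne')
        have k4 := h1.eq_s htR ((mul_eq_zero.mp k2).resolve_left c1.ne')
        exact e.ne (k3.trans k4.symm)
      · by_contra hcon
        have g1 := mul_nonneg w1.le (show 0 ≤ 1 - (pos s').re - (pos s').im by linarith)
        have g2 := mul_nonneg c1.le (show 0 ≤ 1 - (pos t').re - (pos t').im by linarith)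
        have k1 : (1 - w.re - w.im) * (1 - (pos s').re - (pos s').im) = 0 := by nlinarith
        have k2 : w.re * (1 - (pos t').re - (pos t').im) = 0 := by nlinarith
        have k3 := h1.eq_t hsR (by linarith [(mul_eq_zero.mp k1).resolve_left w1.ne'])
        have k4 := h1.eq_t htR (by linarith [(mul_eq_zero.mp k2).resolve_left c1.ne'])
        exact e.ne (k3.trans k4.symm)
  · have hzed2 : ∀ m ∈ M₂, ∀ ⦃u v⦄, (Γ₁ ⊔ Γ₂).Adj u v → ∀ p ∈ segment ℝ I (pos m),
        p ∈ segment ℝ (pos u) (pos v) → p = pos m := by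
      rintro m hm u v (e' | e') p hp hp'
      · by_cases hst : s(u, v) = s(s', t')
        · exact zed2 m hm (adj_of_sym2 (Γ' := Γ₁) hst h2.adj) p hp hp'
        · rcases hC u v e' hst p hp' (hK.segment_subset hIK (hXK m (h2.hM hm)) hp) with rfl | rfl
          · rw [zv2 m hm s' hsX hp]
          · rw [zv2 m hm t' htX hp]
      · exact zed2 m hm e' p hp hp'
    rintro m (hm | hm)
    · by_cases m1 : m = s'
      · subst m1; exact hzed2 _ h2.sM
      by_cases m2 : m = t'
      · subst m2; exact hzed2 _ h2.tM
      rintro u v (e' | e') p hp hp'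
      · exact h1.zed m hm e' p hp hp'
      · have := hZ m hm m1 m2 p hp
          (hK.segment_subset (hXK u (h2.sub e').1) (hXK v (h2.sub e').2) hp')
        subst this
        exact absurd hp' (hIno e')
    · exact hzed2 m hm
  · have hzv2 : ∀ m ∈ M₂, ∀ w ∈ R ∪ X, pos w ∈ segment ℝ I (pos m) → w = m := by
      rintro m hm w (hw | hw) hp
      · rcases hV w hw (hK.segment_subset hIK (hXK m (h2.hM hm)) hp) with rfl | rfl
        · exact zv2 m hm _ hsX hp
        · exact zv2 m hm _ htX hp
      · exact zv2 m hm w hw hp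
    rintro m (hm | hm)
    · by_cases m1 : m = s'
      · subst m1; exact hzv2 _ h2.sM
      by_cases m2 : m = t'
      · subst m2; exact hzv2 _ h2.tM
      rintro w (hw | hw) hp
      · exact h1.zv m hm w hw hp
      · exact absurd (hZ m hm m1 m2 _ hp (hXK w hw)) (hIno' w hw)
    · exact hzv2 m hm

end E2

end

section
open Set Complex Topology Filter

section E3

variable {V : Type*}

lemma exists_low (X : Set V) (hX : X.Finite) (f : V → ℝ) (hf : ∀ v ∈ X, 0 < f v) :
    ∃ δ : ℝ, 0 < δ ∧ δ < 1 ∧ ∀ v ∈ X, δ < f v := by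
  induction X, hX using Set.Finite.induction_on with
  | empty => exact ⟨1 / 2, by norm_num, by norm_num, by simp⟩
  | @insert a S ha hS ih =>
    obtain ⟨δ, h0, h1, h2⟩ := ih (fun v hv => hf v (mem_insert_of_mem _ hv))
    have ha := hf a (mem_insert _ _)
    refine ⟨min δ (f a / 2), lt_min h0 (by linarith), lt_of_le_of_lt (min_le_left _ _) h1, ?_⟩
    rintro v (rfl | hv)
    · exact lt_of_le_of_lt (min_le_right _ _) (by linarith)
    · exact lt_of_le_of_lt (min_le_left _ _) (h2 v hv)

/-- the low triangle -/
def Low (δ : ℝ) : Set ℂ := {p | 0 ≤ p.im ∧ p.im ≤ δ * p.re ∧ p.im ≤ δ * (1 - p.re)}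

lemma low_convex (δ : ℝ) : Convex ℝ (Low δ) := by
  intro p hp q hq a b ha hb hab
  obtain ⟨p1, p2, p3⟩ := hp
  obtain ⟨q1, q2, q3⟩ := hq
  simp only [Low, mem_ofPred_eq, add_re, add_im, smul_re, smul_im, smul_eq_mul]
  have e1 := mul_le_mul_of_nonneg_left p2 ha
  have e2 := mul_le_mul_of_nonneg_left p3 ha
  have e3 := mul_le_mul_of_nonneg_left q2 hb
  have e4 := mul_le_mul_of_nonneg_left q3 hb
  obtain rfl : b = 1 - a := by linarith
  refine ⟨by positivity, by linarith, by linarith⟩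

theorem TD.g3 [Finite V] {Γ₁ Γ₂ : SimpleGraph V} {R M₁ X M : Set V} {s t : V} {pos₁ pos₂ : V → ℂ}
    (h1 : TD Γ₁ R M₁ s t pos₁) (h2 : TD Γ₂ X M s t pos₂)
    (hX : ∀ v ∈ X, v ∈ R → v = s ∨ v = t) :
    ∃ pos, TD (Γ₂ ⊔ Γ₁) (X ∪ R) M s t pos := by
  obtain ⟨δ, d0, d1, hδ⟩ := exists_low (X \ {s, t}) (toFinite _) (fun v => (pos₂ v).im) (by
    rintro v ⟨hv, hv'⟩
    simp only [mem_insert_iff, mem_singleton_iff, not_or] at hv'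
    exact (h2.int v hv hv'.1 hv'.2).2.1)
  set φ := aff 0 1 (1 / 2 + (δ / 2 : ℝ) * I) with hφ
  have hi : Function.Injective φ := _root_.aff_inj (by simp; exact d0.ne')
  obtain ⟨pos, hp2, hp1⟩ := exists_common (X₁ := X) (X₂ := R) (f := pos₂)
    (g := fun v => φ (pos₁ v)) (by
      intro v hv hv'
      rcases hX v hv hv' with rfl | rfl
      · simp [h1.ps, h2.ps, hφ]
      · simp [h1.pt, h2.pt, hφ])
  have hd : ∀ v ∈ X, v ≠ s → v ≠ t → δ < (pos v).im := by
    intro v hv n1 n2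
    rw [hp2 hv]
    exact hδ v ⟨hv, by simp [n1, n2]⟩
  replace h2 := h2.congr hp2
  clear hδ hp2 pos₂
  have hPL1 : PL Γ₁ R pos := (h1.toPL.map φ hi).congr hp1
  have hre : ∀ p, (φ p).re = p.re + p.im / 2 := by
    intro p; rw [hφ, aff_re]; simp; ring
  have him : ∀ p, (φ p).im = p.im * (δ / 2) := by
    intro p; rw [hφ, aff_im]; simp
  have hRK : ∀ v ∈ R, pos v ∈ Low δ := by
    intro v hv
    obtain ⟨r1, r2, r3⟩ := h1.tri hv
    rw [hp1 hv]
    refine ⟨?_, ?_, ?_⟩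
    · rw [him]; positivity
    · rw [him, hre]; nlinarith
    · rw [him, hre]; nlinarith
  have hV : ∀ w ∈ X, pos w ∈ Low δ → w = s ∨ w = t := by
    rintro w hw ⟨w1, w2, w3⟩
    by_contra hcon
    rw [not_or] at hcon
    have := hd w hw hcon.1 hcon.2
    linarith
  have hC0 : ∀ u v, Γ₂.Adj u v → v ≠ s → v ≠ t → ∀ p ∈ segment ℝ (pos u) (pos v), p ∈ Low δ →
      p = pos s ∨ p = pos t := by
    rintro u v e n1 n2 p hp ⟨p1, p2, p3⟩
    obtain ⟨x, x0, x1, rfl⟩ := mem_seg.mp hp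
    have hv := hd v (h2.sub e).2 n1 n2
    obtain ⟨v1, v2, v3⟩ := h2.int v (h2.sub e).2 n1 n2
    simp only [add_im, add_re, mul_re, mul_im, ofReal_re, ofReal_im, sub_re, sub_im, zero_mul,
      sub_zero, add_zero] at p1 p2 p3
    by_cases m1 : u = s
    · subst m1
      left
      rw [h2.ps] at p2 ⊢
      simp only [zero_re, zero_im, sub_zero, zero_add] at p2 ⊢
      have hx : x = 0 := by
        by_contra hx
        have hx : 0 < x := lt_of_le_of_ne x0 (Ne.symm hx)
        have : x * (pos v).im ≤ x * (δ * (pos v).re) := by linarith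
        have := le_of_mul_le_mul_left this hx
        nlinarith
      simp [hx]
    by_cases m2 : u = t
    · subst m2
      right
      rw [h2.pt] at p3 ⊢
      simp only [one_re, one_im, sub_zero, zero_add] at p3 ⊢
      have hx : x = 0 := by
        by_contra hx
        have hx : 0 < x := lt_of_le_of_ne x0 (Ne.symm hx)
        have : x * (pos v).im ≤ x * (δ * (1 - (pos v).re)) := by linarith
        have := le_of_mul_le_mul_left this hx
        nlinarith
      simp [hx]
    exfalso
    have hu := hd u (h2.sub e).1 m1 m2
    nlinarith
  have hC : ∀ u v, Γ₂.Adj u v → s(u, v) ≠ s(s, t) → ∀ p ∈ segment ℝ (pos u) (pos v), p ∈ Low δ →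
      p = pos s ∨ p = pos t := by
    intro u v e' hn p hp hpK
    by_cases hv : v ≠ s ∧ v ≠ t
    · exact hC0 u v e' hv.1 hv.2 p hp hpK
    · refine hC0 v u e'.symm ?_ ?_ p (by rwa [segment_symm]) hpK
      · intro h; apply hn; rw [Sym2.eq_iff]; have := e'.ne; grind
      · intro h; apply hn; rw [Sym2.eq_iff]; have := e'.ne; grind
  have hZ : ∀ m ∈ M, ∀ p ∈ segment ℝ I (pos m), p ∈ Low δ → p = pos m := by
    rintro m hm p hp ⟨p1, p2, p3⟩
    obtain ⟨x, x0, x1, rfl⟩ := mem_seg.mp hp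
    simp only [add_im, add_re, mul_re, mul_im, ofReal_re, ofReal_im, sub_re, sub_im, zero_mul,
      sub_zero, add_zero, I_re, I_im, zero_add] at p1 p2 p3
    have hx : x = 1 → I + (x : ℂ) * (pos m - I) = pos m := by rintro rfl; simp
    by_cases m1 : m = s
    · subst m1
      apply hx
      rw [h2.ps] at p2
      simp at p2
      linarith
    by_cases m2 : m = t
    · subst m2
      apply hx
      rw [h2.pt] at p3
      simp at p3
      nlinarith
    exfalso
    have := hd m (h2.hM hm) m1 m2
    nlinarith
  refine ⟨pos, h2.toPL.glue hPL1 h2.adj h1.adj (low_convex δ) hRK hC hV, Or.inl h2.adj,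
    h2.hM.trans subset_union_left, h2.sM, h2.tM, h2.ps, h2.pt, ?_, ?_, ?_⟩
  · rintro v (hv | hv) n1 n2
    · exact h2.int v hv n1 n2
    · obtain ⟨c1, c2, c3⟩ := h1.int v hv n1 n2
      rw [hp1 hv, hre, him]
      refine ⟨by positivity, by positivity, ?_⟩
      nlinarith
  · rintro m hm u v (e | e) p hp hp'
    · exact h2.zed m hm e p hp hp'
    · exact hZ m hm p hp ((low_convex δ).segment_subset (hRK u (h1.sub e).1) (hRK v (h1.sub e).2) hp')
  · rintro m hm w (hw | hw) hp
    · exact h2.zv m hm w hw hp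
    · have h := hZ m hm _ hp (hRK w hw)
      have hmR : m ∈ R := by
        rcases hV m (h2.hM hm) (h ▸ hRK w hw) with rfl | rfl
        exacts [h1.hM h1.sM, h1.hM h1.tM]
      exact hPL1.inj hw hmR h

end E3

end

section
open Set Complex Topology Filter

section E4

variable {V : Type*}

/-- the segment of an edge -/
def esegC (pos : V → ℂ) (e : Sym2 V) : Set ℂ :=
  Sym2.lift ⟨fun u v => segment ℝ (pos u) (pos v), fun u v => segment_symm ℝ (pos u) (pos v)⟩ e

lemma esegC_mk (pos : V → ℂ) (u v : V) : esegC pos s(u, v) = segment ℝ (pos u) (pos v) := rfl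

/-- image of a straight line drawing -/
def plimg (Γ : SimpleGraph V) (X : Set V) (pos : V → ℂ) : Set ℂ :=
  {p | (∃ v ∈ X, p = pos v) ∨ ∃ u v, Γ.Adj u v ∧ p ∈ segment ℝ (pos u) (pos v)}

lemma PL.drawing {Γ : SimpleGraph V} {X : Set V} {pos : V → ℂ} (h : PL Γ X pos) :
    ∃ D : PlanarDrawingOn Γ X, (∀ v, D.pos v = phi.symm (pos v)) ∧
      D.image = phi.symm '' plimg Γ X pos := by
  refine ⟨⟨fun v => phi.symm (pos v), ?_, fun e => phi.symm '' esegC pos e, ?_, ?_, ?_⟩, fun _ => rfl,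
    ?_⟩
  · intro u hu v hv huv
    exact h.inj hu hv (phi.symm.injective huv)
  · intro u v hu hv e
    have hne : pos v - pos u ≠ 0 := fun h' => e.ne (h.inj hv hu (sub_eq_zero.mp h')).symm
    refine ⟨fun x => phi.symm (pos u + x * (pos v - pos u)), ?_, ?_, by simp, by simp, ?_⟩
    · exact (phi.symm.continuous.comp (by fun_prop)).continuousOn
    · intro x _ y _ hxy
      have h1 := phi.symm.injective hxy
      have h2 : (x : ℂ) * (pos v - pos u) = y * (pos v - pos u) := add_left_cancel h1
      exact_mod_cast mul_right_cancel₀ hne h2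
    · ext p
      constructor
      · rintro ⟨x, hx, rfl⟩
        exact ⟨_, mem_seg.mpr ⟨x, hx.1, hx.2, rfl⟩, rfl⟩
      · rintro ⟨q, hq, rfl⟩
        obtain ⟨x, x0, x1, rfl⟩ := mem_seg.mp hq
        exact ⟨x, ⟨x0, x1⟩, rfl⟩
  · intro e₁ e₂
    induction e₁ with | h u v =>
    induction e₂ with | h x y =>
    rintro a1 a2 - - hne p ⟨⟨q, hq, rfl⟩, ⟨q', hq', e⟩⟩
    obtain rfl := phi.symm.injective e
    obtain ⟨w, w1, w2, w3⟩ := h.edge a1 a2 hne q' hq hq'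
    refine ⟨w, ?_, w1, w2, by rw [w3]⟩
    rcases Sym2.mem_iff.mp w1 with rfl | rfl
    exacts [(h.sub a1).1, (h.sub a1).2]
  · intro e
    induction e with | h u v =>
    rintro a1 - w hw ⟨q, hq, e⟩
    obtain rfl := phi.symm.injective e
    exact Sym2.mem_iff.mpr (h.vert a1 w hw hq)
  · ext p
    constructor
    · rintro (⟨v, hv, rfl⟩ | hp)
      · exact ⟨_, Or.inl ⟨v, hv, rfl⟩, rfl⟩
      · simp only [mem_iUnion] at hp
        obtain ⟨e, ⟨he, -⟩, q, hq, rfl⟩ := hp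
        induction e with | h u v =>
        exact ⟨q, Or.inr ⟨u, v, he, hq⟩, rfl⟩
    · rintro ⟨q, (⟨v, hv, rfl⟩ | ⟨u, v, e, hq⟩), rfl⟩
      · exact Or.inl ⟨v, hv, rfl⟩
      · refine Or.inr ?_
        simp only [mem_iUnion]
        refine ⟨s(u, v), ⟨e, ?_⟩, q, hq, rfl⟩
        intro x hx
        rcases Sym2.mem_iff.mp hx with rfl | rfl
        exacts [(h.sub e).1, (h.sub e).2]

/-- the outside region -/
def Outs : Set ℂ := {p | p.re < 0} ∪ {p | 1 ≤ p.im} ∪ {p | p.im ≤ -1}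

lemma outs_pc : IsPreconnected Outs := by
  have h1 : IsPreconnected {p : ℂ | p.re < 0} := (convex_halfSpace_re_lt 0).isPreconnected
  have h2 : IsPreconnected {p : ℂ | 1 ≤ p.im} := (convex_halfSpace_im_ge 1).isPreconnected
  have h3 : IsPreconnected {p : ℂ | p.im ≤ -1} := (convex_halfSpace_im_le (-1)).isPreconnected
  refine IsPreconnected.union (-1 - I) (Or.inl ?_) ?_ (IsPreconnected.union (-1 + I) ?_ ?_ h1 h2) h3
  all_goals simp

theorem PL.outer {Γ : SimpleGraph V} {X : Set V} {pos : V → ℂ} (h : PL Γ X pos) {M : Set V}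
    (hM : M ⊆ X) (hout : Outs ⊆ (plimg Γ X pos)ᶜ)
    (hacc : ∀ m ∈ M, ∃ z ∈ Outs, ∀ p ∈ segment ℝ z (pos m), p ∈ plimg Γ X pos → p = pos m) :
    ∃ (D : PlanarDrawingOn Γ X) (F : Set (ℝ × ℝ)), D.IsOuterFace F ∧
      ∀ m ∈ M, D.pos m ∈ frontier F := by
  obtain ⟨D, hD, hI⟩ := h.drawing
  have h0 : (-1 : ℂ) ∈ Outs := Or.inl (Or.inl (by simp))
  set T := plimg Γ X pos
  set F' := connectedComponentIn Tᶜ (-1) with hF'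
  have hOF : Outs ⊆ F' := outs_pc.subset_connectedComponentIn h0 hout
  have hIc : D.imageᶜ = phi.symm '' Tᶜ := by
    rw [hI, image_compl_eq phi.symm.bijective]
  refine ⟨D, phi.symm '' F', ⟨⟨phi.symm (-1), ?_, ?_⟩, ?_⟩, ?_⟩
  · rw [hIc]; exact ⟨_, hout h0, rfl⟩
  · rw [hIc, hF']
    exact phi.symm.image_connectedComponentIn (hout h0)
  · intro hb
    obtain ⟨r, hr⟩ := (Metric.isBounded_iff_subset_closedBall 0).mp hb
    have hm : phi.symm (((-(|r| + 1) : ℝ)) : ℂ) ∈ phi.symm '' F' :=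
      ⟨_, hOF (Or.inl (Or.inl (by
        show (((-(|r| + 1) : ℝ)) : ℂ).re < 0
        rw [ofReal_re]; linarith [abs_nonneg r]))), rfl⟩
    have := hr hm
    rw [mem_closedBall_zero_iff] at this
    have h2 := (norm_fst_le _).trans this
    have h3 : (phi.symm (((-(|r| + 1) : ℝ)) : ℂ)).1 = -(|r| + 1) := by simp [phi]
    rw [h3, Real.norm_eq_abs, abs_neg, abs_of_pos (by positivity)] at h2
    linarith [le_abs_self r]
  · intro m hm
    rw [hD, ← phi.symm.image_frontier]
    refine mem_image_of_mem _ ?_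
    obtain ⟨z, hz, hzm⟩ := hacc m hm
    have hmT : pos m ∈ T := Or.inl ⟨m, hM hm, rfl⟩
    have hmF : pos m ∉ F' := fun h' => connectedComponentIn_subset _ _ h' hmT
    refine ⟨?_, fun h' => hmF (interior_subset h')⟩
    set γ : ℝ → ℂ := fun x => z + x * (pos m - z) with hγ
    have hc : Continuous γ := by fun_prop
    have hzne : pos m - z ≠ 0 := by
      intro h'
      rw [sub_eq_zero] at h'
      rw [h'] at hmT
      exact hout hz hmT
    have hsub : γ '' Ico 0 1 ⊆ Tᶜ := by
      rintro _ ⟨x, hx, rfl⟩ hT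
      have h1 := hzm _ (mem_seg.mpr ⟨x, hx.1, hx.2.le, rfl⟩) hT
      have h2 : ((1 - x : ℝ) : ℂ) * (pos m - z) = 0 := by
        change z + (x : ℂ) * (pos m - z) = pos m at h1
        push_cast
        linear_combination -h1
      have h3 := (mul_eq_zero.mp h2).resolve_right hzne
      have h4 : 1 - x = 0 := by exact_mod_cast h3
      linarith [hx.2]
    have hF2 : γ '' Ico 0 1 ⊆ F' := by
      have e1 : connectedComponentIn Tᶜ z = F' := (connectedComponentIn_eq (hOF hz)).symm
      rw [← e1]
      refine (isPreconnected_Ico.image γ hc.continuousOn).subset_connectedComponentIn ?_ hsub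
      exact ⟨0, by simp, by simp [hγ]⟩
    have h1 : (1 : ℝ) ∈ closure (Ico (0 : ℝ) 1) := by
      rw [closure_Ico zero_ne_one]; simp
    have h2 := image_closure_subset_closure_image hc (mem_image_of_mem γ h1)
    have h3 : γ 1 = pos m := by simp [hγ]
    rw [h3] at h2
    exact closure_mono hF2 h2

theorem TD.g2 {Γ₁ Γ₂ : SimpleGraph V} {X₁ M₁ X₂ M₂ : Set V} {s t : V}
    {pos₁ pos₂ : V → ℂ} (h1 : TD Γ₁ X₁ M₁ s t pos₁) (h2 : TD Γ₂ X₂ M₂ s t pos₂)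
    (hX : ∀ v ∈ X₁, v ∈ X₂ → v = s ∨ v = t) :
    ∃ (D : PlanarDrawingOn (Γ₁ ⊔ Γ₂) (X₁ ∪ X₂)) (F : Set (ℝ × ℝ)), D.IsOuterFace F ∧
      ∀ m ∈ M₁ ∪ M₂, D.pos m ∈ frontier F := by
  set φ := aff 0 1 (-I) with hφ
  have hi : Function.Injective φ := _root_.aff_inj (by simp)
  have hre : ∀ p, (φ p).re = p.re := by intro p; rw [hφ, aff_re]; simp
  have him : ∀ p, (φ p).im = -p.im := by intro p; rw [hφ, aff_im]; simp
  obtain ⟨pos, hp1, hp2⟩ := exists_common (X₁ := X₁) (X₂ := X₂) (f := pos₁)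
    (g := fun v => φ (pos₂ v)) (by
      intro v hv hv'
      rcases hX v hv hv' with rfl | rfl
      · simp [h1.ps, h2.ps, hφ]
      · simp [h1.pt, h2.pt, hφ])
  replace h1 := h1.congr hp1
  clear hp1 pos₁
  have hPL2 : PL Γ₂ X₂ pos := (h2.toPL.map φ hi).congr hp2
  have hK : Convex ℝ {p : ℂ | p.im ≤ 0} := convex_halfSpace_im_le 0
  have hK' : Convex ℝ {p : ℂ | 0 ≤ p.im} := convex_halfSpace_im_ge 0
  have hXK : ∀ v ∈ X₂, pos v ∈ {p : ℂ | p.im ≤ 0} := by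
    intro v hv
    have := (h2.bd hv).2.1
    rw [hp2 hv]
    simp only [mem_ofPred_eq, him]; linarith
  have hXK' : ∀ v ∈ X₁, pos v ∈ {p : ℂ | 0 ≤ p.im} := fun v hv => (h1.bd hv).2.1
  have hV : ∀ w ∈ X₁, pos w ∈ {p : ℂ | p.im ≤ 0} → w = s ∨ w = t := by
    intro w hw hwK
    by_contra hcon
    rw [not_or] at hcon
    have := (h1.int w hw hcon.1 hcon.2).2.1
    have : (pos w).im ≤ 0 := hwK
    linarith
  have hC0 : ∀ u v, Γ₁.Adj u v → v ≠ s → v ≠ t → ∀ p ∈ segment ℝ (pos u) (pos v),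
      p ∈ {p : ℂ | p.im ≤ 0} → p = pos s ∨ p = pos t := by
    intro u v e n1 n2 p hp hpK
    obtain ⟨x, x0, x1, rfl⟩ := mem_seg.mp hp
    have hv := (h1.int v (h1.sub e).2 n1 n2).2.1
    have hu := (h1.bd (h1.sub e).1).2.1
    simp only [mem_ofPred_eq, add_im, mul_im, ofReal_re, ofReal_im, sub_im, zero_mul, add_zero] at hpK
    have hx : x = 0 := by
      by_contra hx
      have hx : 0 < x := lt_of_le_of_ne x0 (Ne.symm hx)
      have := mul_pos hx hv
      nlinarith
    subst hx
    simp only [ofReal_zero, zero_mul, add_zero] at hpK ⊢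
    rcases hV u (h1.sub e).1 (by simpa using hpK) with rfl | rfl
    exacts [Or.inl rfl, Or.inr rfl]
  have hC : ∀ u v, Γ₁.Adj u v → s(u, v) ≠ s(s, t) → ∀ p ∈ segment ℝ (pos u) (pos v),
      p ∈ {p : ℂ | p.im ≤ 0} → p = pos s ∨ p = pos t := by
    intro u v e' hn p hp hpK
    by_cases hv : v ≠ s ∧ v ≠ t
    · exact hC0 u v e' hv.1 hv.2 p hp hpK
    · refine hC0 v u e'.symm ?_ ?_ p (by rwa [segment_symm]) hpK
      · intro h; apply hn; rw [Sym2.eq_iff]; have := e'.ne; grind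
      · intro h; apply hn; rw [Sym2.eq_iff]; have := e'.ne; grind
  have hPL := h1.toPL.glue hPL2 h1.adj h2.adj hK hXK hC hV
  have hlow : ∀ p, (∃ v ∈ X₂, p = pos v) ∨ (∃ u v, Γ₂.Adj u v ∧ p ∈ segment ℝ (pos u) (pos v)) →
      p.im ≤ 0 := by
    rintro p (⟨v, hv, rfl⟩ | ⟨u, v, e, hp⟩)
    · exact hXK v hv
    · exact hK.segment_subset (hXK u (hPL2.sub e).1) (hXK v (hPL2.sub e).2) hp
  have hup : ∀ p, (∃ v ∈ X₁, p = pos v) ∨ (∃ u v, Γ₁.Adj u v ∧ p ∈ segment ℝ (pos u) (pos v)) →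
      0 ≤ p.im := by
    rintro p (⟨v, hv, rfl⟩ | ⟨u, v, e, hp⟩)
    · exact hXK' v hv
    · exact hK'.segment_subset (hXK' u (h1.sub e).1) (hXK' v (h1.sub e).2) hp
  have hsplit : ∀ p ∈ plimg (Γ₁ ⊔ Γ₂) (X₁ ∪ X₂) pos,
      ((∃ v ∈ X₁, p = pos v) ∨ (∃ u v, Γ₁.Adj u v ∧ p ∈ segment ℝ (pos u) (pos v))) ∨
      ((∃ v ∈ X₂, p = pos v) ∨ (∃ u v, Γ₂.Adj u v ∧ p ∈ segment ℝ (pos u) (pos v))) := by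
    rintro p (⟨v, hv | hv, rfl⟩ | ⟨u, v, e | e, hp⟩)
    · exact Or.inl (Or.inl ⟨v, hv, rfl⟩)
    · exact Or.inr (Or.inl ⟨v, hv, rfl⟩)
    · exact Or.inl (Or.inr ⟨u, v, e, hp⟩)
    · exact Or.inr (Or.inr ⟨u, v, e, hp⟩)
  refine hPL.outer (union_subset_union h1.hM h2.hM) ?_ ?_
  · have hB : Convex ℝ ({p : ℂ | 0 ≤ p.re} ∩ ({p | p.im < 1} ∩ {p | -1 < p.im})) :=
      (convex_halfSpace_re_ge 0).inter ((convex_halfSpace_im_lt 1).inter (convex_halfSpace_im_gt (-1)))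
    have hvB : ∀ v ∈ X₁ ∪ X₂, pos v ∈ ({p : ℂ | 0 ≤ p.re} ∩ ({p | p.im < 1} ∩ {p | -1 < p.im})) := by
      rintro v (hv | hv)
      · obtain ⟨a, b, c, d⟩ := h1.bd hv
        exact ⟨a, d, (by linarith : -1 < (pos v).im)⟩
      · obtain ⟨a, b, c, d⟩ := h2.bd hv
        rw [hp2 hv]
        simp only [mem_inter_iff, mem_ofPred_eq, hre, him]
        exact ⟨a, by linarith, by linarith⟩
    intro p hp hT
    have hpB : p ∈ ({p : ℂ | 0 ≤ p.re} ∩ ({p | p.im < 1} ∩ {p | -1 < p.im})) := by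
      rcases hT with ⟨v, hv, rfl⟩ | ⟨u, v, e, hp⟩
      · exact hvB v hv
      · exact hB.segment_subset (hvB u (hPL.sub e).1) (hvB v (hPL.sub e).2) hp
    obtain ⟨c1, c2, c3⟩ := hpB
    simp only [mem_ofPred_eq] at c1 c2 c3
    rcases hp with (hp | hp) | hp <;> simp only [mem_ofPred_eq] at hp <;> linarith
  · rintro m (hm | hm)
    · refine ⟨I, Or.inl (Or.inr (by simp)), fun p hp hT => ?_⟩
      rcases hsplit p hT with (⟨v, hv, rfl⟩ | ⟨u, v, e, hp'⟩) | hT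
      · rw [h1.zv m hm v hv hp]
      · exact h1.zed m hm e p hp hp'
      · have := hlow p hT
        have hmi : 0 ≤ (pos m).im := hXK' m (h1.hM hm)
        obtain ⟨x, x0, x1, rfl⟩ := mem_seg.mp hp
        simp at this
        obtain rfl : x = 1 := by nlinarith
        simp
    · refine ⟨-I, Or.inr (by simp), fun p hp hT => ?_⟩
      rcases hsplit p hT with hT | hT
      · have := hup p hT
        have hmi : (pos m).im ≤ 0 := hXK m (h2.hM hm)
        obtain ⟨x, x0, x1, rfl⟩ := mem_seg.mp hp
        simp at this
        obtain rfl : x = 1 := by nlinarith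
        simp
      · have hs : segment ℝ (-I) (pos m) = φ '' segment ℝ I (pos₂ m) := by
          rw [image_segment, hp2 (h2.hM hm)]; simp [φ]
        rw [hs] at hp
        obtain ⟨q, hq, rfl⟩ := hp
        rw [hp2 (h2.hM hm)]
        rcases hT with ⟨v, hv, hvp⟩ | ⟨u, v, e, hp'⟩
        · rw [hp2 hv] at hvp
          obtain rfl := hi hvp
          rw [h2.zv m hm v hv hq]
        · rw [hp2 (h2.sub e).1, hp2 (h2.sub e).2, ← image_segment] at hp'
          obtain ⟨q', hq', e'⟩ := hp'
          obtain rfl := hi e'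
          rw [h2.zed m hm e q' hq hq']

end E4

end

section
open Set Complex Topology Filter

section F1

variable {V : Type*}

lemma ReachableWithin.rfl' {G : SimpleGraph V} {A : Set V} {u : V} (h : u ∈ A) :
    ReachableWithin G A u u := ⟨SimpleGraph.Walk.nil, by simpa using h⟩

lemma ReachableWithin.symm' {G : SimpleGraph V} {A : Set V} {u v : V}
    (h : ReachableWithin G A u v) : ReachableWithin G A v u := by
  obtain ⟨p, hp⟩ := h
  exact ⟨p.reverse, by simpa using hp⟩

lemma ReachableWithin.trans' {G : SimpleGraph V} {A : Set V} {u v w : V}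
    (h : ReachableWithin G A u v) (h' : ReachableWithin G A v w) : ReachableWithin G A u w := by
  obtain ⟨p, hp⟩ := h
  obtain ⟨q, hq⟩ := h'
  refine ⟨p.append q, fun x hx => ?_⟩
  rw [SimpleGraph.Walk.mem_support_append_iff] at hx
  rcases hx with hx | hx
  exacts [hp x hx, hq x hx]

lemma IsTriCompOn.reach {G : SimpleGraph V} {B R : Set V} (h : IsTriCompOn G B R) {s t : V}
    (hst : TriSepPairOn G B s t) {u v : V} (hu : u ∈ R) (hv : v ∈ R) (hu' : u ∉ ({s, t} : Set V))
    (hv' : v ∉ ({s, t} : Set V)) : ReachableWithin G (B \ {s, t}) u v := by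
  by_cases huv : u = v
  · subst huv; exact ReachableWithin.rfl' ⟨h.1 hu, hu'⟩
  · by_contra hcon
    exact (h.2.1 hu hv huv).2.2 s t hst ⟨⟨h.1 hu, hu'⟩, ⟨h.1 hv, hv'⟩, hcon⟩

/-- two triconnected components meeting in a separating pair are separated by it -/
lemma IsTriCompOn.sep {G : SimpleGraph V} {B R R' : Set V} (h : IsTriCompOn G B R)
    (h' : IsTriCompOn G B R') (hne : R ≠ R') {s t : V} (hst : TriSepPairOn G B s t)
    (hs : s ∈ R) (ht : t ∈ R) (hs' : s ∈ R') (ht' : t ∈ R') {x y : V} (hx : x ∈ R) (hy : y ∈ R')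
    (hx' : x ∉ ({s, t} : Set V)) (hy' : y ∉ ({s, t} : Set V)) :
    ¬ ReachableWithin G (B \ {s, t}) x y := by
  have hnot : ¬ (R ∪ R').Pairwise (SameTriCompOn G B) := by
    intro hp
    have e1 := h.2.2 _ subset_union_left (union_subset h.1 h'.1) hp
    have e2 := h'.2.2 _ subset_union_right (union_subset h.1 h'.1) hp
    exact hne (e1.symm.trans e2)
  obtain ⟨u, hu, u', hu', p, q, hpq, hsep⟩ : ∃ u ∈ R, ∃ u' ∈ R', ∃ p q, TriSepPairOn G B p q ∧
      SeparatesOn G B p q u u' := by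
    by_contra hcon
    push Not at hcon
    have hcon' : ∀ u ∈ R, ∀ v ∈ R', SameTriCompOn G B u v ∧ SameTriCompOn G B v u := by
      intro u hu v hv
      refine ⟨⟨h.1 hu, h'.1 hv, fun p q hpq => hcon u hu v hv p q hpq⟩,
        ⟨h'.1 hv, h.1 hu, fun p q hpq hs => hcon u hu v hv p q hpq ⟨hs.2.1, hs.1, fun hr => ?_⟩⟩⟩
      exact hs.2.2 hr.symm'
    apply hnot
    rintro u (hu | hu) v (hv | hv) huv
    · exact h.2.1 hu hv huv
    · exact (hcon' u hu v hv).1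
    · exact (hcon' v hv u hu).2
    · exact h'.2.1 hu hv huv
  have hin : ∀ w ∈ R, w ∈ R' → w ∈ ({p, q} : Set V) := by
    intro w hw hw'
    by_contra hcon
    exact hsep.2.2 ((h.reach hpq hu hw hsep.1.2 hcon).trans' (h'.reach hpq hw' hu' hcon hsep.2.1.2))
  have hst' : s ≠ t := hst.1.2.2.1
  have heq : ({s, t} : Set V) = {p, q} := by
    have h1 := hin s hs hs'
    have h2 := hin t ht ht'
    simp only [mem_insert_iff, mem_singleton_iff] at h1 h2
    rcases h1 with rfl | rfl <;> rcases h2 with rfl | rfl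
    · exact absurd rfl hst'
    · rfl
    · exact pair_comm _ _
    · exact absurd rfl hst'
  intro hr
  have a1 := hsep.1.2
  have a2 := hsep.2.1.2
  have a3 := hsep.2.2
  rw [← heq] at a1 a2 a3
  exact a3 (((h.reach hst hu hx a1 hx').trans' hr).trans' (h'.reach hst hy hu' hy' a2))

lemma chain_sep {G : SimpleGraph V} {B : Set V} {n : ℕ} {R : ℕ → Set V} {P : ℕ → V × V}
    (hR : ∀ i ≤ n, IsTriCompOn G B (R i)) (hP : ∀ i < n, TriSepPairOn G B (P i).1 (P i).2)
    (hL : ∀ i < n, (P i).1 ∈ R i ∧ (P i).2 ∈ R i)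
    (hL' : ∀ i < n, (P i).1 ∈ R (i + 1) ∧ (P i).2 ∈ R (i + 1))
    (hinj : ∀ i ≤ n, ∀ j ≤ n, R i = R j → i = j) {m : ℕ} :
    ∀ j, m < j → j ≤ n → ∀ x ∈ R m, ∀ y ∈ R j, x ∉ ({(P m).1, (P m).2} : Set V) →
      y ∉ ({(P m).1, (P m).2} : Set V) →
      ¬ ReachableWithin G (B \ {(P m).1, (P m).2}) x y := by
  intro j hmj
  have hne : ∀ j, m < j → j ≤ n → R m ≠ R j := by
    intro j h1 h2 h3
    have := hinj m (by omega) j h2 h3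
    omega
  induction j, hmj using Nat.le_induction with
  | base =>
    intro hn x hx y hy hx' hy'
    exact (hR m (by omega)).sep (hR (m + 1) hn) (hne _ (by omega) hn) (hP m (by omega))
      (hL m (by omega)).1 (hL m (by omega)).2 (hL' m (by omega)).1 (hL' m (by omega)).2 hx hy hx' hy'
  | succ j hmj ih =>
    intro hn x hx y hy hx' hy'
    have hmn : m < n := by omega
    by_cases hsub : (P m).1 ∈ R (j + 1) ∧ (P m).2 ∈ R (j + 1)
    · exact (hR m (by omega)).sep (hR (j + 1) hn) (hne _ (by omega) hn) (hP m (by omega))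
        (hL m hmn).1 (hL m hmn).2 hsub.1 hsub.2 hx hy hx' hy'
    · obtain ⟨z, hz, hz1, hz2⟩ : ∃ z, z ∈ R j ∧ z ∈ R (j + 1) ∧
          z ∉ ({(P m).1, (P m).2} : Set V) := by
        obtain ⟨a1, a2⟩ := hL j (by omega)
        obtain ⟨b1, b2⟩ := hL' j (by omega)
        have hpj : (P j).1 ≠ (P j).2 := (hP j (by omega)).1.2.2.1
        by_contra hcon
        push Not at hcon
        have c1 := hcon _ a1 b1
        have c2 := hcon _ a2 b2
        simp only [mem_insert_iff, mem_singleton_iff] at c1 c2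
        apply hsub
        grind
      intro hr
      exact ih (by omega) x hx z hz hx' hz2
        (hr.trans' ((hR (j + 1) hn).reach (hP m hmn) hy hz1 hy' hz2))

lemma chain_inter {G : SimpleGraph V} {B : Set V} {n : ℕ} {R : ℕ → Set V} {P : ℕ → V × V}
    (hR : ∀ i ≤ n, IsTriCompOn G B (R i)) (hP : ∀ i < n, TriSepPairOn G B (P i).1 (P i).2)
    (hL : ∀ i < n, (P i).1 ∈ R i ∧ (P i).2 ∈ R i)
    (hL' : ∀ i < n, (P i).1 ∈ R (i + 1) ∧ (P i).2 ∈ R (i + 1))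
    (hinj : ∀ i ≤ n, ∀ j ≤ n, R i = R j → i = j) {m : ℕ} (j : ℕ) (h1 : m < j) (h2 : j ≤ n)
    (v : V) (hv : v ∈ R m) (hv' : v ∈ R j) : v = (P m).1 ∨ v = (P m).2 := by
  by_contra hcon
  have hc : v ∉ ({(P m).1, (P m).2} : Set V) := by simpa using hcon
  exact chain_sep hR hP hL hL' hinj j h1 h2 v hv v hv' hc hc
    (ReachableWithin.rfl' ⟨(hR j h2).1 hv', hc⟩)

theorem tail [Finite V] {Γ : ℕ → SimpleGraph V} {R : ℕ → Set V} {P : ℕ → V × V} {b : V} {n : ℕ}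
    (hsub : ∀ i, ∀ ⦃u v⦄, (Γ i).Adj u v → u ∈ R i ∧ v ∈ R i)
    (hK : ∀ i ≤ n, KConnectedOn 3 (Γ i) (R i))
    (eL : ∀ i < n, (Γ i).Adj (P i).1 (P i).2) (eR : ∀ i < n, (Γ (i + 1)).Adj (P i).1 (P i).2)
    (hint : ∀ m j, m < j → j ≤ n → ∀ v ∈ R m, v ∈ R j → v = (P m).1 ∨ v = (P m).2)
    (hb : b ∈ R n)
    (hfb : ∀ i, i + 1 = n → OnCommonFace (Γ n) (R n) {b, (P i).1, (P i).2})
    (hfm : ∀ i, i + 1 < n → OnCommonFace (Γ (i + 1)) (R (i + 1))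
      {(P i).1, (P i).2, (P (i + 1)).1, (P (i + 1)).2}) (d : ℕ) :
    ∀ m, m + 1 + d = n → ∃ (Γ' : SimpleGraph V) (X M : Set V) (pos : V → ℂ),
      (∀ u v, Γ'.Adj u v ↔ ∃ i, m < i ∧ i ≤ n ∧ (Γ i).Adj u v) ∧
      (∀ v, v ∈ X ↔ ∃ i, m < i ∧ i ≤ n ∧ v ∈ R i) ∧
      TD Γ' X M (P m).1 (P m).2 pos ∧ b ∈ M ∧
      ∀ i, m ≤ i → i < n → (P i).1 ∈ M ∧ (P i).2 ∈ M := by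
  induction d with
  | zero =>
    intro m hm
    have hm' : m + 1 = n := by omega
    have e := eR m (by omega)
    rw [hm'] at e
    obtain ⟨M, pos, hSM, hTD, -⟩ := td_of_face (hfb m hm') (hK n le_rfl) (hsub n)
      (S := {b, (P m).1, (P m).2})
      (by
        rintro v (rfl | rfl | rfl)
        exacts [hb, (hsub n e).1, (hsub n e).2])
      (s := (P m).1) (t := (P m).2) (by simp) (by simp) e
    refine ⟨Γ n, R n, M, pos, ?_, ?_, hTD, hSM (by simp), ?_⟩
    · intro u v
      refine ⟨fun h => ⟨n, by omega, le_rfl, h⟩, ?_⟩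
      rintro ⟨i, h1, h2, h3⟩
      obtain rfl : i = n := by omega
      exact h3
    · intro v
      refine ⟨fun h => ⟨n, by omega, le_rfl, h⟩, ?_⟩
      rintro ⟨i, h1, h2, h3⟩
      obtain rfl : i = n := by omega
      exact h3
    · intro i h1 h2
      obtain rfl : i = m := by omega
      exact ⟨hSM (by simp), hSM (by simp)⟩
  | succ d ih =>
    intro m hm
    obtain ⟨Γ', X, M', pos', hΓ', hX, hTD', hbM, hPM⟩ := ih (m + 1) (by omega)
    have e := eR m (by omega)
    have e' := eL (m + 1) (by omega)
    obtain ⟨M₁, pos₁, hSM, hTD, hzz⟩ := td_of_face (hfm m (by omega)) (hK (m + 1) (by omega))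
      (hsub (m + 1))
      (by
        rintro v (rfl | rfl | rfl | rfl)
        exacts [(hsub _ e).1, (hsub _ e).2, (hsub _ e').1, (hsub _ e').2])
      (s := (P m).1) (t := (P m).2) (by simp) (by simp) e
    have hinter : ∀ v ∈ R (m + 1), v ∈ X → v = (P (m + 1)).1 ∨ v = (P (m + 1)).2 := by
      intro v hv hv'
      obtain ⟨i, h1, h2, h3⟩ := (hX v).mp hv'
      exact hint (m + 1) i h1 h2 v hv h3
    have hadj : ∀ u v, (∃ i, m < i ∧ i ≤ n ∧ (Γ i).Adj u v) ↔ (Γ (m + 1)).Adj u v ∨ Γ'.Adj u v := by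
      intro u v
      rw [hΓ']
      constructor
      · rintro ⟨i, h1, h2, h3⟩
        by_cases hi : i = m + 1
        · subst hi; exact Or.inl h3
        · exact Or.inr ⟨i, by omega, h2, h3⟩
      · rintro (h | ⟨i, h1, h2, h3⟩)
        · exact ⟨m + 1, by omega, by omega, h⟩
        · exact ⟨i, by omega, h2, h3⟩
    have hmem : ∀ v, (∃ i, m < i ∧ i ≤ n ∧ v ∈ R i) ↔ v ∈ R (m + 1) ∨ v ∈ X := by
      intro v
      rw [hX]
      constructor
      · rintro ⟨i, h1, h2, h3⟩
        by_cases hi : i = m + 1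
        · subst hi; exact Or.inl h3
        · exact Or.inr ⟨i, by omega, h2, h3⟩
      · rintro (h | ⟨i, h1, h2, h3⟩)
        · exact ⟨m + 1, by omega, by omega, h⟩
        · exact ⟨i, by omega, h2, h3⟩
    by_cases hne : s((P (m + 1)).1, (P (m + 1)).2) = s((P m).1, (P m).2)
    · obtain ⟨pos'', hTD''⟩ : ∃ pos'', TD Γ' X M' (P m).1 (P m).2 pos'' := by
        rw [Sym2.eq_iff] at hne
        rcases hne with ⟨h1, h2⟩ | ⟨h1, h2⟩
        · rw [h1, h2] at hTD'; exact ⟨_, hTD'⟩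
        · rw [h1, h2] at hTD'; exact ⟨_, hTD'.swap⟩
      obtain ⟨pos, hpos⟩ := hTD.g3 hTD'' (by
        intro v hv hv'
        have := hinter v hv' hv
        rw [Sym2.eq_iff] at hne
        grind)
      refine ⟨_, _, _, _, ?_, ?_, hpos, hbM, ?_⟩
      · intro u v; rw [hadj, SimpleGraph.sup_adj]; exact or_comm
      · intro v; rw [hmem, mem_union]; exact or_comm
      · intro i h1 h2
        by_cases hi : i = m
        · subst hi; exact ⟨hpos.sM, hpos.tM⟩
        · exact hPM i (by omega) h2
    · obtain ⟨pos, hpos⟩ := hTD.g1 hzz (s' := (P (m + 1)).1) (t' := (P (m + 1)).2)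
        (hSM (by simp)) (hSM (by simp)) e' hne
        ((hK (m + 1) (by omega)).tc.cn2 _ _) hTD' hinter
      refine ⟨_, _, _, _, ?_, ?_, hpos, Or.inr hbM, ?_⟩
      · intro u v; rw [hadj, SimpleGraph.sup_adj]
      · intro v; rw [hmem, mem_union]
      · intro i h1 h2
        by_cases hi : i = m
        · subst hi; exact ⟨hpos.sM, hpos.tM⟩
        · exact ⟨Or.inr (hPM i (by omega) h2).1, Or.inr (hPM i (by omega) h2).2⟩

end F1

end

section
open Set Complex Topology Filter

section F2

variable {V : Type*}

lemma triCompGraph_sub {G : SimpleGraph V} {B R : Set V} ⦃u v : V⦄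
    (h : (triCompGraph G B R).Adj u v) : u ∈ R ∧ v ∈ R := by
  rw [triCompGraph, SimpleGraph.fromRel_adj] at h
  rcases h.2 with h | h
  exacts [⟨h.1, h.2.1⟩, ⟨h.2.1, h.1⟩]

lemma triCompGraph_edge {G : SimpleGraph V} {B R : Set V} {s t : V} (h : TriSepPairOn G B s t)
    (hs : s ∈ R) (ht : t ∈ R) : (triCompGraph G B R).Adj s t := by
  rw [triCompGraph, SimpleGraph.fromRel_adj]
  exact ⟨h.1.2.2.1, Or.inl ⟨hs, ht, Or.inr h⟩⟩

theorem final [Finite V] (G : SimpleGraph V) (B : Set V) (a b : V)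
    (k : ℕ) (sp : SPQRPathOn G B a b k)
    (hfa : OnCommonFace (triCompGraph G B (sp.R 0)) (sp.R 0)
      {a, (sp.P 0).1, (sp.P 0).2})
    (hfb : OnCommonFace (triCompGraph G B (sp.R (Fin.last (k + 1)))) (sp.R (Fin.last (k + 1)))
      {b, (sp.P (Fin.last k)).1, (sp.P (Fin.last k)).2})
    (hfm : ∀ i : Fin k,
      OnCommonFace (triCompGraph G B (sp.R i.succ.castSucc)) (sp.R i.succ.castSucc)
        {(sp.P i.castSucc).1, (sp.P i.castSucc).2, (sp.P i.succ).1, (sp.P i.succ).2}) :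
    ∃ (D : PlanarDrawingOn (⨆ i : Fin (k + 2), triCompGraph G B (sp.R i))
        (⋃ i : Fin (k + 2), sp.R i)) (F : Set (ℝ × ℝ)),
      D.IsOuterFace F ∧
      D.pos a ∈ frontier F ∧ D.pos b ∈ frontier F ∧
      ∀ i : Fin (k + 1), D.pos (sp.P i).1 ∈ frontier F ∧ D.pos (sp.P i).2 ∈ frontier F := by
  obtain ⟨R, hR⟩ : ∃ R : ℕ → Set V, ∀ i : Fin (k + 2), R i = sp.R i :=
    ⟨fun i => if h : i < k + 2 then sp.R ⟨i, h⟩ else ∅, fun i => by simp⟩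
  obtain ⟨P, hP⟩ : ∃ P : ℕ → V × V, ∀ i : Fin (k + 1), P i = sp.P i :=
    ⟨fun i => if h : i < k + 1 then sp.P ⟨i, h⟩ else sp.P 0, fun i => dif_pos i.2⟩
  have hRi : ∀ i (h : i < k + 2), R i = sp.R ⟨i, h⟩ := fun i h => hR ⟨i, h⟩
  have hPi : ∀ i (h : i < k + 1), P i = sp.P ⟨i, h⟩ := fun i h => hP ⟨i, h⟩
  have tR : ∀ i ≤ k + 1, IsTriCompOn G B (R i) := by
    intro i hi; rw [hRi i (by omega)]; exact (sp.rigid _).1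
  have tK : ∀ i ≤ k + 1, KConnectedOn 3 (triCompGraph G B (R i)) (R i) := by
    intro i hi; rw [hRi i (by omega)]; exact (sp.rigid _).2
  have tP : ∀ i < k + 1, TriSepPairOn G B (P i).1 (P i).2 := by
    intro i hi; rw [hPi i hi]; exact sp.sep _
  have tL : ∀ i < k + 1, (P i).1 ∈ R i ∧ (P i).2 ∈ R i := by
    intro i hi; rw [hPi i hi, hRi i (by omega)]; exact sp.linkL ⟨i, hi⟩
  have tL' : ∀ i < k + 1, (P i).1 ∈ R (i + 1) ∧ (P i).2 ∈ R (i + 1) := by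
    intro i hi; rw [hPi i hi, hRi (i + 1) (by omega)]; exact sp.linkR ⟨i, hi⟩
  have tinj : ∀ i ≤ k + 1, ∀ j ≤ k + 1, R i = R j → i = j := by
    intro i hi j hj hij
    rw [hRi i (by omega), hRi j (by omega)] at hij
    simpa using sp.R_inj hij
  have tint : ∀ m j, m < j → j ≤ k + 1 → ∀ v ∈ R m, v ∈ R j → v = (P m).1 ∨ v = (P m).2 :=
    fun m j h1 h2 v hv hv' => chain_inter tR tP tL tL' tinj j h1 h2 v hv hv'
  have eL : ∀ i < k + 1, (triCompGraph G B (R i)).Adj (P i).1 (P i).2 := fun i hi =>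
    triCompGraph_edge (tP i hi) (tL i hi).1 (tL i hi).2
  have eR : ∀ i < k + 1, (triCompGraph G B (R (i + 1))).Adj (P i).1 (P i).2 := fun i hi =>
    triCompGraph_edge (tP i hi) (tL' i hi).1 (tL' i hi).2
  have hlast : R (k + 1) = sp.R (Fin.last (k + 1)) := hR (Fin.last (k + 1))
  have hzero : R 0 = sp.R 0 := hR 0
  have hPz : P 0 = sp.P 0 := hP 0
  obtain ⟨Γ', X, M, pos, hΓ', hX, hTD, hbM, hPM⟩ := tail (Γ := fun i => triCompGraph G B (R i))
    (R := R) (P := P) (b := b) (n := k + 1) (fun i => triCompGraph_sub) tK eL eR tint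
    (by rw [hlast]; exact sp.hb)
    (by
      intro i hi
      obtain rfl : i = k := by omega
      have e : P i = sp.P (Fin.last i) := hP (Fin.last i)
      simp only [hlast, e]
      exact hfb)
    (by
      intro i hi
      have hik : i < k := by omega
      have := hfm ⟨i, hik⟩
      rw [← hR, ← hP, ← hP] at this
      exact this)
    k 0 (by omega)
  rw [← hzero, ← hPz] at hfa
  obtain ⟨M₀, pos₀, hSM, hTD₀, -⟩ := td_of_face hfa (tK 0 (by omega)) triCompGraph_sub
    (by
      rintro v (rfl | rfl | rfl)
      · rw [hzero]; exact sp.ha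
      · exact (tL 0 (by omega)).1
      · exact (tL 0 (by omega)).2)
    (s := (P 0).1) (t := (P 0).2) (by simp) (by simp) (eL 0 (by omega))
  obtain ⟨D, F, hF, hD⟩ := hTD₀.g2 hTD (by
    intro v hv hv'
    obtain ⟨i, h1, h2, h3⟩ := (hX v).mp hv'
    exact tint 0 i h1 h2 v hv h3)
  have eΓ : triCompGraph G B (R 0) ⊔ Γ' = ⨆ i : Fin (k + 2), triCompGraph G B (sp.R i) := by
    ext u v
    rw [SimpleGraph.sup_adj, hΓ', SimpleGraph.iSup_adj]
    constructor
    · rintro (h | ⟨i, h1, h2, h3⟩)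
      · exact ⟨0, by rwa [hzero] at h⟩
      · exact ⟨⟨i, by omega⟩, by rwa [hRi i (by omega)] at h3⟩
    · rintro ⟨⟨i, hi⟩, h⟩
      rw [← hRi i hi] at h
      rcases Nat.eq_zero_or_pos i with rfl | h0
      · exact Or.inl h
      · exact Or.inr ⟨i, h0, by omega, h⟩
  have eX : R 0 ∪ X = ⋃ i : Fin (k + 2), sp.R i := by
    ext v
    rw [mem_union, hX, mem_iUnion]
    constructor
    · rintro (h | ⟨i, h1, h2, h3⟩)
      · exact ⟨0, by rwa [hzero] at h⟩
      · exact ⟨⟨i, by omega⟩, by rwa [hRi i (by omega)] at h3⟩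
    · rintro ⟨⟨i, hi⟩, h⟩
      rw [← hRi i hi] at h
      rcases Nat.eq_zero_or_pos i with rfl | h0
      · exact Or.inl h
      · exact Or.inr ⟨i, h0, by omega, h⟩
  rw [← eΓ, ← eX]
  refine ⟨D, F, hF, hD a (Or.inl (hSM (by simp))), hD b (Or.inr hbM), fun i => ?_⟩
  rw [← hP i]
  exact ⟨hD _ (Or.inr (hPM i (by omega) i.2).1), hD _ (Or.inr (hPM i (by omega) i.2).2)⟩

end F2

end

/-- If the face conditions (a), (b), (c) hold along the SPQR-tree
path, then the subgraph `G_ab` consisting of the triconnected components on the path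
has a planar embedding with all separating-pair vertices together with `a` and `b`
on the boundary of the outer face. -/
theorem stmt6 {V : Type*} [Fintype V] (G : SimpleGraph V) (hplanar : G.IsPlanar)
    (B : Set V) (hB : IsBlock G B)
    (a b : V) (ha : a ∈ B) (hb : b ∈ B)
    (htri : ¬ SameTriCompOn G B a b)
    (k : ℕ) (sp : SPQRPathOn G B a b k)
    (hfa : OnCommonFace (triCompGraph G B (sp.R 0)) (sp.R 0)
      {a, (sp.P 0).1, (sp.P 0).2})
    (hfb : OnCommonFace (triCompGraph G B (sp.R (Fin.last (k + 1)))) (sp.R (Fin.last (k + 1)))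
      {b, (sp.P (Fin.last k)).1, (sp.P (Fin.last k)).2})
    (hfm : ∀ i : Fin k,
      OnCommonFace (triCompGraph G B (sp.R i.succ.castSucc)) (sp.R i.succ.castSucc)
        {(sp.P i.castSucc).1, (sp.P i.castSucc).2, (sp.P i.succ).1, (sp.P i.succ).2}) :
    ∃ (D : PlanarDrawingOn (⨆ i : Fin (k + 2), triCompGraph G B (sp.R i))
        (⋃ i : Fin (k + 2), sp.R i)) (F : Set (ℝ × ℝ)),
      D.IsOuterFace F ∧
      D.pos a ∈ frontier F ∧ D.pos b ∈ frontier F ∧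
      ∀ i : Fin (k + 1), D.pos (sp.P i).1 ∈ frontier F ∧ D.pos (sp.P i).2 ∈ frontier F := by
  exact final G B a b k sp hfa hfb hfm
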